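/- arXiv:1311.4477 — 3 statements merged into one kernel-verified Lean document; each statement's English description precedes it below -/
import Mathlib

section
/- Let p ≥ 3, let λ ∈ ℂ_p be not a root of unity with 1/p < |1-λ| < 1, and let P_λ(x) = λx + x². Then the coefficients b_k of the conjugacy H_{P_λ} satisfy, for every integer k ≥ 2, |b_k| = |1-λ|^{⌊(k-1)/p⌋} / Π_{n=1}^{k-1} |1 - λ^n|. -/
open scoped BigOperators

noncomputable section

/-- `R(s) = p^{-1/(p^{s-1}(p-1))}` for `s ≥ 1`, and `R(0) = 0`. -/
def Rr (p : ℕ) (s : ℕ) : ℝ :=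
  if s = 0 then 0 else (p : ℝ) ^ (-(1 : ℝ) / ((p : ℝ) ^ (s - 1) * ((p : ℝ) - 1)))

/-- The group `Γ_r` of `p`-power roots of unity. -/
def GammaR (p : ℕ) (K : Type*) [Monoid K] : Set K := {z | ∃ k : ℕ, z ^ p ^ k = 1}

/-- The quantity `r̃(λ)`. -/
def rTilde {K : Type*} [NontriviallyNormedField K] (p : ℕ) (lam γ₀ : K) (m s t : ℕ) : ℝ :=
  Rr p (s + 1) ^ ((1 : ℝ) / m) *
    (p : ℝ) ^ (-(((s : ℝ) - (t : ℝ)) / ((m : ℝ) * (p : ℝ) ^ s))) *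
    ‖1 - lam ^ m‖ ^ ((s : ℝ) * ((p : ℝ) - 1) / ((m : ℝ) * (p : ℝ))) *
    ‖γ₀ - lam ^ m‖ ^ ((1 : ℝ) / ((m : ℝ) * (p : ℝ) ^ ((s : ℝ) - (t : ℝ))))

/-- Coefficient of `x^k` in the formal composition `H ∘ F`, where `H, F` are given by their
coefficient sequences `b, c` and `F` has zero constant term. -/
def compCoeff {K : Type*} [Field K] (b c : ℕ → K) (k : ℕ) : K :=
  ∑ l ∈ Finset.range (k + 1), b l * PowerSeries.coeff k ((PowerSeries.mk c) ^ l)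

/-- `b` is (the coefficient sequence of) the normalized formal linearizing conjugacy `H_f` for the
power series `f` with coefficient sequence `c`: `H(0)=0`, `H'(0)=1` and `H ∘ f = λ·H` as formal
power series. -/
def IsConjugacy {K : Type*} [Field K] (lam : K) (c b : ℕ → K) : Prop :=
  b 0 = 0 ∧ b 1 = 1 ∧ ∀ k, compCoeff b c k = lam * b k

/-- Evaluation of the power series with coefficients `b` at `x`. -/
def pEval {K : Type*} [NontriviallyNormedField K] (b : ℕ → K) (x : K) : K :=
  ∑' k, b k * x ^ k

/-- `f` is analytically linearizable on `U` (a disk about `0`): `f` maps `U` to itself and some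
convergent power series `h` with `h(0)=0`, `h'(0)=1` maps `U` bijectively onto itself and
conjugates `f` to `x ↦ λx` on `U`. -/
def LinearizableOn {K : Type*} [NontriviallyNormedField K] (f : K → K) (lam : K)
    (U : Set K) : Prop :=
  Set.MapsTo f U U ∧
    ∃ b : ℕ → K, b 0 = 0 ∧ b 1 = 1 ∧
      (∀ x ∈ U, Summable fun k => b k * x ^ k) ∧
      Set.BijOn (pEval b) U U ∧
      ∀ x ∈ U, pEval b (f x) = lam * pEval b x

/-- A disk about `0`: an open or closed ball centered at the origin. -/
def IsZeroDisk {K : Type*} [NontriviallyNormedField K] (U : Set K) : Prop :=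
  ∃ ρ : ℝ, U = Metric.ball (0 : K) ρ ∨ U = Metric.closedBall (0 : K) ρ

/-- `x` is a periodic point of `f` of minimal period `q`. -/
def IsMinPeriodicPt {K : Type*} (f : K → K) (q : ℕ) (x : K) : Prop :=
  f^[q] x = x ∧ ∀ j, 1 ≤ j → j < q → f^[j] x ≠ x

/-- The valuation `ν(x) = -log_p |x|`. -/
def nuP {K : Type*} [NontriviallyNormedField K] (p : ℕ) (z : K) : ℝ :=
  -Real.logb p ‖z‖

/-- `κ_n = -(ν(1-λ^{p^n}) - ν(1-λ^{p^{n-1}}))/p^n`. -/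
def kappaN {K : Type*} [NontriviallyNormedField K] (p : ℕ) (lam : K) (n : ℕ) : ℝ :=
  -(nuP p (1 - lam ^ p ^ n) - nuP p (1 - lam ^ p ^ (n - 1))) / (p : ℝ) ^ n

open Classical in
/-- The multiplicity of `x` as a zero of the analytic function `g`. -/
def analyticMult {K : Type*} [NontriviallyNormedField K] (g : K → K) (x : K) : ℕ :=
  if h : AnalyticAt K g x then (analyticOrderAt g x).toNat else 0

/-- The radius `r(P_λ) = |1-λ|^{-1/p}·r̃(λ)` of quadratic linearization disks. -/
def rQuad {K : Type*} [NontriviallyNormedField K] (p : ℕ) (lam γ₀ : K) (m s t : ℕ) : ℝ :=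
  ‖1 - lam‖ ^ (-(1 : ℝ) / (p : ℝ)) * rTilde p lam γ₀ m s t

/-- The quantity `Ψ(λ) = |1-λ|^{-1/p}·p^{-(s-t)/p^s}·|γ₀-λ|^{1/p^{s-t}}` (case `m = 1`). -/
def PsiL {K : Type*} [NontriviallyNormedField K] (p : ℕ) (lam γ₀ : K) (s t : ℕ) : ℝ :=
  ‖1 - lam‖ ^ (-(1 : ℝ) / (p : ℝ)) *
    (p : ℝ) ^ (-(((s : ℝ) - (t : ℝ)) / (p : ℝ) ^ s)) *
    ‖γ₀ - lam‖ ^ ((1 : ℝ) / (p : ℝ) ^ ((s : ℝ) - (t : ℝ)))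

/-- Coefficient sequence of the quadratic polynomial `P_λ(x) = λx + x²`. -/
def quadCoeff {K : Type*} [Field K] (lam : K) : ℕ → K :=
  fun i => if i = 1 then lam else if i = 2 then 1 else 0

/-- `δ(z) = (k-1)/z - ⌊(k-1)/z⌋` as a rational number. -/
def deltaFrac (k z : ℕ) : ℚ :=
  ((k : ℚ) - 1) / (z : ℚ) - (((k - 1) / z : ℕ) : ℚ)

end

section Ultrametric

variable {K : Type*} [NontriviallyNormedField K] [IsUltrametricDist K]

/-- In an ultrametric field, a finite sum with a strictly dominant term has the norm of that
term. -/
theorem norm_sum_eq_of_dominant {ι : Type*} [DecidableEq ι] {s : Finset ι} {f : ι → K} {i : ι}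
    {C : ℝ} (hi : i ∈ s) (hC : 0 ≤ C) (hlt : C < ‖f i‖) (h : ∀ j ∈ s, j ≠ i → ‖f j‖ ≤ C) :
    ‖∑ j ∈ s, f j‖ = ‖f i‖ := by
  have hrest : ‖∑ j ∈ s.erase i, f j‖ ≤ C :=
    IsUltrametricDist.norm_sum_le_of_forall_le_of_nonneg hC fun j hj =>
      h j (Finset.mem_of_mem_erase hj) (Finset.ne_of_mem_erase hj)
  have hlt' : ‖∑ j ∈ s.erase i, f j‖ < ‖f i‖ := hrest.trans_lt hlt
  rw [← Finset.add_sum_erase s f hi,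
    IsUltrametricDist.norm_add_eq_max_of_norm_ne_norm hlt'.ne', max_eq_left hlt'.le]

theorem norm_eq_one_of_norm_one_sub_lt_one {x : K} (hx : ‖1 - x‖ < 1) : ‖x‖ = 1 := by
  have h : ‖(1 : K)‖ ≠ ‖-(1 - x)‖ := by rw [norm_one, norm_neg]; exact hx.ne'
  have h1 := IsUltrametricDist.norm_add_eq_max_of_norm_ne_norm h
  rw [norm_neg, norm_one, max_eq_left hx.le] at h1
  simpa using h1

theorem norm_one_sub_pow_le {x : K} (hx : ‖x‖ ≤ 1) (n : ℕ) : ‖1 - x ^ n‖ ≤ ‖1 - x‖ := by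
  rw [← mul_neg_geom_sum, norm_mul]
  refine mul_le_of_le_one_right (norm_nonneg _) ?_
  refine IsUltrametricDist.norm_sum_le_of_forall_le_of_nonneg zero_le_one fun i _ => ?_
  rw [norm_pow]
  exact pow_le_one₀ (norm_nonneg _) hx

/-- If `|1 - x| < 1` and `n` is a unit, then `|1 - x ^ n| = |1 - x|`. -/
theorem norm_one_sub_pow_eq {x : K} (hx : ‖1 - x‖ < 1) {n : ℕ} (hn : ‖(n : K)‖ = 1) :
    ‖1 - x ^ n‖ = ‖1 - x‖ := by
  rw [← mul_neg_geom_sum, norm_mul]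
  have hrest : ‖∑ i ∈ Finset.range n, (1 - x ^ i)‖ ≤ ‖1 - x‖ :=
    IsUltrametricDist.norm_sum_le_of_forall_le_of_nonneg (norm_nonneg _) fun i _ =>
      norm_one_sub_pow_le (norm_eq_one_of_norm_one_sub_lt_one hx).le i
  have hlt : ‖-∑ i ∈ Finset.range n, (1 - x ^ i)‖ < ‖(n : K)‖ := by
    rw [norm_neg, hn]; exact hrest.trans_lt hx
  have hsum : ∑ i ∈ Finset.range n, x ^ i = n + -∑ i ∈ Finset.range n, (1 - x ^ i) := by
    simp
  rw [hsum, IsUltrametricDist.norm_add_eq_max_of_norm_ne_norm hlt.ne', max_eq_left hlt.le, hn,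
    mul_one]

/-- If `|p| ≤ |1 - x| < 1` for a prime `p ≥ 3`, then `|1 - x ^ p| ≤ |1 - x| ^ 2`. -/
theorem norm_one_sub_pow_prime_le {p : ℕ} (hp : p.Prime) (hp3 : 3 ≤ p) {x : K}
    (hx : ‖1 - x‖ ≤ 1) (hpx : ‖(p : K)‖ ≤ ‖1 - x‖) : ‖1 - x ^ p‖ ≤ ‖1 - x‖ ^ 2 := by
  have hsum : x ^ p - 1 = ∑ j ∈ Finset.range p, (x - 1) ^ (j + 1) * (p.choose (j + 1) : K) := by
    have h := add_pow (x - 1) 1 p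
    rw [Finset.sum_range_succ', sub_add_cancel] at h
    simp [h]
  rw [norm_sub_rev, hsum]
  refine IsUltrametricDist.norm_sum_le_of_forall_le_of_nonneg (by positivity) fun j hj => ?_
  have hjp : j + 1 ≤ p := Finset.mem_range.mp hj
  rw [norm_mul, norm_pow, norm_sub_rev x 1]
  rcases hjp.lt_or_eq with hlt | heq
  · obtain ⟨c, hc⟩ := hp.dvd_choose_self (Nat.succ_ne_zero j) hlt
    rw [hc, Nat.cast_mul, norm_mul, pow_succ, sq]
    have h1 : ‖1 - x‖ ^ j * ‖1 - x‖ ≤ ‖1 - x‖ :=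
      mul_le_of_le_one_left (norm_nonneg _) (pow_le_one₀ (norm_nonneg _) hx)
    have h2 : ‖(p : K)‖ * ‖(c : K)‖ ≤ ‖1 - x‖ :=
      (mul_le_of_le_one_right (norm_nonneg _) (IsUltrametricDist.norm_natCast_le_one K c)).trans hpx
    gcongr
  · rw [heq, Nat.choose_self, Nat.cast_one, norm_one, mul_one]
    exact pow_le_pow_of_le_one (norm_nonneg _) hx (by lia)

end Ultrametric

section NormNatCast

variable {p : ℕ} [Fact p.Prime] {K : Type*} [NormedField K] [Algebra ℚ_[p] K]

theorem norm_natCast_eq_padic (hiso : ∀ x : ℚ_[p], ‖algebraMap ℚ_[p] K x‖ = ‖x‖) (n : ℕ) :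
    ‖(n : K)‖ = ‖(n : ℚ_[p])‖ := by
  rw [← hiso, map_natCast]

theorem norm_natCast_eq_one_of_not_dvd (hiso : ∀ x : ℚ_[p], ‖algebraMap ℚ_[p] K x‖ = ‖x‖) {n : ℕ}
    (hn : ¬ p ∣ n) : ‖(n : K)‖ = 1 := by
  rw [norm_natCast_eq_padic hiso]
  refine le_antisymm (by simpa using Padic.norm_int_le_one (p := p) n) ?_
  rw [← not_lt, Padic.norm_natCast_lt_one_iff]
  exact hn

end NormNatCast

section Recurrence

theorem coeff_mk_quadCoeff_pow {K : Type*} [Field K] (lam : K) (l j : ℕ) :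
    PowerSeries.coeff (l + j) (PowerSeries.mk (quadCoeff lam) ^ l) =
      lam ^ (l - j) * (l.choose j : K) := by
  have h : PowerSeries.mk (quadCoeff lam) =
      PowerSeries.X * ((Polynomial.X + Polynomial.C lam : Polynomial K) : PowerSeries K) := by
    ext n
    rcases n with _ | _ | _ | n <;>
      simp [quadCoeff, mul_comm PowerSeries.X, PowerSeries.coeff_succ_mul_X,
        PowerSeries.coeff_X]
  rw [h, mul_pow, add_comm l j, PowerSeries.coeff_X_pow_mul, ← Polynomial.coe_pow,
    Polynomial.coeff_coe, Polynomial.coeff_X_add_C_pow]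

/-- The recurrence satisfied by the coefficients of the conjugacy of `λ x + x ^ 2`. -/
theorem IsConjugacy.recurrence {K : Type*} [Field K] {lam : K} {b : ℕ → K}
    (hb : IsConjugacy lam (quadCoeff lam) b) (m : ℕ) :
    lam * (1 - lam ^ (m + 1)) * b (m + 2) = ∑ i ∈ Finset.range (m + 1),
      b (i + 1) * (lam ^ (i + 1 - (m + 1 - i)) * ((i + 1).choose (m + 1 - i) : K)) := by
  have h := hb.2.2 (m + 2)
  rw [compCoeff, Finset.sum_range_succ, Finset.sum_range_succ', hb.1, zero_mul, add_zero] at h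
  have hlast := coeff_mk_quadCoeff_pow lam (m + 2) 0
  rw [add_zero, Nat.choose_zero_right, Nat.cast_one, mul_one, Nat.sub_zero] at hlast
  rw [hlast] at h
  have hsum : ∑ i ∈ Finset.range (m + 1),
        b (i + 1) * PowerSeries.coeff (m + 2) (PowerSeries.mk (quadCoeff lam) ^ (i + 1)) =
      ∑ i ∈ Finset.range (m + 1),
        b (i + 1) * (lam ^ (i + 1 - (m + 1 - i)) * ((i + 1).choose (m + 1 - i) : K)) := by
    refine Finset.sum_congr rfl fun i hi => ?_
    have hi' := Finset.mem_range.mp hi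
    rw [← coeff_mk_quadCoeff_pow, show i + 1 + (m + 1 - i) = m + 2 by lia]
  rw [← hsum]
  linear_combination -h

end Recurrence

section CoefficientSize

variable {K : Type*} [NontriviallyNormedField K]

/-- The claimed norm of the coefficient of `x ^ (m + 1)` in the conjugacy of `λ x + x ^ 2`. -/
noncomputable def quadCoeffSize (p : ℕ) (lam : K) (m : ℕ) : ℝ :=
  ‖1 - lam‖ ^ (m / p) / ∏ n ∈ Finset.Icc 1 m, ‖1 - lam ^ n‖

variable {p : ℕ} {lam : K}

theorem quadCoeffSize_pos (hroot : ∀ n : ℕ, 1 ≤ n → lam ^ n ≠ 1) (m : ℕ) :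
    0 < quadCoeffSize p lam m := by
  have hpos : ∀ n : ℕ, 1 ≤ n → 0 < ‖1 - lam ^ n‖ := fun n hn =>
    norm_pos_iff.mpr (sub_ne_zero.mpr (hroot n hn).symm)
  have h1 : 0 < ‖1 - lam‖ := by simpa using hpos 1 le_rfl
  exact div_pos (pow_pos h1 _) (Finset.prod_pos fun n hn => hpos n (Finset.mem_Icc.mp hn).1)

theorem quadCoeffSize_succ_of_dvd {m : ℕ} (h : p ∣ m + 1) :
    quadCoeffSize p lam (m + 1) = ‖1 - lam‖ * quadCoeffSize p lam m / ‖1 - lam ^ (m + 1)‖ := by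
  rw [quadCoeffSize, quadCoeffSize, Finset.prod_Icc_succ_top (by lia), Nat.succ_div_of_dvd h]
  ring

theorem quadCoeffSize_succ_of_not_dvd {m : ℕ} (h : ¬ p ∣ m + 1) :
    quadCoeffSize p lam (m + 1) = quadCoeffSize p lam m / ‖1 - lam ^ (m + 1)‖ := by
  rw [quadCoeffSize, quadCoeffSize, Finset.prod_Icc_succ_top (by lia), Nat.succ_div_of_not_dvd h]
  ring

end CoefficientSize

/-- Lemma: exact coefficient sizes for the quadratic conjugacy.
For `p ≥ 3` and `1/p < |1-λ| < 1`, the coefficients of `H_{P_λ}` satisfy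
`|b_k| = |1-λ|^{⌊(k-1)/p⌋} / Π_{n=1}^{k-1}|1-λ^n|` for all `k ≥ 2`. -/
theorem stmt11 (p : ℕ) [Fact p.Prime] (hp3 : 3 ≤ p)
    {K : Type*} [NontriviallyNormedField K] [IsUltrametricDist K] [CompleteSpace K]
    [IsAlgClosed K] [Algebra ℚ_[p] K]
    (hiso : ∀ x : ℚ_[p], ‖algebraMap ℚ_[p] K x‖ = ‖x‖)
    (hdense : Dense {x : K | IsAlgebraic ℚ_[p] x})
    (lam : K) (hroot : ∀ n : ℕ, 1 ≤ n → lam ^ n ≠ 1)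
    (hlam1 : 1 / (p : ℝ) < ‖1 - lam‖) (hlam2 : ‖1 - lam‖ < 1)
    (b : ℕ → K) (hb : IsConjugacy lam (quadCoeff lam) b) :
    ∀ k : ℕ, 2 ≤ k →
      ‖b k‖ = ‖1 - lam‖ ^ ((k - 1) / p : ℕ) / ∏ n ∈ Finset.Icc 1 (k - 1), ‖1 - lam ^ n‖ := by
  have hp : p.Prime := Fact.out
  set a := ‖1 - lam‖ with ha
  have ha0 : 0 < a := lt_of_le_of_lt (by positivity) hlam1
  have hlam : ‖lam‖ = 1 := norm_eq_one_of_norm_one_sub_lt_one hlam2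
  have hnp : ‖(p : K)‖ < a := by
    rw [norm_natCast_eq_padic hiso, Padic.norm_p, ← one_div]; exact hlam1
  have hD0 : ∀ n : ℕ, 0 < ‖1 - lam ^ (n + 1)‖ := fun n =>
    norm_pos_iff.mpr (sub_ne_zero.mpr (hroot (n + 1) (by lia)).symm)
  have hunit : ∀ n : ℕ, ¬ p ∣ n → ‖1 - lam ^ n‖ = a := fun n hn =>
    norm_one_sub_pow_eq hlam2 (norm_natCast_eq_one_of_not_dvd hiso hn)
  have hdvd : ∀ n : ℕ, p ∣ n → ‖1 - lam ^ n‖ ≤ a ^ 2 := by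
    rintro _ ⟨j, rfl⟩
    rw [pow_mul]
    refine (norm_one_sub_pow_le ?_ j).trans (norm_one_sub_pow_prime_le hp hp3 hlam2.le hnp.le)
    rw [norm_pow, hlam, one_pow]
  have hFpos : ∀ m, 0 < quadCoeffSize p lam m := quadCoeffSize_pos hroot
  have hFeq : ∀ m, ¬ p ∣ m + 1 → quadCoeffSize p lam m = a * quadCoeffSize p lam (m + 1) := by
    intro m hm
    rw [quadCoeffSize_succ_of_not_dvd hm, hunit _ hm]
    field_simp
  have hFstep : ∀ m, quadCoeffSize p lam m ≤ a * quadCoeffSize p lam (m + 1) := by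
    intro m
    by_cases hm : p ∣ m + 1
    · rw [quadCoeffSize_succ_of_dvd hm, ← ha, mul_div_assoc', le_div_iff₀ (hD0 m)]
      nlinarith [mul_le_mul_of_nonneg_left (hdvd _ hm) (hFpos m).le]
    · exact (hFeq m hm).le
  have hFle : ∀ i j, quadCoeffSize p lam i ≤ a ^ j * quadCoeffSize p lam (i + j) := by
    intro i j
    induction j with
    | zero => simp
    | succ j ih =>
      refine ih.trans ?_
      rw [pow_succ, mul_assoc]
      exact mul_le_mul_of_nonneg_left (hFstep (i + j)) (by positivity)
  have key : ∀ m, ‖b (m + 1)‖ = quadCoeffSize p lam m := by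
    intro m
    induction m using Nat.strong_induction_on with
    | _ m ih =>
    rcases m with _ | m
    · simp [hb.2.1, quadCoeffSize]
    have hrec := congrArg norm (hb.recurrence m)
    rw [norm_mul, norm_mul, hlam, one_mul] at hrec
    set f : ℕ → K := fun i =>
      b (i + 1) * (lam ^ (i + 1 - (m + 1 - i)) * ((i + 1).choose (m + 1 - i) : K)) with hf
    have hnorm : ∀ i ≤ m,
        ‖f i‖ = quadCoeffSize p lam i * ‖((i + 1).choose (m + 1 - i) : K)‖ := by
      intro i hi
      simp only [hf, norm_mul, norm_pow, hlam, one_pow, one_mul, ih i (by lia)]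
    have hfle : ∀ i ≤ m, ∀ j ≤ m - i, ‖f i‖ ≤ a ^ j * quadCoeffSize p lam m := by
      intro i hi j hj
      rw [hnorm i hi]
      refine (mul_le_of_le_one_right (hFpos i).le
        (IsUltrametricDist.norm_natCast_le_one K _)).trans ((hFle i (m - i)).trans ?_)
      rw [show i + (m - i) = m by lia]
      exact mul_le_mul_of_nonneg_right (pow_le_pow_of_le_one ha0.le hlam2.le hj) (hFpos m).le
    have hfm : ‖f m‖ = quadCoeffSize p lam m * ‖((m + 1 : ℕ) : K)‖ := by
      rw [hnorm m le_rfl, show m + 1 - m = 1 by lia, Nat.choose_one_right]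
    have hsum : ‖∑ i ∈ Finset.range (m + 1), f i‖ =
        ‖1 - lam ^ (m + 1)‖ * quadCoeffSize p lam (m + 1) := by
      by_cases hm : p ∣ m + 1
      · rw [quadCoeffSize_succ_of_dvd hm, mul_div_cancel₀ _ (hD0 m).ne', ← ha]
        have hpm := Nat.le_of_dvd (by lia) hm
        obtain ⟨n, rfl⟩ : ∃ n, m = n + 1 := ⟨m - 1, by lia⟩
        have hn1 : ¬ p ∣ n + 1 := fun h => by
          have := Nat.le_of_dvd one_pos ((Nat.dvd_add_right h).mp hm); lia
        have hn0 : ¬ p ∣ n := fun h => by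
          have := Nat.le_of_dvd two_pos ((Nat.dvd_add_right h).mp hm); lia
        have hchoose : ¬ p ∣ (n + 1).choose 2 := by
          intro h
          have h2 : (n + 1).choose 2 * 2 = (n + 1) * n := by
            rw [Nat.choose_two_right, Nat.add_sub_cancel]
            exact Nat.div_mul_cancel (by rw [mul_comm]; exact (Nat.even_mul_succ_self n).two_dvd)
          rcases hp.dvd_mul.mp (h2 ▸ h.mul_right 2) with h | h
          exacts [hn1 h, hn0 h]
        have hfn : ‖f n‖ = a * quadCoeffSize p lam (n + 1) := by
          rw [hnorm n (by lia), show n + 1 + 1 - n = 2 by lia,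
            norm_natCast_eq_one_of_not_dvd hiso hchoose, mul_one, hFeq n hn1]
        rw [← hfn]
        have hsmall : max ‖(p : K)‖ (a ^ 2) < a := max_lt hnp (by nlinarith)
        refine norm_sum_eq_of_dominant (C := max ‖(p : K)‖ (a ^ 2) * quadCoeffSize p lam (n + 1))
          (Finset.mem_range.mpr (by lia))
          (mul_nonneg (le_max_of_le_left (norm_nonneg _)) (hFpos _).le)
          (hfn ▸ mul_lt_mul_of_pos_right hsmall (hFpos _)) fun j hj hjn => ?_
        have hj' := Finset.mem_range.mp hj
        rcases eq_or_ne j (n + 1) with rfl | hne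
        · rw [hfm, mul_comm]
          refine mul_le_mul_of_nonneg_right (le_max_of_le_left ?_) (hFpos _).le
          obtain ⟨c, hc⟩ := hm
          rw [hc, Nat.cast_mul, norm_mul]
          exact mul_le_of_le_one_right (norm_nonneg _) (IsUltrametricDist.norm_natCast_le_one K c)
        · exact (hfle j (by lia) 2 (by lia)).trans
            (mul_le_mul_of_nonneg_right (le_max_right _ _) (hFpos _).le)
      · rw [quadCoeffSize_succ_of_not_dvd hm, mul_div_cancel₀ _ (hD0 m).ne']
        have hfm' : ‖f m‖ = quadCoeffSize p lam m := by
          rw [hfm, norm_natCast_eq_one_of_not_dvd hiso hm, mul_one]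
        rw [← hfm']
        refine norm_sum_eq_of_dominant (C := a * quadCoeffSize p lam m)
          (Finset.mem_range.mpr (by lia)) (mul_nonneg ha0.le (hFpos m).le)
          (hfm'.symm ▸ mul_lt_of_lt_one_left (hFpos m) hlam2) fun j hj hjm => ?_
        have hj' := Finset.mem_range.mp hj
        simpa using hfle j (by lia) 1 (by lia)
    rw [hsum] at hrec
    exact mul_left_cancel₀ (hD0 m).ne' hrec
  intro k hk
  obtain ⟨m, rfl⟩ : ∃ m, k = m + 1 := ⟨k - 1, by lia⟩
  exact key m
end

section
/- Let p ≥ 3, let λ ∈ ℂ_p be not a root of unity with 1/p < |1-λ| < 1, let P_λ(x) = λx + x², and set τ = |1-λ|^{-1/p} · r̃(λ). Then the coefficients b_k of the conjugacy H_{P_λ} satisfy |b_k|·τ^k < τ for every k ≥ 2; if s ≥ 1, then |b_k|·τ^k ≤ R(s+1)·τ for every k ≥ 2; and if k - 1 = p^{s+α} for some integer α ≥ 1, then |b_k|·τ^k = p^{-1/(p-1)}·τ. -/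
open scoped BigOperators

namespace QuadraticLinearization

section Ultrametric

variable {K : Type*} [NontriviallyNormedField K] [IsUltrametricDist K]

/-- A strictly dominant term determines the norm of an ultrametric sum. -/
lemma norm_sum_eq_of_dominant {ι : Type*} [DecidableEq ι] {S : Finset ι} {f : ι → K} {i : ι}
    (hi : i ∈ S) (hpos : 0 < ‖f i‖) (h : ∀ j ∈ S, j ≠ i → ‖f j‖ < ‖f i‖) :
    ‖∑ j ∈ S, f j‖ = ‖f i‖ := by
  rw [← Finset.add_sum_erase S f hi]
  have hlt : ‖∑ j ∈ S.erase i, f j‖ < ‖f i‖ := by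
    rcases (S.erase i).eq_empty_or_nonempty with he | hne
    · simpa [he] using hpos
    · obtain ⟨j, hj, hle⟩ := IsUltrametricDist.exists_norm_finsetSum_le_of_nonempty hne f
      exact hle.trans_lt (h j (Finset.mem_of_mem_erase hj) (Finset.ne_of_mem_erase hj))
  rw [IsUltrametricDist.norm_add_eq_max_of_norm_ne_norm hlt.ne', max_eq_left hlt.le]

lemma norm_eq_one_of_norm_one_sub_lt {μ : K} (h : ‖1 - μ‖ < 1) : ‖μ‖ = 1 := by
  have hne : ‖(1 : K)‖ ≠ ‖-(1 - μ)‖ := by rw [norm_neg, norm_one]; exact h.ne'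
  have := IsUltrametricDist.norm_add_eq_max_of_norm_ne_norm hne
  rw [norm_neg, norm_one, max_eq_left h.le] at this
  simpa using this

lemma norm_one_sub_pow_le {μ : K} (h : ‖1 - μ‖ < 1) (n : ℕ) : ‖1 - μ ^ n‖ ≤ ‖1 - μ‖ := by
  have hμ := norm_eq_one_of_norm_one_sub_lt h
  rw [← mul_neg_geom_sum, norm_mul]
  refine mul_le_of_le_one_right (norm_nonneg _) ?_
  refine IsUltrametricDist.norm_sum_le_of_forall_le_of_nonneg zero_le_one fun i _ => ?_
  simp [hμ]

lemma norm_natCast_le_inv {p : ℕ} (hp : ‖(p : K)‖ = (p : ℝ)⁻¹) {n : ℕ} (hn : p ∣ n) :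
    ‖(n : K)‖ ≤ (p : ℝ)⁻¹ := by
  obtain ⟨q, rfl⟩ := hn
  rw [Nat.cast_mul, norm_mul, hp]
  exact mul_le_of_le_one_right (by positivity) (IsUltrametricDist.norm_natCast_le_one K q)

variable {p : ℕ} [Fact p.Prime]

lemma norm_natCast_eq_one (hp : ‖(p : K)‖ = (p : ℝ)⁻¹) {n : ℕ} (hn : ¬ p ∣ n) :
    ‖(n : K)‖ = 1 := by
  have hp1 : ‖(p : K)‖ < 1 := by
    rw [hp]
    exact inv_lt_one_of_one_lt₀ (by exact_mod_cast (Fact.out : p.Prime).one_lt)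
  refine le_antisymm (IsUltrametricDist.norm_natCast_le_one K n) (not_lt.1 fun hlt => ?_)
  have hcop : IsCoprime (n : ℤ) (p : ℤ) :=
    Nat.isCoprime_iff_coprime.2 (((Fact.out : p.Prime).coprime_iff_not_dvd.2 hn).symm)
  obtain ⟨u, v, huv⟩ := hcop
  have huv' : (u : K) * n + v * p = 1 := by exact_mod_cast congrArg (Int.cast : ℤ → K) huv
  have h1 : ‖(u : K) * n‖ < 1 := by
    rw [norm_mul]
    exact mul_lt_one_of_nonneg_of_lt_one_right (IsUltrametricDist.norm_intCast_le_one K u)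
      (norm_nonneg _) hlt
  have h2 : ‖(v : K) * p‖ < 1 := by
    rw [norm_mul]
    exact mul_lt_one_of_nonneg_of_lt_one_right (IsUltrametricDist.norm_intCast_le_one K v)
      (norm_nonneg _) hp1
  have h3 := (IsUltrametricDist.norm_add_le_max ((u : K) * n) (v * p)).trans_lt (max_lt h1 h2)
  rw [huv', norm_one] at h3
  exact lt_irrefl _ h3

lemma norm_one_sub_pow_of_not_dvd (hp : ‖(p : K)‖ = (p : ℝ)⁻¹) {μ : K} (h : ‖1 - μ‖ < 1)
    {n : ℕ} (hn : ¬ p ∣ n) : ‖1 - μ ^ n‖ = ‖1 - μ‖ := by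
  rw [← mul_neg_geom_sum, norm_mul]
  have hsum : ‖(n : K) - ∑ i ∈ Finset.range n, μ ^ i‖ ≤ ‖1 - μ‖ := by
    have : (n : K) - ∑ i ∈ Finset.range n, μ ^ i = ∑ i ∈ Finset.range n, (1 - μ ^ i) := by
      simp
    rw [this]
    exact IsUltrametricDist.norm_sum_le_of_forall_le_of_nonneg (norm_nonneg _)
      fun i _ => norm_one_sub_pow_le h i
  have hn1 := norm_natCast_eq_one hp hn
  have hne : ‖(n : K)‖ ≠ ‖-((n : K) - ∑ i ∈ Finset.range n, μ ^ i)‖ := by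
    rw [norm_neg, hn1]
    exact (hsum.trans_lt h).ne'
  have := IsUltrametricDist.norm_add_eq_max_of_norm_ne_norm hne
  rw [norm_neg, hn1, max_eq_left (hsum.trans h.le)] at this
  rw [show ∑ i ∈ Finset.range n, μ ^ i = (n : K) + -((n : K) - ∑ i ∈ Finset.range n, μ ^ i) by
    ring, this, mul_one]

/-- The `p`-th power map near `1`: `μ ^ p - 1 = (μ - 1) ^ p + p (μ - 1) S` with `|S| = 1`. -/
lemma exists_pow_prime_sub_one {μ : K} (h : ‖1 - μ‖ < 1) :
    ∃ S : K, ‖S‖ = 1 ∧ 1 - μ ^ p = -((μ - 1) ^ p + p * (μ - 1) * S) := by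
  have hprime : p.Prime := Fact.out
  have hexp := add_pow_prime_eq hprime (μ - 1) 1
  rw [sub_add_cancel, one_pow p, mul_one] at hexp
  refine ⟨∑ k ∈ Finset.Ioo 0 p, (μ - 1) ^ (k - 1) * 1 ^ (p - k - 1) * ((p.choose k / p : ℕ) : K),
    ?_, by rw [hexp]; ring⟩
  have hone : (μ - 1) ^ (1 - 1) * 1 ^ (p - 1 - 1) * ((p.choose 1 / p : ℕ) : K) = 1 := by
    simp [Nat.div_self hprime.pos]
  have hmem : 1 ∈ Finset.Ioo 0 p := Finset.mem_Ioo.2 ⟨one_pos, hprime.one_lt⟩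
  rw [norm_sum_eq_of_dominant hmem, hone, norm_one]
  · rw [hone]; simp
  · intro j hj hj1
    rw [hone, norm_one, one_pow, mul_one, norm_mul, norm_pow]
    rw [norm_sub_rev] at h
    have hj0 := (Finset.mem_Ioo.1 hj).1
    exact mul_lt_one_of_nonneg_of_lt_one_left (by positivity)
      (pow_lt_one₀ (norm_nonneg _) h (by omega)) (IsUltrametricDist.norm_natCast_le_one K _)

lemma norm_one_sub_pow_prime_le (hp : ‖(p : K)‖ = (p : ℝ)⁻¹) {μ : K} (h : ‖1 - μ‖ < 1) :
    ‖1 - μ ^ p‖ ≤ max (‖1 - μ‖ ^ p) ((p : ℝ)⁻¹ * ‖1 - μ‖) := by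
  obtain ⟨S, hS, hμ⟩ := exists_pow_prime_sub_one (p := p) h
  rw [hμ, norm_neg]
  refine (IsUltrametricDist.norm_add_le_max _ _).trans_eq ?_
  rw [norm_pow, norm_mul, norm_mul, hS, hp, mul_one, norm_sub_rev μ]

lemma norm_one_sub_pow_prime_eq (hp : ‖(p : K)‖ = (p : ℝ)⁻¹) {μ : K} (h : ‖1 - μ‖ < 1)
    (hne : ‖1 - μ‖ ^ p ≠ (p : ℝ)⁻¹ * ‖1 - μ‖) :
    ‖1 - μ ^ p‖ = max (‖1 - μ‖ ^ p) ((p : ℝ)⁻¹ * ‖1 - μ‖) := by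
  obtain ⟨S, hS, hμ⟩ := exists_pow_prime_sub_one (p := p) h
  have h1 : ‖(μ - 1) ^ p‖ = ‖1 - μ‖ ^ p := by rw [norm_pow, norm_sub_rev]
  have h2 : ‖(p : K) * (μ - 1) * S‖ = (p : ℝ)⁻¹ * ‖1 - μ‖ := by
    rw [norm_mul, norm_mul, hS, hp, mul_one, norm_sub_rev μ]
  rw [hμ, norm_neg, IsUltrametricDist.norm_add_eq_max_of_norm_ne_norm (by rwa [h1, h2]), h1, h2]

end Ultrametric

/-- If every `n`-th root of unity has distance at least `r` from `μ`, then `|1 - μ ^ n| ≥ r ^ n`. -/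
lemma pow_le_norm_one_sub_pow {K : Type*} [NontriviallyNormedField K] [IsAlgClosed K]
    {n : ℕ} (hn : n ≠ 0) {μ : K} {r : ℝ} (hr : 0 ≤ r)
    (h : ∀ ζ : K, ζ ^ n = 1 → r ≤ ‖μ - ζ‖) : r ^ n ≤ ‖1 - μ ^ n‖ := by
  open Polynomial in
  have hmonic : (X ^ n - 1 : K[X]).Monic := monic_X_pow_sub_C 1 hn
  have hs := IsAlgClosed.splits (X ^ n - 1 : K[X])
  have hprod := congrArg (eval μ) (hs.eq_prod_roots_of_monic hmonic)
  have hcard : Multiset.card (X ^ n - 1 : K[X]).roots = n := by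
    rw [← hs.natDegree_eq_card_roots]
    exact natDegree_X_pow_sub_C (r := (1 : K))
  rw [eval_multiset_prod, Multiset.map_map] at hprod
  simp only [eval_sub, eval_pow, eval_X, eval_one, Function.comp_def, eval_C] at hprod
  lift r to NNReal using hr
  rw [norm_sub_rev, hprod, ← coe_nnnorm]
  have hhom := Multiset.prod_hom ((X ^ n - 1 : K[X]).roots.map fun a => μ - a)
    (nnnormHom : K →*₀ NNReal)
  rw [Multiset.map_map] at hhom
  change _ = ‖Multiset.prod ((X ^ n - 1 : K[X]).roots.map fun a => μ - a)‖₊ at hhom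
  rw [← hhom]
  have := Multiset.pow_card_le_prod
    (s := (X ^ n - 1 : K[X]).roots.map (nnnormHom ∘ fun a => μ - a)) (a := r) ?_
  · rw [Multiset.card_map, hcard] at this
    exact_mod_cast this
  · intro x hx
    obtain ⟨ζ, hζ, rfl⟩ := Multiset.mem_map.1 hx
    have hz : ζ ^ n = 1 := by
      have := (mem_roots'.1 hζ).2
      simpa [sub_eq_zero] using this
    exact h ζ hz

section Valuation

variable {p : ℕ} [Fact p.Prime] {K : Type*} [NontriviallyNormedField K]

lemma one_lt_cast_prime (p : ℕ) [Fact p.Prime] : (1 : ℝ) < p := by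
  exact_mod_cast (Fact.out : p.Prime).one_lt

lemma nuP_pos_iff {z : K} (hz : z ≠ 0) : 0 < nuP p z ↔ ‖z‖ < 1 := by
  rw [nuP, neg_pos, Real.logb_neg_iff (one_lt_cast_prime p) (norm_pos_iff.2 hz)]

lemma norm_lt_one_of_nuP_pos {z : K} (h : 0 < nuP p z) : ‖z‖ < 1 := by
  refine (nuP_pos_iff (p := p) ?_).1 h
  rintro rfl
  simp [nuP] at h

lemma logb_inv_mul (p : ℕ) [Fact p.Prime] {x : ℝ} (hx : 0 < x) :
    Real.logb p ((p : ℝ)⁻¹ * x) = -1 + Real.logb p x := by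
  have hp := one_lt_cast_prime p
  rw [Real.logb_mul (by positivity) hx.ne', Real.logb_inv, Real.logb_self_eq_one hp]

/-- The partial sums `∑_{j=1}^N ν(1 - μ^j)`. -/
noncomputable def sumNu (p : ℕ) (μ : K) (N : ℕ) : ℝ :=
  ∑ j ∈ Finset.range N, nuP p (1 - μ ^ (j + 1))

/-- `-log_p` of `p^{-N/(p^s(p-1))} |1-μ^{p^s}|^{N/p^s} |1-μ|^{Ns(p-1)/p} / ∏_{j ≤ N} |1-μ^j|`. -/
noncomputable def excess (p : ℕ) (μ : K) (s N : ℕ) : ℝ :=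
  N / (p : ℝ) ^ s * nuP p (1 - μ ^ p ^ s) + N / ((p : ℝ) ^ s * ((p : ℝ) - 1)) +
    N * s * ((p : ℝ) - 1) / p * nuP p (1 - μ) - sumNu p μ N

/-- The condition `R(s) ≤ |1 - μ| < R(s+1)` in terms of the valuation. -/
def InAnnulus (p : ℕ) (μ : K) (s : ℕ) : Prop :=
  1 < nuP p (1 - μ) * ((p : ℝ) ^ s * ((p : ℝ) - 1)) ∧
    (s ≠ 0 → nuP p (1 - μ) * ((p : ℝ) ^ s * ((p : ℝ) - 1)) ≤ p)

lemma InAnnulus.pos {μ : K} {s : ℕ} (h : InAnnulus p μ s) : 0 < nuP p (1 - μ) := by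
  have hp1 := one_lt_cast_prime p
  have : 0 < (p : ℝ) ^ s * ((p : ℝ) - 1) := mul_pos (by positivity) (sub_pos.2 hp1)
  exact pos_of_mul_pos_left (one_pos.trans h.1) this.le

variable [IsUltrametricDist K]

lemma nuP_one_sub_pow_of_not_dvd (hp : ‖(p : K)‖ = (p : ℝ)⁻¹) {μ : K}
    (hpos : 0 < nuP p (1 - μ)) {n : ℕ} (hn : ¬ p ∣ n) :
    nuP p (1 - μ ^ n) = nuP p (1 - μ) := by
  rw [nuP, nuP, norm_one_sub_pow_of_not_dvd hp (norm_lt_one_of_nuP_pos hpos) hn]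

lemma nuP_pow_prime_of_gt (hp : ‖(p : K)‖ = (p : ℝ)⁻¹) {μ : K} (hμ : μ ≠ 1)
    (h : 1 < nuP p (1 - μ) * ((p : ℝ) - 1)) :
    nuP p (1 - μ ^ p) = nuP p (1 - μ) + 1 := by
  have hp1 := one_lt_cast_prime p
  have hx : 0 < ‖1 - μ‖ := norm_pos_iff.2 (sub_ne_zero.2 hμ.symm)
  have hpos : 0 < nuP p (1 - μ) := by
    by_contra hneg
    nlinarith [mul_nonneg (sub_nonneg.2 (not_lt.1 hneg)) (sub_nonneg.2 hp1.le)]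
  have hlt : ‖1 - μ‖ ^ p < (p : ℝ)⁻¹ * ‖1 - μ‖ := by
    rw [← Real.logb_lt_logb_iff hp1 (by positivity) (by positivity), Real.logb_pow,
      logb_inv_mul p hx]
    simp only [nuP] at h
    linarith
  rw [nuP, norm_one_sub_pow_prime_eq hp (norm_lt_one_of_nuP_pos hpos) hlt.ne, max_eq_right hlt.le,
    logb_inv_mul p hx, nuP]
  ring

lemma nuP_pow_prime_of_lt (hp : ‖(p : K)‖ = (p : ℝ)⁻¹) {μ : K}
    (hpos : 0 < nuP p (1 - μ)) (h : nuP p (1 - μ) * ((p : ℝ) - 1) < 1) :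
    nuP p (1 - μ ^ p) = p * nuP p (1 - μ) := by
  have hp1 := one_lt_cast_prime p
  have hx : 0 < ‖1 - μ‖ := by
    rw [norm_pos_iff]
    intro h0
    simp [nuP, h0] at hpos
  have hlt : (p : ℝ)⁻¹ * ‖1 - μ‖ < ‖1 - μ‖ ^ p := by
    rw [← Real.logb_lt_logb_iff hp1 (by positivity) (by positivity), Real.logb_pow,
      logb_inv_mul p hx]
    simp only [nuP] at h
    linarith
  rw [nuP, norm_one_sub_pow_prime_eq hp (norm_lt_one_of_nuP_pos hpos) hlt.ne', max_eq_left hlt.le,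
    Real.logb_pow, nuP]
  ring

lemma le_nuP_pow_prime (hp : ‖(p : K)‖ = (p : ℝ)⁻¹) {μ : K} (hroot : μ ^ p ≠ 1)
    (hpos : 0 < nuP p (1 - μ)) (h : nuP p (1 - μ) * ((p : ℝ) - 1) ≤ 1) :
    p * nuP p (1 - μ) ≤ nuP p (1 - μ ^ p) := by
  have hp1 := one_lt_cast_prime p
  have hx : 0 < ‖1 - μ‖ := by
    rw [norm_pos_iff]
    intro h0
    simp [nuP, h0] at hpos
  have hle : (p : ℝ)⁻¹ * ‖1 - μ‖ ≤ ‖1 - μ‖ ^ p := by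
    rw [← Real.logb_le_logb hp1 (by positivity) (by positivity), Real.logb_pow,
      logb_inv_mul p hx]
    simp only [nuP] at h
    linarith
  have hmain := norm_one_sub_pow_prime_le hp (norm_lt_one_of_nuP_pos hpos)
  rw [max_eq_left hle, ← Real.logb_le_logb hp1
    (norm_pos_iff.2 (sub_ne_zero.2 hroot.symm)) (by positivity), Real.logb_pow] at hmain
  simp only [nuP]
  linarith

/-- Beyond the critical radius, `ν(1 - μ ^ j) = ν(1 - μ) + v_p(j)`. -/
lemma nuP_one_sub_pow_eq (hp : ‖(p : K)‖ = (p : ℝ)⁻¹) {μ : K}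
    (hroot : ∀ n : ℕ, 1 ≤ n → μ ^ n ≠ 1) (h : 1 < nuP p (1 - μ) * ((p : ℝ) - 1))
    {j : ℕ} (hj : j ≠ 0) :
    nuP p (1 - μ ^ j) = nuP p (1 - μ) + padicValNat p j := by
  have hp1 := one_lt_cast_prime p
  have hpow : ∀ e : ℕ, nuP p (1 - μ ^ p ^ e) = nuP p (1 - μ) + e := by
    intro e
    induction e with
    | zero => simp
    | succ e ih =>
      rw [pow_succ, pow_mul, nuP_pow_prime_of_gt hp
        (hroot _ (Nat.one_le_pow _ _ (Fact.out : p.Prime).pos)), ih]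
      · push_cast; ring
      · rw [ih]
        nlinarith [mul_nonneg (Nat.cast_nonneg (α := ℝ) e) (sub_nonneg.2 hp1.le)]
  obtain ⟨e, q, hq, rfl⟩ := Nat.exists_eq_pow_mul_and_not_dvd hj p (Fact.out : p.Prime).ne_one
  have hq0 : q ≠ 0 := by rintro rfl; simp at hq
  have hpos : 0 < nuP p (1 - μ) := by
    by_contra hneg
    nlinarith [mul_nonneg (sub_nonneg.2 (not_lt.1 hneg)) (sub_nonneg.2 hp1.le)]
  have hval : padicValNat p (p ^ e * q) = e := by
    rw [padicValNat.mul (pow_ne_zero _ (Fact.out : p.Prime).ne_zero) hq0, padicValNat.prime_pow,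
      padicValNat.eq_zero_of_not_dvd hq, add_zero]
  rw [hval, pow_mul, nuP_one_sub_pow_of_not_dvd hp _ hq, hpow]
  rw [hpow]
  positivity

lemma sumNu_eq_add_sumNu_pow (hp : ‖(p : K)‖ = (p : ℝ)⁻¹) {μ : K} (hpos : 0 < nuP p (1 - μ))
    (N : ℕ) :
    sumNu p μ N = ((N : ℝ) - (N / p : ℕ)) * nuP p (1 - μ) + sumNu p (μ ^ p) (N / p) := by
  induction N with
  | zero => simp [sumNu]
  | succ N ih =>
    have hstep : sumNu p μ (N + 1) = sumNu p μ N + nuP p (1 - μ ^ (N + 1)) := by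
      simp [sumNu, Finset.sum_range_succ]
    rw [hstep, ih]
    by_cases hd : p ∣ N + 1
    · have hdiv : (N + 1) / p = N / p + 1 := by simp [Nat.succ_div, hd]
      have hpow : (μ ^ p) ^ (N / p + 1) = μ ^ (N + 1) := by
        rw [← pow_mul, ← hdiv, Nat.mul_div_cancel' hd]
      have hstep' : sumNu p (μ ^ p) (N / p + 1)
          = sumNu p (μ ^ p) (N / p) + nuP p (1 - μ ^ (N + 1)) := by
        rw [← hpow]
        simp [sumNu, Finset.sum_range_succ]
      rw [hdiv, hstep']
      push_cast
      ring
    · have hdiv : (N + 1) / p = N / p := by simp [Nat.succ_div, hd]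
      rw [hdiv, nuP_one_sub_pow_of_not_dvd hp hpos hd]
      push_cast
      ring

lemma sumNu_eq_of_gt (hp : ‖(p : K)‖ = (p : ℝ)⁻¹) {μ : K}
    (hroot : ∀ n : ℕ, 1 ≤ n → μ ^ n ≠ 1) (h : 1 < nuP p (1 - μ) * ((p : ℝ) - 1)) (N : ℕ) :
    sumNu p μ N = N * nuP p (1 - μ) + padicValNat p N.factorial := by
  induction N with
  | zero => simp [sumNu]
  | succ N ih =>
    rw [sumNu, Finset.sum_range_succ, ← sumNu, ih,
      nuP_one_sub_pow_eq hp hroot h N.succ_ne_zero, Nat.factorial_succ,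
      padicValNat.mul N.succ_ne_zero N.factorial_ne_zero]
    push_cast
    ring

lemma InAnnulus.pow_prime (hp : ‖(p : K)‖ = (p : ℝ)⁻¹) {μ : K}
    (hroot : ∀ n : ℕ, 1 ≤ n → μ ^ n ≠ 1) {s : ℕ} (h : InAnnulus p μ (s + 1)) :
    InAnnulus p (μ ^ p) s ∧ p * nuP p (1 - μ) ≤ nuP p (1 - μ ^ p) ∧
      (s : ℝ) * nuP p (1 - μ ^ p) = s * (p * nuP p (1 - μ)) := by
  have hp1 := one_lt_cast_prime p
  have hpos := h.pos
  obtain ⟨h1, h2⟩ := h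
  have h2 := h2 s.succ_ne_zero
  set w := nuP p (1 - μ)
  have hps : (1 : ℝ) ≤ (p : ℝ) ^ s := one_le_pow₀ hp1.le
  have hc : w * ((p : ℝ) ^ s * ((p : ℝ) - 1)) ≤ 1 := by
    rw [pow_succ] at h2
    nlinarith
  have hw0 : 0 ≤ w * ((p : ℝ) - 1) := mul_nonneg hpos.le (sub_nonneg.2 hp1.le)
  have hle : p * w ≤ nuP p (1 - μ ^ p) :=
    le_nuP_pow_prime hp (hroot p (Fact.out : p.Prime).one_le) hpos (by nlinarith)
  have heq : s ≠ 0 → nuP p (1 - μ ^ p) = p * w := by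
    intro hs
    refine nuP_pow_prime_of_lt hp hpos ?_
    have : (1 : ℝ) < (p : ℝ) ^ s := one_lt_pow₀ hp1 hs
    have : 0 < w * ((p : ℝ) - 1) := mul_pos hpos (sub_pos.2 hp1)
    nlinarith
  refine ⟨⟨?_, fun hs => ?_⟩, hle, ?_⟩
  · refine h1.trans_le ?_
    have := mul_le_mul_of_nonneg_right hle
      (mul_nonneg (zero_le_one.trans hps) (sub_nonneg.2 hp1.le))
    rw [pow_succ]
    linarith
  · rw [heq hs]
    nlinarith
  · rcases eq_or_ne s 0 with rfl | hs
    · simp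
    · rw [heq hs]

lemma InAnnulus.le_nuP_pow (hp : ‖(p : K)‖ = (p : ℝ)⁻¹) {μ : K}
    (hroot : ∀ n : ℕ, 1 ≤ n → μ ^ n ≠ 1) {s : ℕ} (h : InAnnulus p μ s) :
    (p : ℝ) ^ s * nuP p (1 - μ) ≤ nuP p (1 - μ ^ p ^ s) := by
  induction s generalizing μ with
  | zero => simp
  | succ s ih =>
    obtain ⟨h', hle, -⟩ := h.pow_prime hp hroot
    have := ih (fun n hn => by
      rw [← pow_mul]
      exact hroot _ (Nat.mul_pos (Fact.out : p.Prime).pos hn)) h'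
    rw [← pow_mul, ← pow_succ'] at this
    refine le_trans ?_ this
    rw [pow_succ, mul_assoc]
    gcongr

lemma excess_zero_eq (hp : ‖(p : K)‖ = (p : ℝ)⁻¹) {μ : K}
    (hroot : ∀ n : ℕ, 1 ≤ n → μ ^ n ≠ 1) (h : InAnnulus p μ 0) (N : ℕ) :
    excess p μ 0 N = (p.digits N).sum / ((p : ℝ) - 1) := by
  have hp1 := one_lt_cast_prime p
  have hgt : 1 < nuP p (1 - μ) * ((p : ℝ) - 1) := by simpa using h.1
  have hfac := sub_one_mul_padicValNat_factorial (p := p) N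
  have hle := Nat.digit_sum_le p N
  have hfac' : ((p : ℝ) - 1) * padicValNat p N.factorial = N - (p.digits N).sum := by
    have := congrArg (Nat.cast : ℕ → ℝ) hfac
    rwa [Nat.cast_mul, Nat.cast_sub hle, Nat.cast_sub (Fact.out : p.Prime).one_le,
      Nat.cast_one] at this
  rw [excess, sumNu_eq_of_gt hp hroot hgt]
  have : (p : ℝ) - 1 ≠ 0 := (sub_pos.2 hp1).ne'
  rw [eq_div_iff this]
  simp only [pow_zero, pow_one, div_one, one_mul, Nat.cast_zero, mul_zero, zero_mul, zero_div,
    add_zero]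
  field_simp
  linarith

lemma excess_succ_eq (hp : ‖(p : K)‖ = (p : ℝ)⁻¹) {μ : K}
    (hroot : ∀ n : ℕ, 1 ≤ n → μ ^ n ≠ 1) {s : ℕ} (h : InAnnulus p μ (s + 1)) (N : ℕ) :
    excess p μ (s + 1) N = excess p (μ ^ p) s (N / p) + ((N : ℝ) / p - (N / p : ℕ)) *
      (nuP p (1 - μ ^ p ^ (s + 1)) / (p : ℝ) ^ s + 1 / ((p : ℝ) ^ s * ((p : ℝ) - 1)) +
        (s * ((p : ℝ) - 1) - 1) * nuP p (1 - μ)) := by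
  have hp1 := one_lt_cast_prime p
  obtain ⟨-, -, heq⟩ := h.pow_prime hp hroot
  have hne : (p : ℝ) - 1 ≠ 0 := (sub_pos.2 hp1).ne'
  have hterm : ((N / p : ℕ) : ℝ) * s * ((p : ℝ) - 1) / p * nuP p (1 - μ ^ p) =
      (N / p : ℕ) * s * ((p : ℝ) - 1) * nuP p (1 - μ) := by
    rw [show ((N / p : ℕ) : ℝ) * s * ((p : ℝ) - 1) / p * nuP p (1 - μ ^ p) =
      (N / p : ℕ) * ((p : ℝ) - 1) / p * (s * nuP p (1 - μ ^ p)) by ring, heq]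
    field_simp
  rw [excess, excess, sumNu_eq_add_sumNu_pow hp h.pos, hterm, ← pow_mul, ← pow_succ' p s]
  push_cast
  field_simp
  ring

lemma div_sub_cast_div_nonneg (p N : ℕ) : 0 ≤ (N : ℝ) / p - (N / p : ℕ) :=
  sub_nonneg.2 Nat.cast_div_le

lemma le_excess_succ (hp : ‖(p : K)‖ = (p : ℝ)⁻¹) {μ : K}
    (hroot : ∀ n : ℕ, 1 ≤ n → μ ^ n ≠ 1) {s : ℕ} (h : InAnnulus p μ (s + 1)) (N : ℕ) :
    excess p (μ ^ p) s (N / p) +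
        ((N : ℝ) / p - (N / p : ℕ)) * (1 / ((p : ℝ) ^ s * ((p : ℝ) - 1))) ≤
      excess p μ (s + 1) N - ((N : ℝ) / p - (N / p : ℕ)) * nuP p (1 - μ) := by
  have hp2 : (2 : ℝ) ≤ p := by exact_mod_cast (Fact.out : p.Prime).two_le
  have hpos := h.pos
  have hy : p * nuP p (1 - μ) ≤ nuP p (1 - μ ^ p ^ (s + 1)) / (p : ℝ) ^ s := by
    rw [le_div_iff₀ (by positivity)]
    have := h.le_nuP_pow hp hroot
    rw [pow_succ] at this
    linarith
  have hs : 0 ≤ (s : ℝ) * ((p : ℝ) - 1) * nuP p (1 - μ) :=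
    mul_nonneg (mul_nonneg (Nat.cast_nonneg _) (by linarith)) hpos.le
  have hkey : nuP p (1 - μ) ≤ nuP p (1 - μ ^ p ^ (s + 1)) / (p : ℝ) ^ s +
      (s * ((p : ℝ) - 1) - 1) * nuP p (1 - μ) := by
    nlinarith
  have := mul_le_mul_of_nonneg_left hkey (div_sub_cast_div_nonneg p N)
  rw [excess_succ_eq hp hroot h]
  linarith

lemma le_excess (hp : ‖(p : K)‖ = (p : ℝ)⁻¹) {μ : K}
    (hroot : ∀ n : ℕ, 1 ≤ n → μ ^ n ≠ 1) {s : ℕ} (h : InAnnulus p μ s) {N : ℕ} (hN : 1 ≤ N) :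
    1 / ((p : ℝ) ^ s * ((p : ℝ) - 1)) + (if s = 0 then 0 else
      ((N : ℝ) / p - (N / p : ℕ)) * nuP p (1 - μ)) ≤ excess p μ s N := by
  have hp1 := one_lt_cast_prime p
  have hp0 : 0 < (p : ℝ) - 1 := sub_pos.2 hp1
  induction s generalizing μ N with
  | zero =>
    rw [excess_zero_eq hp hroot h, if_pos rfl, add_zero, pow_zero, one_mul]
    have : 1 ≤ (p.digits N).sum := by
      have hlast : p.digits N ≠ [] := Nat.digits_ne_nil_iff_ne_zero.2 (by omega)
      have hne := Nat.getLast_digit_ne_zero p (m := N) (by omega)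
      have := List.single_le_sum (l := p.digits N) (by simp) _ (List.getLast_mem hlast)
      omega
    gcongr
    exact_mod_cast this
  | succ s ih =>
    have hroot' : ∀ n : ℕ, 1 ≤ n → (μ ^ p) ^ n ≠ 1 := fun n hn => by
      rw [← pow_mul]
      exact hroot _ (Nat.mul_pos (Fact.out : p.Prime).pos hn)
    have hstep := le_excess_succ hp hroot h N
    have hδ := div_sub_cast_div_nonneg p N
    rw [if_neg s.succ_ne_zero]
    suffices hsuff : 1 / ((p : ℝ) ^ (s + 1) * ((p : ℝ) - 1)) ≤ excess p (μ ^ p) s (N / p) +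
        ((N : ℝ) / p - (N / p : ℕ)) * (1 / ((p : ℝ) ^ s * ((p : ℝ) - 1))) by linarith
    rcases Nat.eq_zero_or_pos (N / p) with h0 | h0
    · rw [h0]
      have : excess p (μ ^ p) s 0 = 0 := by simp [excess, sumNu]
      rw [this, zero_add, Nat.cast_zero, sub_zero, div_mul_div_comm, mul_one, ← mul_assoc,
        ← pow_succ']
      gcongr
      exact_mod_cast hN
    · have h1 := ih hroot' (h.pow_prime hp hroot).1 h0
      have h2 : 1 / ((p : ℝ) ^ (s + 1) * ((p : ℝ) - 1)) ≤ 1 / ((p : ℝ) ^ s * ((p : ℝ) - 1)) := by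
        gcongr
        · exact hp1.le
        · omega
      have h3 : 0 ≤ ((N : ℝ) / p - (N / p : ℕ)) * (1 / ((p : ℝ) ^ s * ((p : ℝ) - 1))) := by
        positivity
      have h4 : 0 ≤ (if s = 0 then 0 else ((N / p : ℕ) / (p : ℝ) - (N / p / p : ℕ)) *
          nuP p (1 - μ ^ p)) := by
        split_ifs
        · rfl
        · exact mul_nonneg (div_sub_cast_div_nonneg p _) (h.pow_prime hp hroot).1.pos.le
      linarith

lemma excess_prime_pow (hp : ‖(p : K)‖ = (p : ℝ)⁻¹) {μ : K}
    (hroot : ∀ n : ℕ, 1 ≤ n → μ ^ n ≠ 1) {s : ℕ} (h : InAnnulus p μ s) (α : ℕ) :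
    excess p μ s (p ^ (s + α)) = 1 / ((p : ℝ) - 1) := by
  induction s generalizing μ with
  | zero =>
    rw [excess_zero_eq hp hroot h, zero_add]
    have : (p.digits (p ^ α)).sum = 1 := by
      have := Nat.digits_base_pow_mul (b := p) (k := α) (m := 1) (Fact.out : p.Prime).one_lt one_pos
      rw [mul_one] at this
      rw [this, Nat.digits_of_lt p 1 one_ne_zero (Fact.out : p.Prime).one_lt]
      simp
    rw [this, Nat.cast_one]
  | succ s ih =>
    have hdiv : p ^ (s + 1 + α) / p = p ^ (s + α) := by
      rw [show s + 1 + α = s + α + 1 by ring, pow_succ,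
        Nat.mul_div_cancel _ (Fact.out : p.Prime).pos]
    have hδ : ((p ^ (s + 1 + α) : ℕ) : ℝ) / p - (p ^ (s + α) : ℕ) = 0 := by
      have : (p : ℝ) ≠ 0 := by have := one_lt_cast_prime p; positivity
      push_cast
      field_simp
      ring
    rw [excess_succ_eq hp hroot h, hdiv, hδ, zero_mul, add_zero]
    refine ih (fun n hn => ?_) (h.pow_prime hp hroot).1
    rw [← pow_mul]
    exact hroot _ (Nat.mul_pos (Fact.out : p.Prime).pos hn)

end Valuation

section Conjugacy

lemma coeff_mk_quadCoeff_pow {K : Type*} [Field K] (lam : K) {k l : ℕ} (h : l ≤ k) :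
    PowerSeries.coeff k ((PowerSeries.mk (quadCoeff lam)) ^ l) =
      lam ^ (l - (k - l)) * (l.choose (k - l) : K) := by
  have hmk : PowerSeries.mk (quadCoeff lam) =
      PowerSeries.X * ((Polynomial.X + Polynomial.C lam : Polynomial K) : PowerSeries K) := by
    ext n
    rcases n with _ | n
    · simp [quadCoeff]
    · rw [PowerSeries.coeff_succ_X_mul, PowerSeries.coeff_mk, Polynomial.coeff_coe]
      rcases n with _ | _ | n <;> simp [quadCoeff, Polynomial.coeff_X, Polynomial.coeff_C]
  rw [hmk, mul_pow, PowerSeries.coeff_X_pow_mul', if_pos h, ← Polynomial.coe_pow,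
    Polynomial.coeff_coe, Polynomial.coeff_X_add_C_pow]

lemma conjugacy_recurrence {K : Type*} [Field K] {lam : K} {b : ℕ → K}
    (hb : IsConjugacy lam (quadCoeff lam) b) (n : ℕ) :
    lam * (1 - lam ^ n) * b (n + 1) =
      ∑ l ∈ Finset.range (n + 1),
        b l * (lam ^ (l - (n + 1 - l)) * (l.choose (n + 1 - l) : K)) := by
  have h := hb.2.2 (n + 1)
  rw [compCoeff, Finset.sum_congr rfl fun l hl => by
    rw [coeff_mk_quadCoeff_pow lam (Nat.lt_succ_iff.1 (Finset.mem_range.1 hl))],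
    Finset.sum_range_succ] at h
  simp only [Nat.sub_self, Nat.sub_zero, Nat.choose_zero_right, Nat.cast_one, mul_one] at h
  rw [pow_succ] at h
  linear_combination -h

variable {K : Type*} [NontriviallyNormedField K] [IsUltrametricDist K] {p : ℕ} [Fact p.Prime]

lemma norm_choose_two_eq_one (hp : ‖(p : K)‖ = (p : ℝ)⁻¹) (hp3 : 3 ≤ p) {n : ℕ} (hn : 1 ≤ n)
    (hd : p ∣ n) : ‖((n - 1).choose 2 : K)‖ = 1 := by
  refine norm_natCast_eq_one hp fun hdvd => ?_
  have hprime : p.Prime := Fact.out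
  have hle := Nat.le_of_dvd hn hd
  have h2 : (n - 1).choose 2 * 2 = (n - 1) * (n - 2) := by
    rw [Nat.choose_two_right, Nat.div_mul_cancel (Nat.even_mul_pred_self _).two_dvd]
    congr 1
  rcases (hprime.dvd_mul.1 (h2 ▸ Dvd.dvd.mul_right hdvd 2)) with h | h
  · have := (Nat.dvd_sub hd h)
    rw [show n - (n - 1) = 1 by omega] at this
    exact hprime.one_lt.ne' (Nat.dvd_one.1 this)
  · have := (Nat.dvd_sub hd h)
    rw [show n - (n - 2) = 2 by omega] at this
    have := Nat.le_of_dvd two_pos this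
    omega

/-- The exact growth of the coefficients of the conjugacy of a quadratic polynomial. -/
lemma norm_conjugacy_succ (hp : ‖(p : K)‖ = (p : ℝ)⁻¹) (hp3 : 3 ≤ p) {lam : K}
    (hroot : ∀ n : ℕ, 1 ≤ n → lam ^ n ≠ 1) (hlam1 : (p : ℝ)⁻¹ < ‖1 - lam‖)
    (hlam2 : ‖1 - lam‖ < 1) {b : ℕ → K} (hb : IsConjugacy lam (quadCoeff lam) b)
    {n : ℕ} (hn : 1 ≤ n) :
    0 < ‖b n‖ ∧ (∀ l < n, ‖b l‖ < ‖b n‖) ∧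
      ‖b (n + 1)‖ * ‖1 - lam ^ n‖ = ‖b n‖ * (if p ∣ n then ‖1 - lam‖ else 1) := by
  have hprime : p.Prime := Fact.out
  have hlam := norm_eq_one_of_norm_one_sub_lt hlam2
  have hp1 := one_lt_cast_prime p
  have ha : 0 < ‖1 - lam‖ := lt_trans (by positivity) hlam1
  have hchoose (m l : ℕ) : ‖(m.choose l : K)‖ ≤ 1 := IsUltrametricDist.norm_natCast_le_one K _
  induction n using Nat.strong_induction_on with
  | _ n ih =>
    have hmono : 0 < ‖b n‖ ∧ ∀ l < n, ‖b l‖ < ‖b n‖ := by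
      rcases hn.eq_or_lt with rfl | hn1
      · simp [hb.1, hb.2.1]
      · obtain ⟨m, rfl⟩ : ∃ m, n = m + 1 := ⟨n - 1, by omega⟩
        obtain ⟨h1, h2, h3⟩ := ih m (by omega) (by omega)
        have hq : 0 < ‖1 - lam ^ m‖ :=
          norm_pos_iff.2 (sub_ne_zero.2 (hroot m (by omega)).symm)
        have hgrow : ‖b m‖ < ‖b (m + 1)‖ := by
          have hlt : ‖1 - lam ^ m‖ < if p ∣ m then ‖1 - lam‖ else 1 := by
            split_ifs with hd
            · obtain ⟨q, rfl⟩ := hd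
              have hple : ‖1 - lam ^ p‖ < ‖1 - lam‖ := by
                refine (norm_one_sub_pow_prime_le hp hlam2).trans_lt (max_lt ?_ ?_)
                · exact pow_lt_self_of_lt_one₀ ha hlam2 hprime.one_lt
                · exact mul_lt_of_lt_one_left ha (inv_lt_one_of_one_lt₀ hp1)
              rw [pow_mul]
              exact (norm_one_sub_pow_le (hple.trans hlam2) q).trans_lt hple
            · rwa [norm_one_sub_pow_of_not_dvd hp hlam2 hd]
          have := mul_lt_mul_of_pos_left hlt h1
          rw [← h3] at this
          exact lt_of_mul_lt_mul_right this hq.le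
        refine ⟨h1.trans hgrow, fun l hl => ?_⟩
        rcases (Nat.lt_succ_iff.1 hl).eq_or_lt with rfl | hl'
        · exact hgrow
        · exact (h2 l hl').trans hgrow
    refine ⟨hmono.1, hmono.2, ?_⟩
    have hrec := congrArg norm (conjugacy_recurrence hb n)
    rw [norm_mul, norm_mul, hlam, one_mul, mul_comm] at hrec
    rw [hrec]
    have hterm (l : ℕ) : ‖b l * (lam ^ (l - (n + 1 - l)) * (l.choose (n + 1 - l) : K))‖ =
        ‖b l‖ * ‖(l.choose (n + 1 - l) : K)‖ := by
      rw [norm_mul, norm_mul, norm_pow, hlam, one_pow, one_mul]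
    have hn_term : n.choose (n + 1 - n) = n := by simp
    split_ifs with hd
    · have hpn := Nat.le_of_dvd hn hd
      obtain ⟨m, rfl⟩ : ∃ m, n = m + 1 := ⟨n - 1, by omega⟩
      have hdm : ¬ p ∣ m := fun hm =>
        hprime.one_lt.ne' (Nat.dvd_one.1 ((Nat.dvd_add_right hm).1 hd))
      obtain ⟨h1, h2, h3⟩ := ih m (by omega) (by omega)
      rw [if_neg hdm, norm_one_sub_pow_of_not_dvd hp hlam2 hdm, mul_one] at h3
      have hc : ‖(m.choose (m + 1 + 1 - m) : K)‖ = 1 := by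
        rw [show m + 1 + 1 - m = 2 by omega]
        exact norm_choose_two_eq_one hp hp3 hn hd
      rw [norm_sum_eq_of_dominant (i := m) (by simp), hterm, hc, mul_one, h3]
      · rw [hterm, hc, mul_one]
        exact h1
      · intro l hl hlm
        rw [hterm, hterm, hc, mul_one]
        rcases (Nat.lt_succ_iff.1 (Finset.mem_range.1 hl)).eq_or_lt with rfl | hl'
        · rw [hn_term, ← h3]
          exact mul_lt_mul_of_pos_left ((norm_natCast_le_inv hp hd).trans_lt hlam1) hmono.1
        · exact (mul_le_of_le_one_right (norm_nonneg _) (hchoose _ _)).trans_lt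
            (h2 l (by omega))
    · have hc : ‖(n.choose (n + 1 - n) : K)‖ = 1 := by
        rw [hn_term]
        exact norm_natCast_eq_one hp hd
      rw [norm_sum_eq_of_dominant (i := n) (by simp), hterm, hc]
      · rw [hterm, hc, mul_one]
        exact hmono.1
      · intro l hl hln
        rw [hterm, hterm, hc, mul_one]
        have := Finset.mem_range.1 hl
        exact (mul_le_of_le_one_right (norm_nonneg _) (hchoose _ _)).trans_lt
          (hmono.2 l (by omega))

lemma nuP_conjugacy (hp : ‖(p : K)‖ = (p : ℝ)⁻¹) (hp3 : 3 ≤ p) {lam : K}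
    (hroot : ∀ n : ℕ, 1 ≤ n → lam ^ n ≠ 1) (hlam1 : (p : ℝ)⁻¹ < ‖1 - lam‖)
    (hlam2 : ‖1 - lam‖ < 1) {b : ℕ → K} (hb : IsConjugacy lam (quadCoeff lam) b) (N : ℕ) :
    nuP p (b (N + 1)) = (N / p : ℕ) * nuP p (1 - lam) - sumNu p lam N := by
  induction N with
  | zero => simp [nuP, sumNu, hb.2.1]
  | succ N ih =>
    have ha : 0 < ‖1 - lam‖ := lt_of_le_of_lt (by positivity) hlam1
    obtain ⟨h1, -, h3⟩ := norm_conjugacy_succ hp hp3 hroot hlam1 hlam2 hb (Nat.le_add_left 1 N)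
    have h4 := (norm_conjugacy_succ hp hp3 hroot hlam1 hlam2 hb (Nat.le_add_left 1 (N + 1))).1
    have hq : 0 < ‖1 - lam ^ (N + 1)‖ :=
      norm_pos_iff.2 (sub_ne_zero.2 (hroot (N + 1) (by omega)).symm)
    have hlog := congrArg (fun x => -Real.logb p x) h3
    have hsum : sumNu p lam (N + 1) = sumNu p lam N + nuP p (1 - lam ^ (N + 1)) := by
      simp [sumNu, Finset.sum_range_succ]
    rw [Real.logb_mul h4.ne' hq.ne', Real.logb_mul h1.ne' (by split_ifs <;> positivity)] at hlog
    rw [hsum, Nat.succ_div]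
    simp only [nuP] at ih hlog ⊢
    split_ifs at hlog ⊢ with hd
    · push_cast
      linarith
    · rw [Real.logb_one] at hlog
      push_cast
      linarith

end Conjugacy

section CriticalRadius

variable {p : ℕ} [Fact p.Prime]

lemma Rr_succ_pos (p s : ℕ) [Fact p.Prime] : 0 < Rr p (s + 1) := by
  have hp1 := one_lt_cast_prime p
  rw [Rr, if_neg s.succ_ne_zero]
  positivity

lemma logb_Rr_succ (p s : ℕ) [Fact p.Prime] :
    Real.logb p (Rr p (s + 1)) = -(1 / ((p : ℝ) ^ s * ((p : ℝ) - 1))) := by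
  have hp1 := one_lt_cast_prime p
  rw [Rr, if_neg s.succ_ne_zero, Real.logb_rpow (by positivity) hp1.ne', Nat.add_sub_cancel,
    neg_div]

variable {K : Type*} [NontriviallyNormedField K]

lemma one_lt_nuP_mul_of_lt_Rr {z : K} (hz : z ≠ 0) {s : ℕ} (h : ‖z‖ < Rr p (s + 1)) :
    1 < nuP p z * ((p : ℝ) ^ s * ((p : ℝ) - 1)) := by
  have hp1 := one_lt_cast_prime p
  have hc : 0 < (p : ℝ) ^ s * ((p : ℝ) - 1) := mul_pos (by positivity) (sub_pos.2 hp1)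
  rw [← Real.logb_lt_logb_iff hp1 (norm_pos_iff.2 hz) (Rr_succ_pos p s), logb_Rr_succ] at h
  rw [← div_lt_iff₀ hc, nuP]
  linarith

lemma inAnnulus_of_Rr {μ : K} (hμ : μ ≠ 1) {s : ℕ}
    (h : Rr p s ≤ ‖1 - μ‖ ∧ ‖1 - μ‖ < Rr p (s + 1)) : InAnnulus p μ s := by
  have hp1 := one_lt_cast_prime p
  have hz : 1 - μ ≠ 0 := sub_ne_zero.2 hμ.symm
  refine ⟨one_lt_nuP_mul_of_lt_Rr hz h.2, fun hs => ?_⟩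
  obtain ⟨r, rfl⟩ := Nat.exists_eq_succ_of_ne_zero hs
  have hc : 0 < (p : ℝ) ^ r * ((p : ℝ) - 1) := mul_pos (by positivity) (sub_pos.2 hp1)
  have h1 := h.1
  rw [Nat.succ_eq_add_one, ← Real.logb_le_logb hp1 (Rr_succ_pos p r) (norm_pos_iff.2 hz),
    logb_Rr_succ] at h1
  have h2 : nuP p (1 - μ) * ((p : ℝ) ^ r * ((p : ℝ) - 1)) ≤ 1 := by
    rw [← le_div_iff₀ hc, nuP]
    linarith
  rw [Nat.succ_eq_add_one, pow_succ]
  nlinarith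

variable [IsUltrametricDist K]

/-- A `p`-power root of unity within distance `R(s+1)` of `1` has order dividing `p ^ s`. -/
lemma pow_eq_one_of_norm_lt_Rr (hp : ‖(p : K)‖ = (p : ℝ)⁻¹) {ζ : K} {k s : ℕ}
    (hζ : ζ ^ p ^ k = 1) (h : ‖1 - ζ‖ < Rr p (s + 1)) : ζ ^ p ^ s = 1 := by
  have hp1 := one_lt_cast_prime p
  have hp0 : 0 < (p : ℝ) - 1 := sub_pos.2 hp1
  by_contra hne
  have hζ1 : ζ ≠ 1 := by rintro rfl; simp at hne
  have hbig : 1 < nuP p (1 - ζ ^ p ^ s) * ((p : ℝ) - 1) := by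
    have hν := one_lt_nuP_mul_of_lt_Rr (sub_ne_zero.2 hζ1.symm) h
    clear h hζ
    induction s generalizing ζ with
    | zero => simpa using hν
    | succ s ih =>
      have hpos : 0 < nuP p (1 - ζ) :=
        pos_of_mul_pos_left (one_pos.trans hν) (mul_nonneg (by positivity) hp0.le)
      have hps : (1 : ℝ) ≤ (p : ℝ) ^ s := one_le_pow₀ hp1.le
      rw [pow_succ', pow_mul] at hne ⊢
      have hζp : ζ ^ p ≠ 1 := fun h0 => hne (by rw [h0, one_pow])
      refine ih hne hζp ?_
      rcases le_or_gt (nuP p (1 - ζ) * ((p : ℝ) - 1)) 1 with hle | hgt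
      · have hle' := le_nuP_pow_prime hp hζp hpos hle
        refine hν.trans_le ?_
        have := mul_le_mul_of_nonneg_right hle' (mul_nonneg (zero_le_one.trans hps) hp0.le)
        rw [pow_succ]
        linarith
      · rw [nuP_pow_prime_of_gt hp hζ1 hgt]
        nlinarith [mul_nonneg (sub_nonneg.2 hps) (mul_nonneg hpos.le hp0.le),
          mul_pos (one_pos.trans_le hps) hp0]
  have hiter : ∀ j : ℕ, (ζ ^ p ^ s) ^ p ^ j ≠ 1 ∧
      1 < nuP p (1 - (ζ ^ p ^ s) ^ p ^ j) * ((p : ℝ) - 1) := by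
    intro j
    induction j with
    | zero => simpa using ⟨hne, hbig⟩
    | succ j ih =>
      have hstep := nuP_pow_prime_of_gt hp ih.1 ih.2
      rw [pow_succ, pow_mul, hstep]
      have hpos := pos_of_mul_pos_left (one_pos.trans ih.2) hp0.le
      refine ⟨fun h0 => ?_, by nlinarith [ih.2]⟩
      rw [h0, sub_self, nuP, norm_zero, Real.logb_zero, neg_zero] at hstep
      linarith
  refine (hiter k).1 ?_
  rw [← pow_mul, mul_comm, pow_mul, hζ, one_pow]

/-- The valuation of `1 - λ^{p^s}` in terms of the closest `p`-power root of unity. -/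
lemma nuP_one_sub_pow_eq_nearest [IsAlgClosed K] (hp : ‖(p : K)‖ = (p : ℝ)⁻¹) {lam γ₀ : K}
    {s t : ℕ} (hroot : ∀ n : ℕ, 1 ≤ n → lam ^ n ≠ 1) (hs : ‖1 - lam‖ < Rr p (s + 1))
    (hγ₀ : γ₀ ∈ GammaR p K) (hγmin : ∀ γ ∈ GammaR p K, ‖γ₀ - lam‖ ≤ ‖γ - lam‖)
    (ht : Rr p t ≤ ‖γ₀ - lam‖ ∧ ‖γ₀ - lam‖ < Rr p (t + 1)) :
    nuP p (1 - lam ^ p ^ s) = ((s : ℝ) - t) + (p : ℝ) ^ t * nuP p (γ₀ - lam) := by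
  have hp1 := one_lt_cast_prime p
  have hp0 : 0 < (p : ℝ) - 1 := sub_pos.2 hp1
  have hprime : p.Prime := Fact.out
  obtain ⟨k, hk⟩ := hγ₀
  have hγnorm : ‖γ₀‖ = 1 :=
    (pow_eq_one_iff_of_nonneg (norm_nonneg _) (pow_ne_zero k hprime.ne_zero)).1
      (by rw [← norm_pow, hk, norm_one])
  have hγne : γ₀ ≠ 0 := norm_ne_zero_iff.1 (by rw [hγnorm]; exact one_ne_zero)
  have hdist (z : K) : ‖lam / γ₀ - z‖ = ‖γ₀ * z - lam‖ := by
    rw [div_sub' hγne, norm_div, hγnorm, div_one, norm_sub_rev]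
  have hdist1 : ‖1 - lam / γ₀‖ = ‖γ₀ - lam‖ := by rw [norm_sub_rev, hdist, mul_one]
  have hν1 : nuP p (1 - lam / γ₀) = nuP p (γ₀ - lam) := by rw [nuP, hdist1, nuP]
  have hμroot : ∀ n : ℕ, 1 ≤ n → (lam / γ₀) ^ n ≠ 1 := by
    intro n hn h1
    rw [div_pow, div_eq_one_iff_eq (pow_ne_zero _ hγne)] at h1
    refine hroot (n * p ^ k) (Nat.mul_pos hn (pow_pos hprime.pos k)) ?_
    rw [pow_mul, h1, ← pow_mul, mul_comm, pow_mul, hk, one_pow]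
  have hμ1 : lam / γ₀ ≠ 1 := by simpa using hμroot 1 le_rfl
  have hann : InAnnulus p (lam / γ₀) t := inAnnulus_of_Rr hμ1 (by rwa [hdist1])
  have hγle : ‖γ₀ - lam‖ ≤ ‖1 - lam‖ := hγmin 1 ⟨0, one_pow _⟩
  have hγs : γ₀ ^ p ^ s = 1 := by
    refine pow_eq_one_of_norm_lt_Rr hp hk ?_
    have h1 : (1 : K) - γ₀ = (1 - lam) + -(γ₀ - lam) := by ring
    rw [h1]
    refine (IsUltrametricDist.norm_add_le_max _ _).trans_lt (max_lt hs ?_)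
    rw [norm_neg]
    exact hγle.trans_lt hs
  have hts : t ≤ s := by
    by_contra hlt
    have h1 := hann.2 (by omega)
    have h2 : 1 < nuP p (γ₀ - lam) * ((p : ℝ) ^ s * ((p : ℝ) - 1)) := by
      refine one_lt_nuP_mul_of_lt_Rr (fun h0 => ?_) (hγle.trans_lt hs)
      rw [h0, norm_zero] at hdist1
      exact hμ1 (sub_eq_zero.1 (norm_eq_zero.1 hdist1)).symm
    have hpos := hann.pos
    rw [hν1] at h1 hpos
    have h3 : (p : ℝ) ^ (s + 1) ≤ (p : ℝ) ^ t := pow_le_pow_right₀ hp1.le (by omega)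
    have h4 := mul_le_mul_of_nonneg_right h3 (mul_nonneg hpos.le hp0.le)
    rw [pow_succ] at h4
    nlinarith
  have hle := hann.le_nuP_pow hp hμroot
  have hge : nuP p (1 - (lam / γ₀) ^ p ^ t) ≤ (p : ℝ) ^ t * nuP p (γ₀ - lam) := by
    have hpow := pow_le_norm_one_sub_pow (pow_ne_zero t hprime.ne_zero) (norm_nonneg (γ₀ - lam))
      (μ := lam / γ₀) fun ζ hζ => by
        rw [hdist]
        refine hγmin _ ⟨max k t, ?_⟩
        obtain ⟨c, hc⟩ := pow_dvd_pow p (le_max_left k t)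
        obtain ⟨d, hd⟩ := pow_dvd_pow p (le_max_right k t)
        rw [mul_pow, hc, pow_mul, hk, one_pow, ← hc, hd, pow_mul, hζ, one_pow, one_mul]
    have hr : 0 < ‖γ₀ - lam‖ := by
      rw [← hdist1, norm_pos_iff, sub_ne_zero]
      exact hμ1.symm
    rw [← Real.logb_le_logb hp1 (pow_pos hr _) (lt_of_lt_of_le (pow_pos hr _) hpow),
      Real.logb_pow] at hpow
    push_cast at hpow
    simp only [nuP]
    linarith
  have heq : nuP p (1 - (lam / γ₀) ^ p ^ t) = (p : ℝ) ^ t * nuP p (γ₀ - lam) :=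
    le_antisymm hge (by rwa [hν1] at hle)
  have hlampow : ((lam / γ₀) ^ p ^ t) ^ p ^ (s - t) = lam ^ p ^ s := by
    rw [← pow_mul, ← pow_add, Nat.add_sub_cancel' hts, div_pow, hγs, div_one]
  have hbig : 1 < nuP p (1 - (lam / γ₀) ^ p ^ t) * ((p : ℝ) - 1) := by
    have := hann.1
    rw [hν1] at this
    rw [heq]
    linarith
  rw [← hlampow, nuP_one_sub_pow_eq hp (fun n hn => by
    rw [← pow_mul]
    exact hμroot _ (Nat.mul_pos (pow_pos hprime.pos t) hn)) hbig
    (pow_ne_zero _ hprime.ne_zero), padicValNat.prime_pow, heq, Nat.cast_sub hts]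
  ring

end CriticalRadius

section Radius

variable {p : ℕ} [Fact p.Prime] {K : Type*} [NontriviallyNormedField K]

lemma rQuad_pos {lam γ₀ : K} (h1 : 1 - lam ≠ 0) (hγ : γ₀ - lam ≠ 0) (s t : ℕ) :
    0 < rQuad p lam γ₀ 1 s t := by
  have hp1 := one_lt_cast_prime p
  have hR := Rr_succ_pos p s
  have := norm_pos_iff.2 h1
  have := norm_pos_iff.2 hγ
  rw [rQuad, rTilde, pow_one]
  positivity

lemma logb_rQuad {lam γ₀ : K} (h1 : 1 - lam ≠ 0) (hγ : γ₀ - lam ≠ 0) (s t : ℕ) :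
    Real.logb p (rQuad p lam γ₀ 1 s t) =
      -(1 / ((p : ℝ) ^ s * ((p : ℝ) - 1)) + (s * ((p : ℝ) - 1) - 1) / p * nuP p (1 - lam) +
        (((s : ℝ) - t) + (p : ℝ) ^ t * nuP p (γ₀ - lam)) / (p : ℝ) ^ s) := by
  have hp1 := one_lt_cast_prime p
  have hp0 : (0 : ℝ) < p := by positivity
  have hR := Rr_succ_pos p s
  have ha := norm_pos_iff.2 h1
  have hg := norm_pos_iff.2 hγ
  have hpow : (p : ℝ) ^ ((s : ℝ) - t) = (p : ℝ) ^ s / (p : ℝ) ^ t := by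
    rw [Real.rpow_sub hp0, Real.rpow_natCast, Real.rpow_natCast]
  rw [rQuad, rTilde, pow_one, Real.logb_mul (by positivity) (by positivity),
    Real.logb_mul (by positivity) (by positivity), Real.logb_mul (by positivity) (by positivity),
    Real.logb_mul (by positivity) (by positivity), Real.logb_rpow_eq_mul_logb_of_pos ha,
    Real.logb_rpow_eq_mul_logb_of_pos hR, Real.logb_rpow hp0 hp1.ne',
    Real.logb_rpow_eq_mul_logb_of_pos ha, Real.logb_rpow_eq_mul_logb_of_pos hg, logb_Rr_succ,
    hpow, nuP, nuP, Nat.cast_one]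
  have : (p : ℝ) - 1 ≠ 0 := (sub_pos.2 hp1).ne'
  field_simp
  ring

end Radius

end QuadraticLinearization

/-- Lemma: coefficient estimates at the critical radius
`τ = |1-λ|^{-1/p}·r̃(λ)`. For `p ≥ 3` and `1/p < |1-λ| < 1`: `|b_k|τ^k < τ` for `k ≥ 2`;
if `s ≥ 1` then `|b_k|τ^k ≤ R(s+1)τ` for `k ≥ 2`; and if `k-1 = p^{s+α}` with `α ≥ 1`,
then `|b_k|τ^k = p^{-1/(p-1)}τ`. -/
theorem stmt12 (p : ℕ) [Fact p.Prime] (hp3 : 3 ≤ p)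
    {K : Type*} [NontriviallyNormedField K] [IsUltrametricDist K] [CompleteSpace K]
    [IsAlgClosed K] [Algebra ℚ_[p] K]
    (hiso : ∀ x : ℚ_[p], ‖algebraMap ℚ_[p] K x‖ = ‖x‖)
    (hdense : Dense {x : K | IsAlgebraic ℚ_[p] x})
    (lam : K) (hroot : ∀ n : ℕ, 1 ≤ n → lam ^ n ≠ 1)
    (hlam1 : 1 / (p : ℝ) < ‖1 - lam‖) (hlam2 : ‖1 - lam‖ < 1)
    (m : ℕ) (hm : IsLeast {n : ℕ | 1 ≤ n ∧ ‖1 - lam ^ n‖ < 1} m)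
    (s : ℕ) (hs : Rr p s ≤ ‖1 - lam ^ m‖ ∧ ‖1 - lam ^ m‖ < Rr p (s + 1))
    (γ₀ : K) (hγ₀ : γ₀ ∈ GammaR p K)
    (hγmin : ∀ γ ∈ GammaR p K, ‖γ₀ - lam ^ m‖ ≤ ‖γ - lam ^ m‖)
    (t : ℕ) (ht : Rr p t ≤ ‖γ₀ - lam ^ m‖ ∧ ‖γ₀ - lam ^ m‖ < Rr p (t + 1))
    (b : ℕ → K) (hb : IsConjugacy lam (quadCoeff lam) b) :
    (∀ k : ℕ, 2 ≤ k →
      ‖b k‖ * rQuad p lam γ₀ m s t ^ k < rQuad p lam γ₀ m s t) ∧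
    (1 ≤ s → ∀ k : ℕ, 2 ≤ k →
      ‖b k‖ * rQuad p lam γ₀ m s t ^ k ≤ Rr p (s + 1) * rQuad p lam γ₀ m s t) ∧
    (∀ k α : ℕ, 1 ≤ α → k = p ^ (s + α) + 1 →
      ‖b k‖ * rQuad p lam γ₀ m s t ^ k =
        (p : ℝ) ^ (-(1 : ℝ) / ((p : ℝ) - 1)) * rQuad p lam γ₀ m s t) := by
  have hprime : p.Prime := Fact.out
  have hp1 := QuadraticLinearization.one_lt_cast_prime p
  have hp : ‖(p : K)‖ = (p : ℝ)⁻¹ := by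
    have := hiso (p : ℚ_[p])
    rwa [map_natCast, Padic.norm_p] at this
  have hm1 : m = 1 := le_antisymm (hm.2 ⟨le_rfl, by simpa using hlam2⟩) hm.1.1
  subst hm1
  rw [pow_one] at hs ht
  simp only [pow_one] at hγmin
  have hlam1' : (p : ℝ)⁻¹ < ‖1 - lam‖ := by rwa [one_div] at hlam1
  have hne : lam ≠ 1 := by simpa using hroot 1 le_rfl
  have h1 : 1 - lam ≠ 0 := sub_ne_zero.2 hne.symm
  have hγ : γ₀ - lam ≠ 0 := by
    intro h0
    obtain ⟨k, hk⟩ := hγ₀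
    rw [sub_eq_zero.1 h0] at hk
    exact hroot _ (pow_pos hprime.pos k) hk
  have hann := QuadraticLinearization.inAnnulus_of_Rr hne hs
  have hτ := QuadraticLinearization.rQuad_pos (p := p) h1 hγ s t
  have hlogτ := QuadraticLinearization.logb_rQuad (p := p) h1 hγ s t
  rw [← QuadraticLinearization.nuP_one_sub_pow_eq_nearest hp hroot hs.2 hγ₀ hγmin ht] at hlogτ
  set τ := rQuad p lam γ₀ 1 s t
  have hbpos (N : ℕ) : 0 < ‖b (N + 1)‖ * τ ^ N :=
    mul_pos (QuadraticLinearization.norm_conjugacy_succ hp hp3 hroot hlam1' hlam2 hb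
      (Nat.le_add_left 1 N)).1 (pow_pos hτ N)
  have hlog (N : ℕ) : Real.logb p (‖b (N + 1)‖ * τ ^ N) =
      -(QuadraticLinearization.excess p lam s N -
        ((N : ℝ) / p - (N / p : ℕ)) * nuP p (1 - lam)) := by
    have hν := QuadraticLinearization.nuP_conjugacy hp hp3 hroot hlam1' hlam2 hb N
    have hbn := pos_of_mul_pos_left (hbpos N) (pow_pos hτ N).le
    rw [Real.logb_mul hbn.ne' (pow_pos hτ N).ne', Real.logb_pow, hlogτ,
      QuadraticLinearization.excess]
    rw [nuP] at hν
    rw [← neg_neg (Real.logb p ‖b (N + 1)‖), hν]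
    have : (p : ℝ) - 1 ≠ 0 := (sub_pos.2 hp1).ne'
    field_simp
    ring
  have hsplit (N : ℕ) : ‖b (N + 1)‖ * τ ^ (N + 1) = ‖b (N + 1)‖ * τ ^ N * τ := by ring
  have hstrong : 1 ≤ s → ∀ k : ℕ, 2 ≤ k → ‖b k‖ * τ ^ k ≤ Rr p (s + 1) * τ := by
    intro hs1 k hk
    obtain ⟨N, rfl⟩ : ∃ N, k = N + 1 := ⟨k - 1, by omega⟩
    rw [hsplit]
    refine mul_le_mul_of_nonneg_right ?_ hτ.le
    have hle := QuadraticLinearization.le_excess hp hroot hann (N := N) (by omega)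
    rw [if_neg (by omega)] at hle
    rw [← Real.logb_le_logb hp1 (hbpos N) (QuadraticLinearization.Rr_succ_pos p s), hlog,
      QuadraticLinearization.logb_Rr_succ]
    linarith
  refine ⟨fun k hk => ?_, hstrong, fun k α hα hk => ?_⟩
  · rcases Nat.eq_zero_or_pos s with rfl | hs1
    · obtain ⟨N, rfl⟩ : ∃ N, k = N + 1 := ⟨k - 1, by omega⟩
      rw [hsplit]
      refine mul_lt_of_lt_one_left hτ ?_
      rw [← Real.logb_neg_iff hp1 (hbpos N), hlog, neg_lt_zero, sub_pos]
      have hle := QuadraticLinearization.le_excess hp hroot hann (N := N) (by omega)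
      rw [QuadraticLinearization.excess_zero_eq hp hroot hann] at hle ⊢
      have hp0 : 0 < (p : ℝ) - 1 := sub_pos.2 hp1
      have hS : (1 : ℝ) ≤ (p.digits N).sum := by
        rw [if_pos rfl, add_zero, pow_zero, one_mul] at hle
        exact (div_le_div_iff_of_pos_right hp0).1 hle
      have hmod : ((N % p : ℕ) : ℝ) ≤ (p.digits N).sum := by
        rw [Nat.digits_def' hprime.one_lt (by omega), List.sum_cons]
        exact_mod_cast Nat.le_add_right _ _
      have hδ : (N : ℝ) / p - (N / p : ℕ) = (N % p : ℕ) / p := by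
        have := congrArg (Nat.cast : ℕ → ℝ) (Nat.div_add_mod N p)
        push_cast at this
        field_simp
        linarith
      have hν1 : nuP p (1 - lam) < 1 := by
        have := Real.logb_lt_logb hp1 (by positivity) hlam1'
        rw [Real.logb_inv, Real.logb_self_eq_one hp1] at this
        rw [nuP]
        linarith
      calc ((N : ℝ) / p - (N / p : ℕ)) * nuP p (1 - lam)
          ≤ ((N % p : ℕ) : ℝ) / p := by
            rw [hδ]
            exact mul_le_of_le_one_right (by positivity) hν1.le
        _ ≤ (p.digits N).sum / (p : ℝ) := by gcongr
        _ < (p.digits N).sum / ((p : ℝ) - 1) := by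
            refine div_lt_div_of_pos_left (by linarith) hp0 (by linarith)
    · refine (hstrong hs1 k hk).trans_lt (mul_lt_of_lt_one_left hτ ?_)
      have hc : 0 < (p : ℝ) ^ s * ((p : ℝ) - 1) := mul_pos (by positivity) (sub_pos.2 hp1)
      rw [← Real.logb_neg_iff hp1 (QuadraticLinearization.Rr_succ_pos p s),
        QuadraticLinearization.logb_Rr_succ, neg_lt_zero]
      positivity
  · subst hk
    rw [hsplit]
    congr 1
    have hδ : ((p ^ (s + α) : ℕ) : ℝ) / p - (p ^ (s + α) / p : ℕ) = 0 := by
      rw [Nat.cast_div (dvd_pow_self p (by omega)) (by positivity), sub_self]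
    have hl := hlog (p ^ (s + α))
    rw [QuadraticLinearization.excess_prime_pow hp hroot hann, hδ, zero_mul, sub_zero] at hl
    rw [← Real.rpow_logb (by positivity) hp1.ne' (hbpos _), hl, neg_div]
end

section
/- Let p ≥ 3 and let f(x) = λx + Σ_{i≥2} a_i x^i ∈ 𝒪_p[[x]] with λ not a root of unity, 0 < |1-λ| < 1, |a₂| = 1 and |a₂² - a₃| = 1. Then every periodic point of f in the open unit disk has minimal period p^n for some integer n ≥ 0, and: (1) the fixed points of f in the open unit disk are x = 0 and one further point x₀ ≠ 0 with |x₀| = |1-λ|; (2) if s ≥ 2 and 1 ≤ n ≤ s-1, every periodic point of minimal period p^n satisfies |x| = |1-λ|^{(p-1)/p}; (3) if s ≥ 1, every periodic point of minimal period p^s satisfies |x| = Ψ(λ); (4) for n ≥ s+1, every periodic point of minimal period p^n satisfies |x| = p^{-1/p^n}. In particular, apart from 0, f has no periodic point in the open disk D_ρ(0) with ρ = min{|1-λ|, Ψ(λ)}; and ρ = Ψ(λ) if and only if s - t ≥ 2, or s - t = 1 and |γ₀ - λ| ≤ |1-λ|². -/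
open scoped BigOperators

open PowerSeries in
theorem PowerSeries.eq_zero_of_forall_X_pow_dvd {R : Type*} [CommRing R] {φ : R⟦X⟧}
    (h : ∀ n, (X : R⟦X⟧) ^ n ∣ φ) : φ = 0 := by
  ext n
  simpa using X_pow_dvd_iff.1 (h (n + 1)) n (Nat.lt_succ_self n)

open PowerSeries in
/-- An algebra endomorphism `T` of `R⟦X⟧` is trivial modulo `T X - X`. -/
theorem PowerSeries.algHom_X_sub_dvd {R : Type*} [CommRing R] (T : R⟦X⟧ →ₐ[R] R⟦X⟧)
    (φ : R⟦X⟧) : T X - X ∣ T φ - φ := by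
  let sh : ℕ → R⟦X⟧ := fun j => mk fun n => coeff (n + j) φ
  have hsh : ∀ j, sh j = C (coeff j φ) + X * sh (j + 1) := by
    intro j
    ext n
    cases n with
    | zero => simp [sh]
    | succ n =>
      simp only [sh, coeff_mk, map_add, coeff_succ_X_mul, coeff_C]
      simp [Nat.add_comm, Nat.add_left_comm]
  have hTC : ∀ a : R, T (C a) = C a := fun a => T.commutes a
  let Q : R⟦X⟧ := mk fun n => ∑ j ∈ Finset.range (n + 1), coeff (n - j) (T (sh (j + 1)))
  have key : ∀ N, T φ - φ = (T X - X) * (∑ j ∈ Finset.range N, X ^ j * T (sh (j + 1)))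
      + X ^ N * (T (sh N) - sh N) := by
    intro N
    induction N with
    | zero => simp [sh, show (mk fun n => coeff n φ) = φ from by ext; simp]
    | succ N ih =>
      rw [ih, Finset.sum_range_succ, hsh N, map_add, map_mul, hTC]
      ring
  have hQ : ∀ N, (X : R⟦X⟧) ^ N ∣ Q - ∑ j ∈ Finset.range N, X ^ j * T (sh (j + 1)) := by
    intro N
    rw [X_pow_dvd_iff]
    intro m hm
    simp only [map_sub, map_sum, Q, coeff_mk, coeff_X_pow_mul', sub_eq_zero]
    rw [← Finset.sum_filter]
    refine Finset.sum_congr ?_ fun _ _ => rfl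
    ext j
    simp only [Finset.mem_range, Finset.mem_filter]
    omega
  refine ⟨Q, sub_eq_zero.1 (eq_zero_of_forall_X_pow_dvd fun N => ?_)⟩
  obtain ⟨r, hr⟩ := hQ N
  refine ⟨T (sh N) - sh N - (T X - X) * r, ?_⟩
  rw [key N]
  linear_combination (-(T X - X)) * hr

open PowerSeries in
/-- `LeadingTerms T q a b` says that `T X = X + a X^(q+1) + b X^(q+2) + O(X^(q+3))`. -/
def LeadingTerms {k : Type*} [CommRing k] (T : k⟦X⟧ →ₐ[k] k⟦X⟧) (q : ℕ) (a b : k) : Prop :=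
  ∃ r : k⟦X⟧, T X = X + X ^ (q + 1) * (C a + C b * X + X ^ 2 * r)

theorem exists_one_add_pow_eq {R : Type*} [CommRing R] (u : R) (N : ℕ) :
    ∃ w : R, (1 + u) ^ N = 1 + N * u + N.choose 2 * u ^ 2 + u ^ 3 * w := by
  induction N with
  | zero => exact ⟨0, by simp⟩
  | succ N ih =>
    obtain ⟨w, hw⟩ := ih
    refine ⟨w * (1 + u) + N.choose 2, ?_⟩
    rw [pow_succ, hw, Nat.choose_succ_succ' N 1, Nat.choose_one_right]
    push_cast
    ring

open PowerSeries in
theorem LeadingTerms.sub_eq {k : Type*} [CommRing k] {T : k⟦X⟧ →ₐ[k] k⟦X⟧} {q : ℕ} {a b : k}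
    (hT : LeadingTerms T q a b) {ε : k} (hq : ∃ e : k⟦X⟧, X ^ q = C ε * X + X ^ 2 * e)
    {N : ℕ} {A B : k} {φ : k⟦X⟧} (hφ : ∃ ψ, φ = X ^ N * (C A + C B * X + X ^ 2 * ψ)) :
    ∃ ψ, T φ - φ = X ^ (N + q) * (C (N * A * a) +
      C (A * (N * b + ε * N.choose 2 * a ^ 2) + (N + 1) * a * B) * X + X ^ 2 * ψ) := by
  obtain ⟨ψ, rfl⟩ := hφ
  obtain ⟨r, hr⟩ := hT
  obtain ⟨e, he⟩ := hq
  obtain ⟨s, hs⟩ := algHom_X_sub_dvd T ψ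
  have hTψ : T ψ = ψ + (T X - X) * s := by rw [← hs]; ring
  have hTC : ∀ c : k, T (C c) = C c := fun c => T.commutes c
  set v : k⟦X⟧ := C a + C b * X + X ^ 2 * r with hv
  obtain ⟨w, hw⟩ := exists_one_add_pow_eq (X ^ q * v) N
  have hX : T X = X * (1 + X ^ q * v) := by rw [hr]; ring
  have hE : ∃ E, (1 + X ^ q * v) ^ N =
      1 + X ^ q * (C (N * a) + C (N * b + ε * N.choose 2 * a ^ 2) * X + X ^ 2 * E) := by
    have : ∃ d, v ^ 2 = C (a ^ 2) + X * d := ⟨C (2 * a * b) + C (2 * a) * X * r + X * (C b + X * r) ^ 2, by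
      simp only [hv, map_pow, map_mul, map_ofNat]; ring⟩
    obtain ⟨d, hd⟩ := this
    refine ⟨(N : k⟦X⟧) * r + (N.choose 2 : k⟦X⟧) * (C ε * d + e * v ^ 2) + v ^ 3 * w * (C ε + X * e) ^ 2, ?_⟩
    rw [hw, mul_pow _ v 2, mul_pow _ v 3]
    have h2 : ((X : k⟦X⟧) ^ q) ^ 2 * v ^ 2 = X ^ q * (C (ε * a ^ 2) * X + X ^ 2 * (C ε * d + e * v ^ 2)) := by
      rw [sq (X ^ q)]
      nth_rewrite 2 [he]
      simp only [map_mul]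
      linear_combination X ^ q * C ε * X * hd
    have h3 : ((X : k⟦X⟧) ^ q) ^ 3 = X ^ q * (X ^ 2 * (C ε + X * e) ^ 2) := by
      rw [pow_succ' _ 2]
      congr 1
      rw [he]; ring
    rw [h2, h3, hv]
    simp only [map_mul, map_add, map_natCast]
    ring
  obtain ⟨E, hE⟩ := hE
  have hXs : T X - X = X ^ q * (X * v) := by rw [hr]; ring
  rw [map_mul, map_pow, map_add, map_add, map_mul, map_mul, map_pow, hTC, hTC, hTψ, hXs, hX, mul_pow,
    hE, pow_add]
  set Y : k⟦X⟧ := X ^ q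
  set β : k := N * b + ε * N.choose 2 * a ^ 2
  set P : k⟦X⟧ := C (N * a) + C β * X + X ^ 2 * E with hP
  obtain ⟨g, hg⟩ : ∃ g, Y = X * g := ⟨C ε + X * e, by rw [he]; ring⟩
  set M : k⟦X⟧ := P * (1 + Y * v) ^ 2 + v * (2 + Y * v) with hM
  refine ⟨C A * E + C B * (C b + X * r) + C B * (C β + X * E) + C B * g * P * v +
    M * ψ + (1 + Y * M) * (X * v * s), ?_⟩
  clear_value v P Y β
  simp only [map_mul, map_add, map_natCast, map_one] at hP ⊢
  linear_combination X ^ N * Y * ((C A + C B * X) * hP + C B * X * hv + C B * X * P * v * hg) -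
    X ^ N * X ^ 2 * Y * (ψ + Y * (X * v) * s) * hM

theorem CharP.two_ne_zero_of_three_le {k : Type*} [Ring k] {p : ℕ} [CharP k p] (hp3 : 3 ≤ p) :
    (2 : k) ≠ 0 := by
  intro h
  have h' : ((2 : ℕ) : k) = 0 := by exact_mod_cast h
  have := Nat.le_of_dvd (by norm_num) ((CharP.cast_eq_zero_iff k p 2).1 h')
  omega

theorem cast_choose_two_mul_two {R : Type*} [CommRing R] (N : ℕ) :
    (N.choose 2 : R) * 2 = N * (N - 1) := by
  induction N with
  | zero => simp
  | succ N ih =>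
    rw [Nat.choose_succ_succ' N 1, Nat.choose_one_right]
    push_cast
    linear_combination ih

open PowerSeries in
theorem LeadingTerms.iterate_sub {k : Type*} [CommRing k] {T : k⟦X⟧ →ₐ[k] k⟦X⟧} {q : ℕ}
    {a b : k} (hT : LeadingTerms T q a b) {ε : k} (hq : ∃ e : k⟦X⟧, X ^ q = C ε * X + X ^ 2 * e)
    (hqk : (q : k) = 1) (m : ℕ) :
    ∃ (B : k) (ψ : k⟦X⟧), ((T.toLinearMap - 1) ^ m) X =
      X ^ (m * q + 1) * (C ((m.factorial : k) * a ^ m) + C B * X + X ^ 2 * ψ) := by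
  induction m with
  | zero => exact ⟨0, 0, by simp⟩
  | succ m ih =>
    obtain ⟨B, ψ, h⟩ := ih
    obtain ⟨ψ', h'⟩ := hT.sub_eq hq ⟨ψ, h⟩
    refine ⟨((m.factorial : k) * a ^ m) * ((m * q + 1 : ℕ) * b +
      ε * (m * q + 1).choose 2 * a ^ 2) + ((m * q + 1 : ℕ) + 1) * a * B, ψ', ?_⟩
    rw [pow_succ', Module.End.mul_apply]
    refine h'.trans ?_
    rw [show m * q + 1 + q = (m + 1) * q + 1 by ring]
    congr 4
    push_cast [hqk, Nat.factorial_succ]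
    ring

open PowerSeries in
theorem LeadingTerms.pow_prime {k : Type*} [Field k] {p : ℕ} [hp : Fact p.Prime] [CharP k p]
    (hp3 : 3 ≤ p) {T : k⟦X⟧ →ₐ[k] k⟦X⟧} {q : ℕ}
    {a b : k} (hT : LeadingTerms T q a b) {ε : k} (hq : ∃ e : k⟦X⟧, X ^ q = C ε * X + X ^ 2 * e)
    (hqk : (q : k) = 1) :
    ∃ b', LeadingTerms (T ^ p) (p * q + 1)
      (a * (((p - 2).factorial : k) * a ^ (p - 2) * (ε * a ^ 2 - b))) b' := by
  obtain ⟨m, rfl⟩ : ∃ m, p = m + 2 := ⟨p - 2, by omega⟩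
  have hm : (m : k) + 2 = 0 := by
    have := CharP.cast_eq_zero k (m + 2)
    push_cast at this
    exact this
  have h2 : (2 : k) ≠ 0 := CharP.two_ne_zero_of_three_le hp3
  obtain ⟨B, ψ, h⟩ := hT.iterate_sub hq hqk m
  obtain ⟨ψ₁, h₁⟩ := hT.sub_eq hq ⟨ψ, h⟩
  obtain ⟨ψ₂, h₂⟩ := hT.sub_eq hq ⟨ψ₁, h₁⟩
  have hN1 : ((m * q + 1 : ℕ) : k) = -1 := by push_cast [hqk]; linear_combination hm
  have hN2 : ((m * q + 1 + q : ℕ) : k) = 0 := by push_cast [hqk]; linear_combination hm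
  have hc1 : ((m * q + 1).choose 2 : k) = 1 := by
    have := cast_choose_two_mul_two (R := k) (m * q + 1)
    rw [hN1] at this
    apply mul_right_cancel₀ h2
    rw [this]; ring
  have hc2 : ((m * q + 1 + q).choose 2 : k) = 0 := by
    have := cast_choose_two_mul_two (R := k) (m * q + 1 + q)
    rw [hN2] at this
    apply mul_right_cancel₀ h2
    rw [this]; ring
  have hpow : (T ^ (m + 2)) X - X = ((T.toLinearMap - 1) ^ (m + 2)) X := by
    have : CharP (Module.End k k⟦X⟧) (m + 2) := charP_of_injective_algebraMap
      (FaithfulSMul.algebraMap_injective k (Module.End k k⟦X⟧)) (m + 2)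
    rw [sub_pow_char_of_commute (m + 2) (Commute.one_right _), one_pow, LinearMap.sub_apply,
      Module.End.pow_apply, AlgHom.coe_pow]
    simp
  have key : ((T.toLinearMap - 1) ^ (m + 2)) X =
      T (T (((T.toLinearMap - 1) ^ m) X) - ((T.toLinearMap - 1) ^ m) X) -
        (T (((T.toLinearMap - 1) ^ m) X) - ((T.toLinearMap - 1) ^ m) X) := by
    rw [pow_succ', pow_succ']; rfl
  refine ⟨coeff 0 ψ₂, mk fun n => coeff (n + 1) ψ₂, ?_⟩
  rw [← sub_eq_iff_eq_add', hpow, key, h₂, hN1, hN2, hc1, hc2]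
  have hψ : ψ₂ = C (coeff 0 ψ₂) + X * mk fun n => coeff (n + 1) ψ₂ := by
    rw [add_comm]; simpa using eq_X_mul_shift_add_const ψ₂
  conv_lhs => rw [hψ]
  simp only [Nat.add_sub_cancel, map_mul, map_add, map_zero, map_one, map_sub, map_pow, map_neg]
  ring

open PowerSeries in
/-- Two commuting series tangent to the identity determine each other's subleading term. -/
theorem LeadingTerms.commute {k : Type*} [Field k] {p : ℕ} [CharP k p]
    (hp3 : 3 ≤ p) {F G : k⟦X⟧ →ₐ[k] k⟦X⟧} {q : ℕ} {a b α β : k}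
    (hF : LeadingTerms F 1 a b) (hG : LeadingTerms G q α β) (hq : 2 ≤ q) (hqk : (q : k) = 1)
    (hFG : F (G X) = G (F X)) : a * β = α * (b - a ^ 2) := by
  have h2 : (2 : k) ≠ 0 := CharP.two_ne_zero_of_three_le hp3
  have hF' : ∃ ψ, F X - X = X ^ 2 * (C a + C b * X + X ^ 2 * ψ) := by
    obtain ⟨r, hr⟩ := hF
    exact ⟨r, by rw [hr]; ring⟩
  have hG' : ∃ ψ, G X - X = X ^ (q + 1) * (C α + C β * X + X ^ 2 * ψ) := by
    obtain ⟨r, hr⟩ := hG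
    exact ⟨r, by rw [hr]; ring⟩
  obtain ⟨ψ₁, h₁⟩ := hF.sub_eq (ε := 1) ⟨0, by simp⟩ hG'
  obtain ⟨ψ₂, h₂⟩ := hG.sub_eq (ε := 0) ⟨X ^ (q - 2), by
    rw [map_zero, zero_mul, zero_add, ← pow_add]; congr 1; omega⟩ hF'
  have h₃ : F (G X - X) - (G X - X) = G (F X - X) - (F X - X) := by
    rw [map_sub, map_sub, hFG]; ring
  rw [h₁, h₂, show q + 1 + 1 = 2 + q by ring] at h₃
  have h₄ := mul_left_cancel₀ (pow_ne_zero _ X_ne_zero) h₃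
  have hco : ∀ (x y : k) (ψ : k⟦X⟧), coeff 1 (C x + C y * X + X ^ 2 * ψ) = y := by
    intro x y ψ
    rw [map_add, map_add, coeff_C_mul, coeff_one_X, coeff_X_pow_mul', if_neg (by norm_num), coeff_C,
      if_neg one_ne_zero]
    ring
  have h₅ := congrArg (coeff 1) h₄
  rw [hco, hco] at h₅
  have hc : ((q + 1).choose 2 : k) = 1 := by
    apply mul_right_cancel₀ h2
    rw [cast_choose_two_mul_two]
    push_cast [hqk]
    ring
  rw [hc] at h₅
  push_cast [hqk] at h₅
  linear_combination h₅

open PowerSeries in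
/-- Minimal ramification in characteristic `p`. -/
theorem LeadingTerms.pow_prime_pow {k : Type*} [Field k] {p : ℕ} [hp : Fact p.Prime] [CharP k p]
    (hp3 : 3 ≤ p) {T : k⟦X⟧ →ₐ[k] k⟦X⟧} {a b : k} (hT : LeadingTerms T 1 a b) (ha : a ≠ 0)
    (hab : b - a ^ 2 ≠ 0) (n : ℕ) :
    ∃ α β, α ≠ 0 ∧ LeadingTerms (T ^ p ^ n) (∑ i ∈ Finset.range (n + 1), p ^ i) α β := by
  have hfac : ((p - 2).factorial : k) ≠ 0 := by
    rw [Ne, CharP.cast_eq_zero_iff k p, hp.out.dvd_factorial]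
    omega
  induction n with
  | zero => exact ⟨a, b, ha, by simpa using hT⟩
  | succ n ih =>
    obtain ⟨α, β, hα, h⟩ := ih
    rw [pow_succ, pow_mul, geom_sum_succ (n := n + 1)]
    cases n with
    | zero =>
      simp only [pow_zero, pow_one, zero_add, Finset.sum_range_one] at h ⊢
      obtain ⟨b', hb'⟩ := hT.pow_prime hp3 (ε := 1) ⟨0, by simp⟩ (by simp)
      refine ⟨_, b', ?_, hb'⟩
      refine mul_ne_zero ha (mul_ne_zero (mul_ne_zero hfac (pow_ne_zero _ ha)) ?_)
      rw [one_mul, ← neg_sub]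
      exact neg_ne_zero.2 hab
    | succ n =>
      set q := ∑ i ∈ Finset.range (n + 1 + 1), p ^ i with hq
      have hqk : (q : k) = 1 := by simp [hq, geom_sum_succ]
      have hq2 : 2 ≤ q := by
        rw [hq, geom_sum_succ, geom_sum_succ]
        have : 0 < p := hp.out.pos
        nlinarith [Nat.zero_le (p * ∑ i ∈ Finset.range n, p ^ i)]
      have hc := hT.commute hp3 h hq2 hqk (by
        rw [← AlgHom.mul_apply, ← AlgHom.mul_apply, ← pow_succ, ← pow_succ'])
      obtain ⟨b', hb'⟩ := h.pow_prime hp3 (ε := 0) ⟨X ^ (q - 2), by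
        rw [map_zero, zero_mul, zero_add, ← pow_add]; congr 1; omega⟩ hqk
      refine ⟨_, b', ?_, hb'⟩
      refine mul_ne_zero hα (mul_ne_zero (mul_ne_zero hfac (pow_ne_zero _ hα)) ?_)
      rw [zero_mul, zero_sub]
      exact neg_ne_zero.2 (right_ne_zero_of_mul (a := a) (hc ▸ mul_ne_zero hα hab))

section Disk

open PowerSeries

variable {K : Type*} [NontriviallyNormedField K] [IsUltrametricDist K]

/-- The closed unit disk of `K` as a valuation ring. -/
noncomputable abbrev unitDisk (K : Type*) [NontriviallyNormedField K] [IsUltrametricDist K] :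
    ValuationSubring K :=
  (NormedField.valuation (K := K)).valuationSubring

theorem mem_unitDisk_iff {x : K} : x ∈ unitDisk K ↔ ‖x‖ ≤ 1 := Iff.rfl

theorem unitDisk.norm_le (a : unitDisk K) : ‖(a : K)‖ ≤ 1 := a.2

theorem unitDisk.residue_eq_zero_iff (a : unitDisk K) :
    IsLocalRing.residue (unitDisk K) a = 0 ↔ ‖(a : K)‖ < 1 := by
  rw [IsLocalRing.residue_eq_zero_iff, IsLocalRing.mem_maximalIdeal, mem_nonunits_iff]
  refine ⟨fun h => lt_of_le_of_ne (unitDisk.norm_le a) fun h1 => h ?_, fun h hu => ?_⟩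
  · have ha : (a : K) ≠ 0 := norm_ne_zero_iff.1 (by rw [h1]; exact one_ne_zero)
    refine IsUnit.of_mul_eq_one ⟨(a : K)⁻¹, mem_unitDisk_iff.2 (by rw [norm_inv, h1, inv_one])⟩ ?_
    exact Subtype.ext (mul_inv_cancel₀ ha)
  · obtain ⟨b, hb⟩ := hu.exists_right_inv
    have h' : ‖(a : K)‖ * ‖(b : K)‖ = 1 := by
      rw [← norm_mul, ← norm_one (α := K)]
      exact congrArg norm (congrArg Subtype.val hb)
    nlinarith [unitDisk.norm_le b, norm_nonneg (a : K), norm_nonneg (b : K)]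

theorem summable_norm_coeff_mul_pow {x : K} (hx : ‖x‖ < 1) (φ : (unitDisk K)⟦X⟧) :
    Summable fun n => ‖((coeff n φ : unitDisk K) : K) * x ^ n‖ := by
  refine Summable.of_nonneg_of_le (fun _ => norm_nonneg _) (fun n => ?_)
    (summable_geometric_of_lt_one (norm_nonneg x) hx)
  rw [norm_mul, norm_pow]
  exact mul_le_of_le_one_left (by positivity) (unitDisk.norm_le _)

theorem map_residue_X_sub_C_mul {a : unitDisk K} (ha : ‖(a : K)‖ < 1) (g : (unitDisk K)⟦X⟧) :
    PowerSeries.map (IsLocalRing.residue (unitDisk K)) ((X - C a) * g) =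
      X * PowerSeries.map (IsLocalRing.residue (unitDisk K)) g := by
  rw [map_mul, map_sub, map_X, map_C, (unitDisk.residue_eq_zero_iff a).2 ha, map_zero, sub_zero]

variable [CompleteSpace K]

/-- Evaluation of integral power series at a point of the open unit disk. -/
noncomputable def diskEval {x : K} (hx : ‖x‖ < 1) : (unitDisk K)⟦X⟧ →+* K where
  toFun φ := pEval (fun n => ((coeff n φ : unitDisk K) : K)) x
  map_one' := by
    rw [pEval, tsum_eq_single 0 fun n hn => by simp [coeff_one, hn]]
    simp
  map_zero' := by simp [pEval]
  map_add' φ ψ := by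
    simp only [pEval, map_add, AddMemClass.coe_add, add_mul]
    exact (summable_norm_coeff_mul_pow hx φ).of_norm.tsum_add
      (summable_norm_coeff_mul_pow hx ψ).of_norm
  map_mul' φ ψ := by
    rw [pEval, pEval, pEval, tsum_mul_tsum_eq_tsum_sum_antidiagonal_of_summable_norm
      (summable_norm_coeff_mul_pow hx φ) (summable_norm_coeff_mul_pow hx ψ)]
    refine tsum_congr fun n => ?_
    rw [coeff_mul, AddSubmonoidClass.coe_finsetSum, Finset.sum_mul]
    refine Finset.sum_congr rfl fun ij hij => ?_
    rw [← Finset.HasAntidiagonal.mem_antidiagonal.1 hij, pow_add, MulMemClass.coe_mul]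
    ring

theorem diskEval_apply {x : K} (hx : ‖x‖ < 1) (φ : (unitDisk K)⟦X⟧) :
    diskEval hx φ = pEval (fun n => ((coeff n φ : unitDisk K) : K)) x := rfl

@[simp]
theorem diskEval_C {x : K} (hx : ‖x‖ < 1) (a : unitDisk K) : diskEval hx (C a) = a := by
  rw [diskEval_apply, pEval, tsum_eq_single 0 fun n hn => by simp [coeff_C, hn]]
  simp

@[simp]
theorem diskEval_X {x : K} (hx : ‖x‖ < 1) : diskEval hx X = x := by
  rw [diskEval_apply, pEval, tsum_eq_single 1 fun n hn => by simp [coeff_X, hn]]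
  simp

theorem norm_diskEval_le {x : K} (hx : ‖x‖ < 1) (φ : (unitDisk K)⟦X⟧) : ‖diskEval hx φ‖ ≤ 1 := by
  refine IsUltrametricDist.norm_tsum_le_of_forall_le_of_nonneg zero_le_one fun n => ?_
  rw [norm_mul, norm_pow]
  exact mul_le_one₀ (unitDisk.norm_le _) (by positivity) (pow_le_one₀ (norm_nonneg _) hx.le)

theorem exists_eq_C_add_X_mul {R : Type*} [CommRing R] (φ : R⟦X⟧) :
    ∃ ψ, φ = C (constantCoeff φ) + X * ψ :=
  ⟨_, by rw [add_comm]; exact eq_X_mul_shift_add_const φ⟩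

theorem norm_diskEval_lt {x : K} (hx : ‖x‖ < 1) {φ : (unitDisk K)⟦X⟧}
    (h : ‖((constantCoeff φ : unitDisk K) : K)‖ < 1) : ‖diskEval hx φ‖ < 1 := by
  obtain ⟨ψ, hψ⟩ := exists_eq_C_add_X_mul φ
  rw [hψ, map_add, map_mul, diskEval_C, diskEval_X]
  refine (IsUltrametricDist.norm_add_le_max _ _).trans_lt (max_lt h ?_)
  rw [norm_mul]
  exact (mul_le_of_le_one_right (norm_nonneg _) (norm_diskEval_le hx ψ)).trans_lt hx

theorem diskEval_algHom {x y : K} (hx : ‖x‖ < 1) (hy : ‖y‖ < 1)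
    (T : (unitDisk K)⟦X⟧ →ₐ[unitDisk K] (unitDisk K)⟦X⟧) (hxy : diskEval hx (T X) = y)
    (φ : (unitDisk K)⟦X⟧) : diskEval hx (T φ) = diskEval hy φ := by
  have key : ∀ N : ℕ, ∃ ψ, diskEval hx (T φ) - diskEval hy φ =
      y ^ N * (diskEval hx (T ψ) - diskEval hy ψ) := by
    intro N
    induction N with
    | zero => exact ⟨φ, by simp⟩
    | succ N ih =>
      obtain ⟨ψ, hψ⟩ := ih
      obtain ⟨ψ', hψ'⟩ := exists_eq_C_add_X_mul ψ
      refine ⟨ψ', ?_⟩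
      have hTC : T (C (constantCoeff ψ)) = C (constantCoeff ψ) := T.commutes _
      rw [hψ, hψ', map_add T, map_mul T, hTC]
      simp only [map_add, map_mul, diskEval_X, diskEval_C, hxy]
      ring
  have hle : ∀ N : ℕ, ‖diskEval hx (T φ) - diskEval hy φ‖ ≤ ‖y‖ ^ N := by
    intro N
    obtain ⟨ψ, hψ⟩ := key N
    rw [hψ, norm_mul, norm_pow]
    refine mul_le_of_le_one_right (by positivity) ?_
    rw [sub_eq_add_neg]
    refine (IsUltrametricDist.norm_add_le_max _ _).trans ?_
    rw [norm_neg]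
    exact max_le (norm_diskEval_le _ _) (norm_diskEval_le _ _)
  have h0 := ge_of_tendsto' (tendsto_pow_atTop_nhds_zero_of_lt_one (norm_nonneg y) hy) hle
  exact sub_eq_zero.1 (norm_le_zero_iff.1 h0)

/-- Division of an integral power series by `X - a`. -/
theorem exists_eq_C_add_X_sub_C_mul {a : unitDisk K} (ha : ‖(a : K)‖ < 1) (φ : (unitDisk K)⟦X⟧) :
    ∃ g : (unitDisk K)⟦X⟧, φ = C ⟨diskEval ha φ, norm_diskEval_le ha φ⟩ + (X - C a) * g := by
  let sh : ℕ → (unitDisk K)⟦X⟧ := fun j => mk fun n => coeff (n + j) φ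
  have hsh : ∀ j, diskEval ha (sh j) = (coeff j φ : unitDisk K) + a * diskEval ha (sh (j + 1)) := by
    intro j
    have : sh j = C (coeff j φ) + X * sh (j + 1) := by
      ext1 n
      cases n with
      | zero => simp [sh]
      | succ n =>
        simp only [sh, coeff_mk, map_add, coeff_succ_X_mul, coeff_C]
        simp [Nat.add_comm, Nat.add_left_comm]
    rw [this, map_add, map_mul, diskEval_C, diskEval_X]
  have hsh0 : sh 0 = φ := by ext1 n; simp [sh]
  refine ⟨mk fun n => ⟨diskEval ha (sh (n + 1)), norm_diskEval_le ha _⟩, ?_⟩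
  ext1 n
  refine Subtype.ext ?_
  rw [sub_mul, map_add, map_sub, coeff_C_mul, coeff_mk]
  cases n with
  | zero =>
    have := hsh 0
    rw [hsh0] at this
    simp only [coeff_zero_X_mul, zero_sub, coeff_C, if_pos]
    push_cast
    rw [this]
    simp
  | succ n =>
    simp only [coeff_succ_X_mul, coeff_C, coeff_mk, Nat.succ_ne_zero, if_false]
    push_cast
    rw [hsh (n + 1)]
    simp

/-- If an integral power series of Weierstrass degree `d` has `d` distinct zeros in the open unit
disk, then the product of their absolute values is that of the constant coefficient. -/
theorem norm_constantCoeff_eq_prod (S : Finset K) :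
    ∀ φ : (unitDisk K)⟦X⟧, (∀ a ∈ S, ∃ ha : ‖a‖ < 1, diskEval ha φ = 0) →
      (PowerSeries.map (IsLocalRing.residue (unitDisk K)) φ).order = S.card →
      ‖((constantCoeff φ : unitDisk K) : K)‖ = ∏ a ∈ S, ‖a‖ := by
  classical
  induction S using Finset.induction_on with
  | empty =>
    intro φ _ h
    rw [Finset.prod_empty]
    refine le_antisymm (unitDisk.norm_le _) (not_lt.1 fun hlt => ?_)
    rw [← unitDisk.residue_eq_zero_iff] at hlt
    rw [Finset.card_empty, Nat.cast_zero] at h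
    refine order_ne_zero_iff_constCoeff_eq_zero.2 ?_ h
    rw [← coeff_zero_eq_constantCoeff_apply, coeff_map, coeff_zero_eq_constantCoeff_apply, hlt]
  | insert a S haS ih =>
    intro φ hφ h
    obtain ⟨ha, hφa⟩ := hφ a (Finset.mem_insert_self a S)
    obtain ⟨g, hg⟩ := exists_eq_C_add_X_sub_C_mul (a := ⟨a, ha.le⟩) ha φ
    have hg' : φ = (X - C ⟨a, ha.le⟩) * g := by
      rw [hg]
      convert zero_add _
      rw [← map_zero C]
      exact congrArg C (Subtype.ext hφa)
    have hz : ∀ b ∈ S, ∃ hb : ‖b‖ < 1, diskEval hb g = 0 := by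
      intro b hb
      obtain ⟨hb1, hφb⟩ := hφ b (Finset.mem_insert_of_mem hb)
      refine ⟨hb1, ?_⟩
      rw [hg', map_mul, map_sub, diskEval_X, diskEval_C] at hφb
      refine (mul_eq_zero.1 hφb).resolve_left (sub_ne_zero.2 ?_)
      rintro rfl
      exact haS hb
    have ho : (PowerSeries.map (IsLocalRing.residue (unitDisk K)) g).order = S.card := by
      rw [hg', map_residue_X_sub_C_mul ha, order_mul, order_X, Finset.card_insert_of_notMem haS,
        Nat.cast_succ, add_comm] at h
      exact (ENat.add_left_injective_of_ne_top ENat.one_ne_top) h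
    rw [Finset.prod_insert haS, ← ih g hz ho, hg', map_mul, map_sub, constantCoeff_X, zero_sub,
      constantCoeff_C]
    push_cast
    rw [norm_mul, norm_neg]

end Disk

section NearTranslation

variable {K : Type*} [NontriviallyNormedField K]

/-- A self-map of the open unit disk which, at every scale, is a translation up to a strictly
smaller error. -/
structure IsNearTranslation (f : K → K) : Prop where
  norm_lt_one : ∀ x, ‖x‖ < 1 → ‖f x‖ < 1
  norm_sub_lt : ∀ x y, ‖x‖ < 1 → ‖y‖ < 1 → x ≠ y → ‖(f y - f x) - (y - x)‖ < ‖y - x‖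

namespace IsNearTranslation

protected theorem id : IsNearTranslation (id : K → K) where
  norm_lt_one _ hx := hx
  norm_sub_lt x y _ _ hxy := by simpa using sub_ne_zero.2 hxy.symm

variable [IsUltrametricDist K]

theorem norm_eq_of_norm_sub_lt {a b : K} (h : ‖a - b‖ < ‖b‖) : ‖a‖ = ‖b‖ := by
  have := IsUltrametricDist.norm_add_eq_max_of_norm_ne_norm h.ne
  rwa [sub_add_cancel, max_eq_right h.le] at this

variable {f g : K → K}

theorem norm_sub (hf : IsNearTranslation f) {x y : K} (hx : ‖x‖ < 1) (hy : ‖y‖ < 1) :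
    ‖f y - f x‖ = ‖y - x‖ := by
  rcases eq_or_ne x y with rfl | hxy
  · simp
  · exact norm_eq_of_norm_sub_lt (hf.norm_sub_lt x y hx hy hxy)

theorem comp (hf : IsNearTranslation f) (hg : IsNearTranslation g) :
    IsNearTranslation (f ∘ g) where
  norm_lt_one x hx := hf.norm_lt_one _ (hg.norm_lt_one x hx)
  norm_sub_lt x y hx hy hxy := by
    have h := hg.norm_sub hx hy
    have hne : g x ≠ g y := by
      intro hgxy
      rw [hgxy, sub_self, norm_zero] at h
      exact hxy (sub_eq_zero.1 (norm_eq_zero.1 h.symm)).symm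
    have h1 := hf.norm_sub_lt _ _ (hg.norm_lt_one x hx) (hg.norm_lt_one y hy) hne
    rw [h] at h1
    have h2 : (f ∘ g) y - (f ∘ g) x - (y - x) =
        (f (g y) - f (g x) - (g y - g x)) + (g y - g x - (y - x)) := by
      simp only [Function.comp_apply]
      ring
    rw [h2]
    exact (IsUltrametricDist.norm_add_le_max _ _).trans_lt
      (max_lt h1 (hg.norm_sub_lt x y hx hy hxy))

theorem iterate (hf : IsNearTranslation f) (n : ℕ) : IsNearTranslation f^[n] := by
  induction n with
  | zero => exact IsNearTranslation.id
  | succ n ih => exact ih.comp hf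

theorem eq_of_iterate_eq (hf : IsNearTranslation f) {x : K} (hx : ‖x‖ < 1) {m : ℕ}
    (hm : ‖(m : K)‖ = 1) (h : f^[m] x = x) : f x = x := by
  by_contra hne
  have hpos : 0 < ‖f x - x‖ := norm_pos_iff.2 (sub_ne_zero.2 hne)
  have hsum : ∑ j ∈ Finset.range m, (f^[j] (f x) - f^[j] x) = 0 := by
    have := Finset.sum_range_sub (fun j => f^[j] x) m
    simp only [Function.iterate_succ_apply] at this
    rw [this, h]
    simp
  have hsum2 : ∑ j ∈ Finset.range m, ((f^[j] (f x) - f^[j] x) - (f x - x)) =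
      -((m : K) * (f x - x)) := by
    rw [Finset.sum_sub_distrib, hsum, Finset.sum_const, Finset.card_range, nsmul_eq_mul, zero_sub]
  have hlt : ‖∑ j ∈ Finset.range m, ((f^[j] (f x) - f^[j] x) - (f x - x))‖ < ‖f x - x‖ := by
    have hm0 : m ≠ 0 := by
      rintro rfl
      simp at hm
    obtain ⟨j, -, hj⟩ := IsUltrametricDist.isNonarchimedean_norm.finset_image_add_of_nonempty
      (fun j => (f^[j] (f x) - f^[j] x) - (f x - x)) (Finset.nonempty_range_iff.2 hm0)
    exact hj.trans_lt ((hf.iterate j).norm_sub_lt x (f x) hx (hf.norm_lt_one x hx) (Ne.symm hne))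
  rw [hsum2, norm_neg, norm_mul, hm, one_mul] at hlt
  exact lt_irrefl _ hlt

end IsNearTranslation

end NearTranslation

theorem IsNearTranslation.exists_eq_prime_pow {K : Type*} [NontriviallyNormedField K]
    [IsUltrametricDist K] {p : ℕ} (hp : p.Prime) (hpK : ∀ m : ℕ, ¬ p ∣ m → ‖(m : K)‖ = 1)
    {f : K → K} (hf : IsNearTranslation f) {x : K} (hx : ‖x‖ < 1) {q : ℕ} (hq : 1 ≤ q)
    (h : IsMinPeriodicPt f q x) : ∃ n, q = p ^ n := by
  obtain ⟨n, m, hm, hqm⟩ := Nat.exists_eq_pow_mul_and_not_dvd (Nat.one_le_iff_ne_zero.1 hq) p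
    hp.ne_one
  have hm0 : 0 < m := Nat.pos_of_ne_zero fun h0 => hm (h0 ▸ dvd_zero p)
  have hfix : f^[p ^ n] x = x := by
    refine (hf.iterate (p ^ n)).eq_of_iterate_eq hx (hpK m hm) ?_
    rw [← Function.iterate_mul, ← hqm]
    exact h.1
  refine ⟨n, ?_⟩
  by_contra hne
  refine h.2 (p ^ n) (Nat.one_le_pow _ _ hp.pos) (lt_of_le_of_ne ?_ (Ne.symm hne)) hfix
  rw [hqm]
  exact Nat.le_mul_of_pos_right _ hm0

theorem IsMinPeriodicPt.injOn_iterate {α : Type*} {f : α → α} {q : ℕ} {x : α}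
    (h : IsMinPeriodicPt f q x) : Set.InjOn (fun j => f^[j] x) (Finset.range q : Set ℕ) := by
  have key : ∀ i j, i < j → j < q → f^[i] x ≠ f^[j] x := by
    intro i j hij hj heq
    refine h.2 (q - j + i) (by omega) (by omega) ?_
    rw [Function.iterate_add_apply, heq, ← Function.iterate_add_apply, Nat.sub_add_cancel hj.le]
    exact h.1
  intro i hi j hj heq
  simp only [Finset.coe_range, Set.mem_Iio] at hi hj
  rcases lt_trichotomy i j with hij | hij | hij
  · exact absurd heq (key i j hij hj)
  · exact hij
  · exact absurd heq.symm (key j i hij hi)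

section Dynamics

open PowerSeries

theorem PowerSeries.algHom_X_sub_dvd_pow {R : Type*} [CommRing R] (T : R⟦X⟧ →ₐ[R] R⟦X⟧) (n : ℕ) :
    T X - X ∣ (T ^ n) X - X := by
  induction n with
  | zero => simp
  | succ n ih =>
    have h : (T ^ (n + 1)) X - X = (T ((T ^ n) X) - (T ^ n) X) + ((T ^ n) X - X) := by
      rw [pow_succ', AlgHom.mul_apply]
      ring
    rw [h]
    exact dvd_add (algHom_X_sub_dvd T _) ih

theorem PowerSeries.exists_algHom_pow_X {R : Type*} [CommRing R] (T : R⟦X⟧ →ₐ[R] R⟦X⟧)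
    {a : R} (h : ∃ r, T X = X * (C a + X * r)) (n : ℕ) :
    ∃ r, (T ^ n) X = X * (C (a ^ n) + X * r) := by
  induction n with
  | zero => exact ⟨0, by simp⟩
  | succ n ih =>
    obtain ⟨r, hr⟩ := h
    obtain ⟨r', hr'⟩ := ih
    refine ⟨r * C (a ^ n) + (C a + X * r) ^ 2 * T r', ?_⟩
    have hTC : T (C (a ^ n)) = C (a ^ n) := T.commutes _
    rw [pow_succ', AlgHom.mul_apply, hr', map_mul, map_add, map_mul, hTC, hr, pow_succ, map_mul]
    ring

variable {K : Type*} [NontriviallyNormedField K] [IsUltrametricDist K] [CompleteSpace K]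

theorem diskEval_pow_X {T : (unitDisk K)⟦X⟧ →ₐ[unitDisk K] (unitDisk K)⟦X⟧} {f : K → K}
    (hf1 : ∀ x, ‖x‖ < 1 → ‖f x‖ < 1) (hf : ∀ x (hx : ‖x‖ < 1), diskEval hx (T X) = f x) (n : ℕ) :
    ∀ {x : K} (hx : ‖x‖ < 1), diskEval hx ((T ^ n) X) = f^[n] x := by
  induction n with
  | zero => intro x hx; simp
  | succ n ih =>
    intro x hx
    rw [pow_succ', AlgHom.mul_apply, diskEval_algHom hx (hf1 x hx) T (hf x hx), ih,
      Function.iterate_succ_apply]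

theorem diskEval_sub_norm_lt {φ : (unitDisk K)⟦X⟧} (h : ‖((coeff 1 φ : unitDisk K) : K)‖ < 1)
    {x y : K} (hx : ‖x‖ < 1) (hy : ‖y‖ < 1) (hxy : x ≠ y) :
    ‖diskEval hy φ - diskEval hx φ‖ < ‖y - x‖ := by
  obtain ⟨g, hg⟩ := exists_eq_C_add_X_sub_C_mul (a := ⟨x, hx.le⟩) hx φ
  have hg0 : ‖((constantCoeff g : unitDisk K) : K)‖ < 1 := by
    rw [← unitDisk.residue_eq_zero_iff] at h ⊢
    have h1 := congrArg (coeff 1) (congrArg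
      (PowerSeries.map (IsLocalRing.residue (unitDisk K))) hg)
    rw [map_add (PowerSeries.map _), map_residue_X_sub_C_mul (a := ⟨x, hx.le⟩) hx, map_C, coeff_map,
      h, map_add, coeff_C, if_neg one_ne_zero, zero_add, ← zero_add 1, coeff_succ_X_mul, coeff_map,
      coeff_zero_eq_constantCoeff_apply] at h1
    exact h1.symm
  have h2 : diskEval hy φ - diskEval hx φ = (y - x) * diskEval hy g := by
    have h3 := congrArg (diskEval hy) hg
    rw [map_add, map_mul, map_sub, diskEval_C, diskEval_X, diskEval_C] at h3
    rw [h3]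
    ring
  rw [h2, norm_mul]
  exact mul_lt_of_lt_one_right (norm_pos_iff.2 (sub_ne_zero.2 hxy.symm)) (norm_diskEval_lt hy hg0)

end Dynamics

section Ramification

open PowerSeries

theorem PowerSeries.exists_algHom_pair {R S : Type*} [CommRing R] [CommRing S] (π : R →+* S)
    {F : R⟦X⟧} (hF : constantCoeff F = 0) :
    ∃ (T : R⟦X⟧ →ₐ[R] R⟦X⟧) (T' : S⟦X⟧ →ₐ[S] S⟦X⟧), T X = F ∧ T' X = PowerSeries.map π F ∧
      ∀ φ, PowerSeries.map π (T φ) = T' (PowerSeries.map π φ) := by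
  have hF' : constantCoeff (PowerSeries.map π F) = 0 := by
    rw [← coeff_zero_eq_constantCoeff_apply, coeff_map, coeff_zero_eq_constantCoeff_apply, hF,
      map_zero]
  have h := HasSubst.of_constantCoeff_zero' hF
  have h' := HasSubst.of_constantCoeff_zero' hF'
  refine ⟨substAlgHom h, substAlgHom h', substAlgHom_X h, substAlgHom_X h', fun φ => ?_⟩
  rw [coe_substAlgHom h, coe_substAlgHom h']
  exact map_subst h φ

theorem PowerSeries.exists_eq_leading {R : Type*} [CommRing R] (F : R⟦X⟧) :
    ∃ r, F = C (coeff 0 F) + C (coeff 1 F) * X + C (coeff 2 F) * X ^ 2 + C (coeff 3 F) * X ^ 3 +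
      X ^ 4 * r := by
  refine ⟨mk fun n => coeff (n + 4) F, ?_⟩
  have h : ∀ j, (mk fun n => coeff (n + j) F) =
      C (coeff j F) + X * mk fun n => coeff (n + (j + 1)) F := by
    intro j
    ext1 n
    cases n with
    | zero => simp
    | succ n =>
      simp only [coeff_mk, map_add, coeff_succ_X_mul, coeff_C]
      simp [Nat.add_comm, Nat.add_left_comm]
  have h0 : (mk fun n => coeff (n + 0) F) = F := by ext1 n; simp
  nth_rewrite 1 [← h0]
  rw [h 0, h 1, h 2, h 3]
  ring

variable {p : ℕ} [Fact p.Prime]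
  {K : Type*} [NontriviallyNormedField K] [IsUltrametricDist K]

theorem unitDisk.charP_residueField (hp : ‖(p : K)‖ < 1) :
    CharP (IsLocalRing.ResidueField (unitDisk K)) p := by
  refine (CharP.charP_iff_prime_eq_zero Fact.out).2 ?_
  have h := (unitDisk.residue_eq_zero_iff (K := K) (p : unitDisk K)).2 (by exact_mod_cast hp)
  simpa using h

theorem order_map_pow_X_sub (hp3 : 3 ≤ p) (hp : ‖(p : K)‖ < 1) {F : (unitDisk K)⟦X⟧}
    {T' : (IsLocalRing.ResidueField (unitDisk K))⟦X⟧ →ₐ[IsLocalRing.ResidueField (unitDisk K)]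
      (IsLocalRing.ResidueField (unitDisk K))⟦X⟧}
    (hT' : T' X = PowerSeries.map (IsLocalRing.residue (unitDisk K)) F)
    (h0 : coeff 0 F = 0) (h1 : ‖((coeff 1 F : unitDisk K) : K) - 1‖ < 1)
    (h2 : ‖((coeff 2 F : unitDisk K) : K)‖ = 1)
    (h3 : ‖((coeff 2 F : unitDisk K) : K) ^ 2 - (coeff 3 F : unitDisk K)‖ = 1) (n : ℕ) :
    ((T' ^ p ^ n) X - X).order = ((∑ i ∈ Finset.range (n + 1), p ^ i + 1 : ℕ) : ℕ∞) := by
  have := unitDisk.charP_residueField (p := p) hp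
  set π := IsLocalRing.residue (unitDisk K) with hπ
  have hlead : LeadingTerms T' 1 (π (coeff 2 F)) (π (coeff 3 F)) := by
    obtain ⟨r, hr⟩ := exists_eq_leading F
    have h1' : π (coeff 1 F) = 1 := by
      rw [← sub_eq_zero, ← map_one π, ← map_sub, hπ, unitDisk.residue_eq_zero_iff]
      exact h1
    refine ⟨PowerSeries.map π r, ?_⟩
    have hmap := congrArg (PowerSeries.map π) hr
    simp only [map_add, map_mul, map_pow, map_C, map_X, h0, h1', map_zero, map_one] at hmap
    rw [hT', hmap]
    ring
  have ha : π (coeff 2 F) ≠ 0 := by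
    rw [Ne, hπ, unitDisk.residue_eq_zero_iff, h2]
    exact lt_irrefl 1
  have hab : π (coeff 3 F) - π (coeff 2 F) ^ 2 ≠ 0 := by
    rw [← neg_sub, neg_ne_zero, ← map_pow, ← map_sub, Ne, hπ, unitDisk.residue_eq_zero_iff]
    push_cast
    rw [h3]
    exact lt_irrefl 1
  obtain ⟨α, β, hα, r, hr⟩ := hlead.pow_prime_pow hp3 ha hab n
  rw [hr, add_sub_cancel_left, order_mul, order_X_pow, order_zero_of_unit, add_zero]
  rw [isUnit_iff_constantCoeff]
  simpa using hα

variable [CompleteSpace K]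

theorem isNearTranslation_pEval {c : ℕ → K} (hc0 : c 0 = 0) (hc : ∀ i, ‖c i‖ ≤ 1)
    (hc1 : ‖c 1 - 1‖ < 1) : IsNearTranslation (pEval c) where
  norm_lt_one x hx := by
    have h := norm_diskEval_lt (φ := mk fun i => (⟨c i, hc i⟩ : unitDisk K)) hx (by simp [hc0])
    simpa [diskEval_apply] using h
  norm_sub_lt x y hx hy hxy := by
    have h := diskEval_sub_norm_lt (φ := mk (fun i => (⟨c i, hc i⟩ : unitDisk K)) - X)
      (by simpa using hc1) hx hy hxy
    rw [map_sub, map_sub, diskEval_X, diskEval_X, diskEval_apply, diskEval_apply] at h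
    simp only [coeff_mk] at h
    rwa [sub_sub_sub_comm] at h

theorem norm_sub_eq_mul_of_isMinPeriodicPt (hp3 : 3 ≤ p) (hp : ‖(p : K)‖ < 1)
    {c : ℕ → K} (hc0 : c 0 = 0) (hc : ∀ i, ‖c i‖ ≤ 1) (hc1 : ‖c 1 - 1‖ < 1)
    (hc2 : ‖c 2‖ = 1) (hc3 : ‖c 2 ^ 2 - c 3‖ = 1) {n : ℕ} {x : K} (hx : ‖x‖ < 1)
    (hper : IsMinPeriodicPt (pEval c) (p ^ (n + 1)) x) :
    ‖1 - c 1 ^ p ^ (n + 1)‖ = ‖1 - c 1 ^ p ^ n‖ * ‖x‖ ^ p ^ (n + 1) := by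
  classical
  have hnt := isNearTranslation_pEval hc0 hc hc1
  set F : (unitDisk K)⟦X⟧ := mk fun i => ⟨c i, hc i⟩ with hF
  set π := IsLocalRing.residue (unitDisk K) with hπ
  have hF0 : constantCoeff F = 0 := by
    rw [← coeff_zero_eq_constantCoeff_apply, hF, coeff_mk]
    exact Subtype.ext hc0
  obtain ⟨T, T', hT, hT', hcomm⟩ := exists_algHom_pair π hF0
  have hf : ∀ x (hx : ‖x‖ < 1), diskEval hx (T X) = pEval c x := by
    intro x hx
    rw [hT, diskEval_apply]
    simp [hF]
  have hpow : ∀ (m : ℕ) φ, PowerSeries.map π ((T ^ m) φ) = (T' ^ m) (PowerSeries.map π φ) := by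
    intro m
    induction m with
    | zero => intro φ; simp
    | succ m ih => intro φ; rw [pow_succ, pow_succ, AlgHom.mul_apply, AlgHom.mul_apply, ih, hcomm]
  have hord : ∀ m : ℕ, (PowerSeries.map π ((T ^ p ^ m) X - X)).order =
      ((∑ i ∈ Finset.range (m + 1), p ^ i + 1 : ℕ) : ℕ∞) := by
    intro m
    rw [map_sub, hpow, map_X]
    exact order_map_pow_X_sub hp3 hp hT' (by simpa using hF0) (by simpa [hF] using hc1)
      (by simpa [hF] using hc2) (by simpa [hF] using hc3) m
  obtain ⟨g, hg⟩ : (T ^ p ^ n) X - X ∣ (T ^ p ^ (n + 1)) X - X := by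
    rw [pow_succ, pow_mul]
    exact algHom_X_sub_dvd_pow (T ^ p ^ n) p
  have hgord : (PowerSeries.map π g).order = (p ^ (n + 1) : ℕ) := by
    have h := hord (n + 1)
    rw [hg, map_mul, order_mul, hord n, Finset.sum_range_succ _ (n + 1),
      add_right_comm, Nat.cast_add] at h
    exact ENat.add_right_injective_of_ne_top (ENat.natCast_ne_top _) h
  have hnorm : ∀ j, ‖(pEval c)^[j] x‖ = ‖x‖ := by
    intro j
    have h0 : pEval c 0 = 0 := by
      rw [pEval, tsum_eq_single 0 fun m hm => by simp [hm]]
      simp [hc0]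
    have h := (hnt.iterate j).norm_sub (x := 0) (y := x) (by simp) hx
    rwa [Function.iterate_fixed h0, sub_zero, sub_zero] at h
  have hprod := norm_constantCoeff_eq_prod
    ((Finset.range (p ^ (n + 1))).image fun j => (pEval c)^[j] x) g ?_ ?_
  · rw [Finset.prod_image hper.injOn_iterate, Finset.prod_congr rfl fun j _ => hnorm j,
      Finset.prod_const, Finset.card_range] at hprod
    rw [← hprod, ← norm_mul]
    have hT1 : ∃ r, T X = X * (C (coeff 1 F) + X * r) := by
      obtain ⟨r, hr⟩ := exists_eq_leading F
      refine ⟨C (coeff 2 F) + C (coeff 3 F) * X + X ^ 2 * r, ?_⟩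
      rw [hT]
      nth_rewrite 1 [hr]
      rw [coeff_zero_eq_constantCoeff_apply, hF0, map_zero]
      ring
    have hcoeff : ∀ m, coeff 1 ((T ^ m) X - X) = (coeff 1 F) ^ m - 1 := by
      intro m
      obtain ⟨r, hr⟩ := exists_algHom_pow_X T hT1 m
      rw [hr, map_sub, coeff_one_X]
      congr 1
      rw [← zero_add 1, coeff_succ_X_mul]
      simp
    have hmul : (coeff 1 F) ^ p ^ (n + 1) - 1 = ((coeff 1 F) ^ p ^ n - 1) * constantCoeff g := by
      obtain ⟨r, hr⟩ := exists_algHom_pow_X T hT1 (p ^ n)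
      have hXdvd : (T ^ p ^ n) X - X = X * (C (coeff 1 F ^ p ^ n - 1) + X * r) := by
        rw [hr, map_sub, map_one]
        ring
      rw [← hcoeff, hg, hXdvd, mul_assoc, ← zero_add 1, coeff_succ_X_mul]
      simp
    have hmul' := congrArg (fun a : unitDisk K => ‖(a : K)‖) hmul
    simp only [hF, coeff_mk] at hmul'
    push_cast at hmul'
    rw [norm_sub_rev, hmul', norm_mul, norm_mul, norm_sub_rev]
  · intro a ha
    obtain ⟨j, -, rfl⟩ := Finset.mem_image.1 ha
    have hj : ‖(pEval c)^[j] x‖ < 1 := by rw [hnorm]; exact hx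
    refine ⟨hj, ?_⟩
    have h := congrArg (diskEval hj) hg
    rw [map_mul, map_sub, map_sub, diskEval_X, diskEval_pow_X hnt.norm_lt_one hf,
      diskEval_pow_X hnt.norm_lt_one hf] at h
    have hshift : ∀ m, (pEval c)^[m] ((pEval c)^[j] x) = (pEval c)^[j] ((pEval c)^[m] x) := fun m =>
      (Function.Commute.iterate_iterate_self (pEval c) m j).eq x
    rw [hshift, hshift, hper.1, sub_self] at h
    refine (mul_eq_zero.1 h.symm).resolve_left (norm_ne_zero_iff.1 ?_)
    rw [(hnt.iterate j).norm_sub hx ((hnt.iterate _).norm_lt_one x hx), norm_ne_zero_iff,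
      sub_ne_zero]
    have hp1 : 1 < p := by omega
    exact hper.2 _ (Nat.one_le_pow _ _ (by omega)) (Nat.pow_lt_pow_right hp1 (Nat.lt_succ_self n))
  · rw [hgord, Finset.card_image_of_injOn hper.injOn_iterate, Finset.card_range]

end Ramification

section FixedPoints

open PowerSeries

variable {K : Type*} [NontriviallyNormedField K] [IsUltrametricDist K] [CompleteSpace K]

theorem norm_pEval_le {c : ℕ → K} (hc : ∀ i, ‖c i‖ ≤ 1) {x : K} (hx : ‖x‖ < 1) :
    ‖pEval c x‖ ≤ 1 := by
  simpa [diskEval_apply] using norm_diskEval_le hx (mk fun i => (⟨c i, hc i⟩ : unitDisk K))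

theorem norm_pEval_sub_le {c : ℕ → K} (hc : ∀ i, ‖c i‖ ≤ 1) {x y : K} (hx : ‖x‖ < 1)
    (hy : ‖y‖ < 1) : ‖pEval c y - pEval c x‖ ≤ ‖y - x‖ := by
  obtain ⟨g, hg⟩ := exists_eq_C_add_X_sub_C_mul (a := ⟨x, hx.le⟩) hx
    (mk fun i => (⟨c i, hc i⟩ : unitDisk K))
  have h := congrArg (diskEval hy) hg
  rw [map_add, map_mul, map_sub, diskEval_C, diskEval_X, diskEval_C] at h
  simp only [diskEval_apply, coeff_mk] at h
  rw [h, add_sub_cancel_left, norm_mul]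
  exact mul_le_of_le_one_right (norm_nonneg _) (norm_diskEval_le hy g)

theorem pEval_eq_leading {c : ℕ → K} (hc0 : c 0 = 0) (hc : ∀ i, ‖c i‖ ≤ 1) {x : K}
    (hx : ‖x‖ < 1) :
    pEval c x = c 1 * x + x * (c 2 * x + x ^ 2 * pEval (fun i => c (i + 3)) x) := by
  have hsum : Summable fun i => c i * x ^ i := by
    simpa using (summable_norm_coeff_mul_pow hx (mk fun i => (⟨c i, hc i⟩ : unitDisk K))).of_norm
  rw [pEval, ← hsum.sum_add_tsum_nat_add 3, pEval, ← tsum_mul_left, mul_add, ← tsum_mul_left,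
    ← add_assoc]
  congr 1
  · simp [Finset.sum_range_succ, hc0]
    ring
  · exact tsum_congr fun i => by ring

theorem norm_sq_mul_pEval_sub_le {c : ℕ → K} (hc : ∀ i, ‖c i‖ ≤ 1) {x y : K} {r : ℝ}
    (hr : r < 1) (hx : ‖x‖ ≤ r) (hy : ‖y‖ ≤ r) :
    ‖y ^ 2 * pEval c y - x ^ 2 * pEval c x‖ ≤ r * ‖y - x‖ := by
  have hx1 := hx.trans_lt hr
  have hy1 := hy.trans_lt hr
  have h : y ^ 2 * pEval c y - x ^ 2 * pEval c x =
      (y + x) * (pEval c y) * (y - x) + x * (x * (pEval c y - pEval c x)) := by ring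
  have hr0 : 0 ≤ r := (norm_nonneg x).trans hx
  rw [h]
  refine (IsUltrametricDist.norm_add_le_max _ _).trans (max_le ?_ ?_)
  · rw [norm_mul, norm_mul]
    refine mul_le_mul_of_nonneg_right ?_ (norm_nonneg _)
    refine (mul_le_of_le_one_right (norm_nonneg _) (norm_pEval_le hc hy1)).trans ?_
    exact (IsUltrametricDist.norm_add_le_max _ _).trans (max_le hy hx)
  · rw [norm_mul, norm_mul]
    refine mul_le_mul hx ?_ (by positivity) hr0
    calc ‖x‖ * ‖pEval c y - pEval c x‖ ≤ 1 * ‖y - x‖ :=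
          mul_le_mul hx1.le (norm_pEval_sub_le hc hx1 hy1) (norm_nonneg _) zero_le_one
      _ = ‖y - x‖ := one_mul _

theorem exists_fixedPoint_pEval {c : ℕ → K} (hc0 : c 0 = 0) (hc : ∀ i, ‖c i‖ ≤ 1)
    (hpos : 0 < ‖1 - c 1‖) (hlt : ‖1 - c 1‖ < 1) (hc2 : ‖c 2‖ = 1) :
    ∃ x₀ : K, x₀ ≠ 0 ∧ ‖x₀‖ = ‖1 - c 1‖ ∧ pEval c x₀ = x₀ ∧
      ∀ x : K, ‖x‖ < 1 → pEval c x = x → x = 0 ∨ x = x₀ := by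
  set e : K → K := pEval fun i => c (i + 3) with he
  set r := ‖1 - c 1‖ with hr
  have hc' : ∀ i, ‖c (i + 3)‖ ≤ 1 := fun i => hc _
  have hc20 : c 2 ≠ 0 := norm_ne_zero_iff.1 (by rw [hc2]; exact one_ne_zero)
  have hfix : ∀ x : K, ‖x‖ < 1 → x ≠ 0 → (pEval c x = x ↔ c 2 * x + x ^ 2 * e x = 1 - c 1) := by
    intro x hx hx0
    rw [pEval_eq_leading hc0 hc hx]
    constructor
    · intro h
      refine mul_left_cancel₀ hx0 ?_
      linear_combination h
    · intro h
      rw [h]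
      ring
  let Φ : K → K := fun x => (1 - c 1 - x ^ 2 * e x) / c 2
  have hmaps : Set.MapsTo Φ (Metric.closedBall 0 r) (Metric.closedBall 0 r) := by
    intro x hx
    rw [mem_closedBall_zero_iff] at hx ⊢
    rw [norm_div, hc2, div_one, sub_eq_add_neg]
    refine (IsUltrametricDist.norm_add_le_max _ _).trans (max_le le_rfl ?_)
    have h := norm_sq_mul_pEval_sub_le (x := 0) (y := x) hc' hlt (by simpa using hpos.le) hx
    rw [norm_neg]
    simp only [sub_zero, ne_eq, OfNat.ofNat_ne_zero, not_false_eq_true, zero_pow, zero_mul] at h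
    exact h.trans ((mul_le_of_le_one_right hpos.le (hx.trans hlt.le)))
  have hcontr : ContractingWith r.toNNReal (hmaps.restrict Φ _ _) := by
    refine ⟨by rw [← NNReal.coe_lt_coe, Real.coe_toNNReal _ hpos.le]; exact hlt, ?_⟩
    refine LipschitzWith.of_dist_le_mul fun x y => ?_
    rw [Real.coe_toNNReal _ hpos.le, Subtype.dist_eq, Subtype.dist_eq, dist_eq_norm, dist_eq_norm]
    have hx := mem_closedBall_zero_iff.1 x.2
    have hy := mem_closedBall_zero_iff.1 y.2
    have h := norm_sq_mul_pEval_sub_le hc' hlt hx hy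
    rw [Set.MapsTo.val_restrict_apply, Set.MapsTo.val_restrict_apply]
    simp only [Φ]
    rw [← sub_div, norm_div, hc2, div_one, sub_sub_sub_cancel_left, norm_sub_rev (x : K)]
    exact h
  obtain ⟨x₀, hx₀, hΦ, -⟩ := hcontr.exists_fixedPoint' (Metric.isClosed_closedBall.isComplete)
    hmaps (x := 0) (by simpa using hpos.le) (edist_ne_top _ _)
  rw [mem_closedBall_zero_iff] at hx₀
  have hx₀1 := hx₀.trans_lt hlt
  have heq : c 2 * x₀ + x₀ ^ 2 * e x₀ = 1 - c 1 := by
    have h : (1 - c 1 - x₀ ^ 2 * e x₀) / c 2 = x₀ := hΦ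
    rw [div_eq_iff hc20] at h
    linear_combination -h
  have hx₀0 : x₀ ≠ 0 := by
    rintro rfl
    rw [mul_zero, zero_pow two_ne_zero, zero_mul, add_zero] at heq
    rw [hr, ← heq, norm_zero] at hpos
    exact lt_irrefl _ hpos
  refine ⟨x₀, hx₀0, ?_, (hfix x₀ hx₀1 hx₀0).2 heq, ?_⟩
  · rw [hr, ← heq]
    have h1 : ‖c 2 * x₀‖ = ‖x₀‖ := by rw [norm_mul, hc2, one_mul]
    rw [← h1]
    symm
    apply IsNearTranslation.norm_eq_of_norm_sub_lt
    rw [add_sub_cancel_left, h1, norm_mul, norm_pow, sq]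
    refine (mul_le_of_le_one_right (by positivity) (norm_pEval_le hc' hx₀1)).trans_lt ?_
    exact mul_lt_of_lt_one_left (norm_pos_iff.2 hx₀0) hx₀1
  · intro x hx hxfix
    refine or_iff_not_imp_left.2 fun hx0 => ?_
    rw [hfix x hx hx0] at hxfix
    by_contra hne
    have h := norm_sq_mul_pEval_sub_le hc' (max_lt hx hx₀1) (le_max_right ‖x‖ ‖x₀‖)
      (le_max_left ‖x‖ ‖x₀‖)
    have h2 : x ^ 2 * e x - x₀ ^ 2 * e x₀ = -(c 2 * (x - x₀)) := by
      linear_combination hxfix - heq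
    rw [← he, h2, norm_neg, norm_mul, hc2, one_mul] at h
    have hpos' : 0 < ‖x - x₀‖ := norm_pos_iff.2 (sub_ne_zero.2 hne)
    nlinarith [max_lt hx hx₀1]

end FixedPoints

section RootsOfUnity

variable {p : ℕ} [Fact p.Prime] {K : Type*} [NontriviallyNormedField K] [IsUltrametricDist K]

theorem exists_one_add_pow_prime_eq {y : K} (hy : ‖y‖ ≤ 1) :
    ∃ z : K, (1 + y) ^ p = 1 + y ^ p + p * z ∧ ‖z‖ ≤ ‖y‖ ∧ (‖y‖ < 1 → ‖z‖ = ‖y‖) := by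
  have hp : p.Prime := Fact.out
  set S : K := ∑ k ∈ Finset.Ioo 1 p, y ^ (k - 1) * 1 ^ (p - k - 1) * ((p.choose k / p : ℕ) : K)
    with hS
  have hsplit : Finset.Ioo 0 p = insert 1 (Finset.Ioo 1 p) := by
    ext k
    have := hp.one_lt
    simp only [Finset.mem_Ioo, Finset.mem_insert]
    omega
  have hSle : ‖S‖ ≤ ‖y‖ := by
    refine IsUltrametricDist.norm_sum_le_of_forall_le_of_nonneg (norm_nonneg _) fun k hk => ?_
    rw [one_pow, mul_one, norm_mul, norm_pow]
    refine (mul_le_of_le_one_right (by positivity)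
      (IsUltrametricDist.norm_natCast_le_one K _)).trans ?_
    exact pow_le_of_le_one (norm_nonneg _) hy (Nat.sub_ne_zero_of_lt (Finset.mem_Ioo.1 hk).1)
  refine ⟨y * (1 + S), ?_, ?_, fun hy1 => ?_⟩
  · have h := add_pow_prime_eq hp y (1 : K)
    rw [hsplit, Finset.sum_insert (by simp), ← hS, one_pow, one_pow, Nat.choose_one_right,
      Nat.div_self hp.pos, Nat.sub_self, pow_zero, Nat.cast_one, mul_one, mul_one, mul_one] at h
    rw [add_comm 1 y, h]
    ring
  · rw [norm_mul]
    refine mul_le_of_le_one_right (norm_nonneg _) ?_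
    exact (IsUltrametricDist.norm_add_le_max _ _).trans (max_le norm_one.le (hSle.trans hy))
  · rw [norm_mul, IsNearTranslation.norm_eq_of_norm_sub_lt (a := 1 + S) (b := 1), norm_one, mul_one]
    rw [add_sub_cancel_left, norm_one]
    exact hSle.trans_lt hy1

theorem norm_one_sub_pow_prime_of_lt (hpK : ‖(p : K)‖ = (p : ℝ)⁻¹)
    {μ : K} (h1 : ‖1 - μ‖ ≤ 1)
    (h : (p : ℝ)⁻¹ < ‖1 - μ‖ ^ (p - 1)) : ‖1 - μ ^ p‖ = ‖1 - μ‖ ^ p := by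
  have hp : p.Prime := Fact.out
  rw [norm_sub_rev] at h1 h ⊢
  rw [norm_sub_rev 1 μ]
  obtain ⟨z, hz, hzle, -⟩ := exists_one_add_pow_prime_eq (p := p) h1
  rw [add_sub_cancel] at hz
  rw [← norm_pow]
  have hpos : 0 < ‖μ - 1‖ := by
    refine (norm_nonneg _).lt_of_ne fun h0 => ?_
    rw [← h0, zero_pow (Nat.sub_ne_zero_of_lt hp.one_lt)] at h
    exact absurd h (not_lt.2 (by positivity))
  apply IsNearTranslation.norm_eq_of_norm_sub_lt
  have : μ ^ p - 1 - (μ - 1) ^ p = p * z := by rw [hz]; ring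
  rw [this, norm_mul, hpK, norm_pow]
  calc (p : ℝ)⁻¹ * ‖z‖ ≤ (p : ℝ)⁻¹ * ‖μ - 1‖ := by gcongr
    _ < ‖μ - 1‖ ^ (p - 1) * ‖μ - 1‖ := by gcongr
    _ = ‖μ - 1‖ ^ p := pow_sub_one_mul hp.ne_zero _

theorem norm_one_sub_pow_prime_of_gt (hpK : ‖(p : K)‖ = (p : ℝ)⁻¹)
    {μ : K} (h : ‖1 - μ‖ ^ (p - 1) < (p : ℝ)⁻¹) :
    ‖1 - μ ^ p‖ = ‖1 - μ‖ / p := by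
  have hp : p.Prime := Fact.out
  have hp1 : (1 : ℝ) < p := by exact_mod_cast hp.one_lt
  have h1 : ‖1 - μ‖ < 1 := by
    by_contra hge
    exact absurd (h.trans (inv_lt_one_of_one_lt₀ hp1)) (not_lt.2 (one_le_pow₀ (not_lt.1 hge)))
  rw [norm_sub_rev] at h1 h ⊢
  rw [norm_sub_rev 1 μ]
  obtain ⟨z, hz, -, hzeq⟩ := exists_one_add_pow_prime_eq (p := p) h1.le
  specialize hzeq h1
  rw [add_sub_cancel] at hz
  rcases eq_or_ne (μ - 1) 0 with h0 | h0
  · rw [sub_eq_zero] at h0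
    simp [h0]
  have hpos : 0 < ‖μ - 1‖ := norm_pos_iff.2 h0
  have hn : ‖(p : K) * z‖ = ‖μ - 1‖ / p := by rw [norm_mul, hpK, hzeq, inv_mul_eq_div]
  rw [← hn]
  apply IsNearTranslation.norm_eq_of_norm_sub_lt
  have : μ ^ p - 1 - p * z = (μ - 1) ^ p := by rw [hz]; ring
  rw [this, hn, norm_pow, ← pow_sub_one_mul hp.ne_zero, div_eq_inv_mul]
  gcongr

theorem norm_one_sub_pow_prime_le_s13 (hpK : ‖(p : K)‖ = (p : ℝ)⁻¹)
    {μ : K} (h1 : ‖1 - μ‖ ≤ 1) :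
    ‖1 - μ ^ p‖ ≤ max (‖1 - μ‖ ^ p) (‖1 - μ‖ / p) := by
  rw [norm_sub_rev] at h1 ⊢
  rw [norm_sub_rev 1 μ]
  obtain ⟨z, hz, hzle, -⟩ := exists_one_add_pow_prime_eq (p := p) h1
  rw [add_sub_cancel] at hz
  have : μ ^ p - 1 = (μ - 1) ^ p + p * z := by rw [hz]; ring
  rw [this]
  refine (IsUltrametricDist.norm_add_le_max _ _).trans (max_le_max (norm_pow _ _).le ?_)
  rw [norm_mul, hpK, inv_mul_eq_div]
  gcongr

theorem norm_one_sub_pow_of_lt (hpK : ‖(p : K)‖ = (p : ℝ)⁻¹)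
    {μ : K} (h1 : ‖1 - μ‖ ≤ 1) {n : ℕ}
    (h : (p : ℝ)⁻¹ < ‖1 - μ‖ ^ (p ^ n * (p - 1))) :
    ‖1 - μ ^ p ^ (n + 1)‖ = ‖1 - μ‖ ^ p ^ (n + 1) := by
  have hp : p.Prime := Fact.out
  induction n with
  | zero =>
    rw [zero_add, pow_one]
    exact norm_one_sub_pow_prime_of_lt hpK h1 (by simpa using h)
  | succ n ih =>
    have hn := ih (h.trans_le (pow_le_pow_of_le_one (norm_nonneg _) h1
      (Nat.mul_le_mul_right _ (Nat.pow_le_pow_right hp.pos n.le_succ))))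
    rw [pow_succ p (n + 1), pow_mul, pow_mul, ← hn]
    refine norm_one_sub_pow_prime_of_lt hpK ?_ ?_
    · rw [hn]
      exact pow_le_one₀ (norm_nonneg _) h1
    · rwa [hn, ← pow_mul]

theorem norm_one_sub_pow_of_le (hpK : ‖(p : K)‖ = (p : ℝ)⁻¹)
    {μ : K} (h0 : 0 < ‖1 - μ‖) (h1 : ‖1 - μ‖ < 1) {n : ℕ}
    (h : (p : ℝ)⁻¹ ≤ ‖1 - μ‖ ^ (p ^ n * (p - 1))) : ‖1 - μ ^ p ^ n‖ = ‖1 - μ‖ ^ p ^ n := by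
  have hp : p.Prime := Fact.out
  cases n with
  | zero => simp
  | succ n =>
    refine norm_one_sub_pow_of_lt hpK h1.le (h.trans_lt (pow_lt_pow_right_of_lt_one₀ h0 h1 ?_))
    exact Nat.mul_lt_mul_of_pos_right (Nat.pow_lt_pow_right hp.one_lt n.lt_succ_self)
      (Nat.sub_pos_of_lt hp.one_lt)

theorem norm_one_sub_pow_lt (hpK : ‖(p : K)‖ = (p : ℝ)⁻¹)
    {μ : K} {n : ℕ} (h : ‖1 - μ‖ ^ (p ^ n * (p - 1)) < (p : ℝ)⁻¹) :
    ‖1 - μ ^ p ^ n‖ ^ (p - 1) < (p : ℝ)⁻¹ := by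
  have hp : p.Prime := Fact.out
  have hp1 : (1 : ℝ) < p := by exact_mod_cast hp.one_lt
  induction n generalizing μ with
  | zero => simpa using h
  | succ n ih =>
    have h1 : ‖1 - μ‖ < 1 := by
      by_contra hge
      exact absurd (h.trans (inv_lt_one_of_one_lt₀ hp1)) (not_lt.2 (one_le_pow₀ (not_lt.1 hge)))
    rw [pow_succ', pow_mul]
    apply ih
    have hne : p ^ n * (p - 1) ≠ 0 :=
      mul_ne_zero (pow_ne_zero _ hp.ne_zero) (Nat.sub_ne_zero_of_lt hp.one_lt)
    rcases le_max_iff.1 (norm_one_sub_pow_prime_le_s13 hpK h1.le) with hle | hle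
    · refine (pow_le_pow_left₀ (norm_nonneg _) hle _).trans_lt ?_
      rwa [← pow_mul, ← mul_assoc, ← pow_succ']
    · have hlt : ‖1 - μ ^ p‖ < (p : ℝ)⁻¹ := by
        refine hle.trans_lt ?_
        rw [div_eq_mul_inv]
        exact mul_lt_of_lt_one_left (by positivity) h1
      exact (pow_le_of_le_one (norm_nonneg _) (hlt.trans (inv_lt_one_of_one_lt₀ hp1)).le
        hne).trans_lt hlt

theorem norm_one_sub_pow_eq_div (hpK : ‖(p : K)‖ = (p : ℝ)⁻¹)
    {μ : K} (h : ‖1 - μ‖ ^ (p - 1) < (p : ℝ)⁻¹) (k : ℕ) :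
    ‖1 - μ ^ p ^ k‖ = ‖1 - μ‖ / (p : ℝ) ^ k := by
  have hp : p.Prime := Fact.out
  have hp1 : (1 : ℝ) ≤ p := by exact_mod_cast hp.one_lt.le
  induction k with
  | zero => simp
  | succ k ih =>
    rw [pow_succ, pow_mul, norm_one_sub_pow_prime_of_gt hpK, ih, div_div, pow_succ]
    refine (pow_le_pow_left₀ (norm_nonneg _) ?_ _).trans_lt h
    rw [ih]
    exact div_le_self (norm_nonneg _) (one_le_pow₀ hp1)

theorem pow_eq_one_of_norm_lt (hpK : ‖(p : K)‖ = (p : ℝ)⁻¹)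
    {γ : K} (hγ : γ ∈ GammaR p K) {n : ℕ}
    (h : ‖1 - γ‖ ^ (p ^ n * (p - 1)) < (p : ℝ)⁻¹) : γ ^ p ^ n = 1 := by
  have hp : p.Prime := Fact.out
  obtain ⟨k, hk⟩ := hγ
  have h2 := norm_one_sub_pow_eq_div hpK (norm_one_sub_pow_lt hpK h) k
  rw [← pow_mul, mul_comm, pow_mul, hk, one_pow, sub_self, norm_zero, eq_comm, div_eq_zero_iff] at h2
  have h3 := h2.resolve_right (pow_ne_zero _ (by exact_mod_cast hp.ne_zero))
  exact (sub_eq_zero.1 (norm_eq_zero.1 h3)).symm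

theorem norm_one_sub_pow_le_of_pow_eq_one (hpK : ‖(p : K)‖ = (p : ℝ)⁻¹)
    {γ : K} {n : ℕ} (hγ : γ ^ p ^ (n + 1) = 1) :
    ‖1 - γ‖ ^ (p ^ n * (p - 1)) ≤ (p : ℝ)⁻¹ := by
  have hp : p.Prime := Fact.out
  by_contra hlt
  rw [not_le] at hlt
  have hγ1 : ‖γ‖ = 1 := by
    refine (pow_eq_one_iff_of_nonneg (norm_nonneg _) (pow_ne_zero (n + 1) hp.ne_zero)).1 ?_
    rw [← norm_pow, hγ, norm_one]
  have h1 : ‖1 - γ‖ ≤ 1 := by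
    rw [sub_eq_add_neg]
    refine (IsUltrametricDist.norm_add_le_max _ _).trans ?_
    rw [norm_neg, norm_one, hγ1, max_self]
  have h := norm_one_sub_pow_of_lt hpK h1 hlt
  rw [hγ, sub_self, norm_zero, eq_comm] at h
  rw [eq_zero_of_pow_eq_zero h, zero_pow (mul_ne_zero (pow_ne_zero _ hp.ne_zero)
    (Nat.sub_ne_zero_of_lt hp.one_lt))] at hlt
  exact absurd hlt (not_lt.2 (by positivity))

end RootsOfUnity

section Radii

variable {K : Type*} [NontriviallyNormedField K] {p : ℕ}

/-- The hypotheses relating a multiplier `lam`, a closest `p`-power root of unity `γ₀` and the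
levels `s`, `t` of the radii `Rr p` locating `‖1 - lam‖` and `‖γ₀ - lam‖`. -/
structure MultiplierData (p : ℕ) (lam γ₀ : K) (s t : ℕ) : Prop where
  norm_p : ‖(p : K)‖ = (p : ℝ)⁻¹
  pos : 0 < ‖1 - lam‖
  lt_one : ‖1 - lam‖ < 1
  le_s : Rr p s ≤ ‖1 - lam‖
  lt_s : ‖1 - lam‖ < Rr p (s + 1)
  mem : γ₀ ∈ GammaR p K
  norm_min : ∀ γ ∈ GammaR p K, ‖γ₀ - lam‖ ≤ ‖γ - lam‖
  le_t : Rr p t ≤ ‖γ₀ - lam‖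
  lt_t : ‖γ₀ - lam‖ < Rr p (t + 1)

variable {lam γ₀ : K} {s t : ℕ}

theorem MultiplierData.norm_le (h : MultiplierData p lam γ₀ s t) : ‖γ₀ - lam‖ ≤ ‖1 - lam‖ :=
  h.norm_min 1 ⟨0, one_pow _⟩

variable [Fact p.Prime]

theorem Rr_succ_pow (n : ℕ) : 0 ≤ Rr p (n + 1) ∧ Rr p (n + 1) ^ (p ^ n * (p - 1)) = (p : ℝ)⁻¹ := by
  have hp : p.Prime := Fact.out
  have hp1 : (1 : ℝ) < p := by exact_mod_cast hp.one_lt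
  have hp0 : (0 : ℝ) < p := by linarith
  rw [Rr, if_neg n.succ_ne_zero, Nat.add_sub_cancel]
  refine ⟨by positivity, ?_⟩
  rw [← Real.rpow_natCast, ← Real.rpow_mul hp0.le, Nat.cast_mul, Nat.cast_pow,
    Nat.cast_sub hp.one_lt.le, Nat.cast_one, div_mul_cancel₀, Real.rpow_neg_one]
  have : (p : ℝ) - 1 ≠ 0 := by linarith
  positivity

theorem lt_Rr_succ_iff {x : ℝ} (hx : 0 ≤ x) (n : ℕ) :
    x < Rr p (n + 1) ↔ x ^ (p ^ n * (p - 1)) < (p : ℝ)⁻¹ := by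
  have hp : p.Prime := Fact.out
  obtain ⟨h0, h⟩ := Rr_succ_pow (p := p) n
  rw [← h, pow_lt_pow_iff_left₀ hx h0
    (mul_ne_zero (pow_ne_zero _ hp.ne_zero) (Nat.sub_ne_zero_of_lt hp.one_lt))]

theorem Rr_succ_le_iff {x : ℝ} (hx : 0 ≤ x) (n : ℕ) :
    Rr p (n + 1) ≤ x ↔ (p : ℝ)⁻¹ ≤ x ^ (p ^ n * (p - 1)) := by
  rw [← not_lt, lt_Rr_succ_iff hx, not_lt]

namespace MultiplierData

theorem pow_lt (h : MultiplierData p lam γ₀ s t) {n : ℕ} (hn : s ≤ n) :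
    ‖1 - lam‖ ^ (p ^ n * (p - 1)) < (p : ℝ)⁻¹ := by
  have hp : p.Prime := Fact.out
  refine (pow_le_pow_of_le_one (norm_nonneg _) h.lt_one.le ?_).trans_lt
    ((lt_Rr_succ_iff (norm_nonneg _) s).1 h.lt_s)
  exact Nat.mul_le_mul_right _ (Nat.pow_le_pow_right hp.pos hn)

theorem le_pow (h : MultiplierData p lam γ₀ s t) {n : ℕ} (hn : n + 1 ≤ s) :
    (p : ℝ)⁻¹ ≤ ‖1 - lam‖ ^ (p ^ n * (p - 1)) := by
  have hp : p.Prime := Fact.out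
  obtain ⟨s, rfl⟩ : ∃ s', s = s' + 1 := ⟨s - 1, by omega⟩
  refine ((Rr_succ_le_iff (norm_nonneg _) s).1 h.le_s).trans
    (pow_le_pow_of_le_one (norm_nonneg _) h.lt_one.le ?_)
  exact Nat.mul_le_mul_right _ (Nat.pow_le_pow_right hp.pos (by omega))

theorem t_le_s (h : MultiplierData p lam γ₀ s t) : t ≤ s := by
  by_contra hlt
  obtain ⟨t, rfl⟩ : ∃ t', t = t' + 1 := ⟨t - 1, by omega⟩
  have h1 := (Rr_succ_le_iff (norm_nonneg _) t).1 h.le_t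
  have h2 := h.pow_lt (n := t) (by omega)
  exact absurd (h1.trans (pow_le_pow_left₀ (norm_nonneg _) h.norm_le _)) (not_le.2 h2)

end MultiplierData

theorem norm_one_sub_pow_eq_of_forall [IsAlgClosed K] {ν : K} {N : ℕ} (hN : N ≠ 0) {r : ℝ}
    (h : ∀ γ : K, γ ^ N = 1 → ‖ν - γ‖ = r) : ‖1 - ν ^ N‖ = r ^ N := by
  have hmonic : (Polynomial.X ^ N - 1 : Polynomial K).Monic := Polynomial.monic_X_pow_sub_C 1 hN
  have hsplit := IsAlgClosed.splits (Polynomial.X ^ N - 1 : Polynomial K)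
  have heval := hsplit.eval_eq_prod_roots_of_monic hmonic ν
  have hcard := hsplit.natDegree_eq_card_roots
  have hdeg : (Polynomial.X ^ N - 1 : Polynomial K).natDegree = N :=
    Polynomial.natDegree_X_pow_sub_C (r := (1 : K))
  rw [Polynomial.eval_sub, Polynomial.eval_pow, Polynomial.eval_X, Polynomial.eval_one] at heval
  rw [norm_sub_rev, heval]
  change (normHom : K →*₀ ℝ) _ = _
  rw [map_multiset_prod, Multiset.map_map, Multiset.map_congr rfl (g := fun _ => r),
    Multiset.map_const', Multiset.prod_replicate, ← hcard, hdeg]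
  intro γ hγ
  refine h γ ?_
  have hroot := (Polynomial.mem_roots'.1 hγ).2
  rw [Polynomial.IsRoot, Polynomial.eval_sub, Polynomial.eval_pow, Polynomial.eval_X,
    Polynomial.eval_one, sub_eq_zero] at hroot
  exact hroot

variable [IsUltrametricDist K]

theorem norm_one_sub_le_of_Rr_le (hpK : ‖(p : K)‖ = (p : ℝ)⁻¹) {γ : K} {t : ℕ} {r : ℝ} (hr : 0 ≤ r)
    (hγ : γ ^ p ^ t = 1) (ht : Rr p t ≤ r) : ‖1 - γ‖ ≤ r := by
  have hp : p.Prime := Fact.out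
  cases t with
  | zero =>
    rw [pow_zero, pow_one] at hγ
    simpa [hγ] using hr
  | succ t =>
    rw [Rr_succ_le_iff hr] at ht
    exact (pow_le_pow_iff_left₀ (norm_nonneg _) hr (mul_ne_zero (pow_ne_zero _ hp.ne_zero)
      (Nat.sub_ne_zero_of_lt hp.one_lt))).1
      ((norm_one_sub_pow_le_of_pow_eq_one hpK hγ).trans ht)

namespace MultiplierData

theorem gamma_pow (h : MultiplierData p lam γ₀ s t) : γ₀ ^ p ^ s = 1 := by
  refine pow_eq_one_of_norm_lt h.norm_p h.mem ?_
  refine (pow_le_pow_left₀ (norm_nonneg _) ?_ _).trans_lt (h.pow_lt le_rfl)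
  have : 1 - γ₀ = (1 - lam) + -(γ₀ - lam) := by ring
  rw [this]
  refine (IsUltrametricDist.norm_add_le_max _ _).trans ?_
  rw [norm_neg, max_eq_left h.norm_le]

theorem norm_one_sub_pow_small (h : MultiplierData p lam γ₀ s t) {n : ℕ} (hn : n + 1 ≤ s) :
    ‖1 - lam ^ p ^ n‖ = ‖1 - lam‖ ^ p ^ n :=
  norm_one_sub_pow_of_le h.norm_p h.pos h.lt_one (h.le_pow hn)

theorem norm_one_sub_pow_large (h : MultiplierData p lam γ₀ s t) {n : ℕ} (hn : s ≤ n) :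
    ‖1 - lam ^ p ^ (n + 1)‖ = ‖1 - lam ^ p ^ n‖ / p := by
  rw [pow_succ, pow_mul]
  exact norm_one_sub_pow_prime_of_gt h.norm_p (norm_one_sub_pow_lt h.norm_p (h.pow_lt hn))

theorem norm_one_sub_pow_s [IsAlgClosed K] (h : MultiplierData p lam γ₀ s t) :
    ‖1 - lam ^ p ^ s‖ = ‖γ₀ - lam‖ ^ p ^ t / (p : ℝ) ^ (s - t) := by
  have hp : p.Prime := Fact.out
  have hγ0 : γ₀ ≠ 0 := by
    rintro rfl
    have := h.gamma_pow
    rw [zero_pow (pow_ne_zero _ hp.ne_zero)] at this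
    exact zero_ne_one this
  have hγ1 : ‖γ₀‖ = 1 := by
    refine (pow_eq_one_iff_of_nonneg (norm_nonneg _) (pow_ne_zero s hp.ne_zero)).1 ?_
    rw [← norm_pow, h.gamma_pow, norm_one]
  have hmul : ∀ γ, ‖lam / γ₀ - γ‖ = ‖γ * γ₀ - lam‖ := by
    intro γ
    rw [← mul_one ‖lam / γ₀ - γ‖, ← hγ1, ← norm_mul, sub_mul, div_mul_cancel₀ _ hγ0, norm_sub_rev]
  have hν : ‖1 - (lam / γ₀) ^ p ^ t‖ = ‖γ₀ - lam‖ ^ p ^ t := by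
    refine norm_one_sub_pow_eq_of_forall (pow_ne_zero t hp.ne_zero) fun γ hγ => ?_
    rw [hmul]
    refine le_antisymm ?_ (h.norm_min _ ?_)
    · have : γ * γ₀ - lam = (γ₀ - lam) + -((1 - γ) * γ₀) := by ring
      rw [this]
      refine (IsUltrametricDist.norm_add_le_max _ _).trans (max_le le_rfl ?_)
      rw [norm_neg, norm_mul, hγ1, mul_one]
      exact norm_one_sub_le_of_Rr_le h.norm_p (norm_nonneg _) hγ h.le_t
    · refine ⟨t + s, ?_⟩
      rw [mul_pow, pow_add, pow_mul, hγ, one_pow, mul_comm (p ^ t), pow_mul, h.gamma_pow, one_pow,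
        mul_one]
  have hs : lam ^ p ^ s = ((lam / γ₀) ^ p ^ t) ^ p ^ (s - t) := by
    rw [← pow_mul, ← pow_add, Nat.add_sub_cancel' h.t_le_s, div_pow, h.gamma_pow, div_one]
  rw [hs, norm_one_sub_pow_eq_div h.norm_p, hν]
  rw [hν, ← pow_mul]
  exact (lt_Rr_succ_iff (norm_nonneg _) t).1 h.lt_t

end MultiplierData

end Radii

section Psi

variable {K : Type*} [NontriviallyNormedField K] {p : ℕ} {lam γ₀ : K} {s t : ℕ}

theorem PsiL_nonneg : 0 ≤ PsiL p lam γ₀ s t := by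
  unfold PsiL
  positivity

variable [Fact p.Prime]

theorem PsiL_pow_mul (hpos : 0 < ‖1 - lam‖) (hts : t ≤ s + 1) :
    PsiL p lam γ₀ (s + 1) t ^ p ^ (s + 1) * ‖1 - lam‖ ^ p ^ s =
      ‖γ₀ - lam‖ ^ p ^ t / (p : ℝ) ^ (s + 1 - t) := by
  have hp : p.Prime := Fact.out
  have hp0 : (0 : ℝ) < p := by exact_mod_cast hp.pos
  have h1 : (‖1 - lam‖ ^ (-(1 : ℝ) / (p : ℝ))) ^ p ^ (s + 1) * ‖1 - lam‖ ^ p ^ s = 1 := by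
    rw [← Real.rpow_natCast, ← Real.rpow_mul hpos.le, ← Real.rpow_natCast, ← Real.rpow_add hpos]
    convert Real.rpow_zero _
    push_cast
    rw [pow_succ]
    field_simp
    ring
  have h2 : ((p : ℝ) ^ (-((((s + 1 : ℕ) : ℝ) - (t : ℝ)) / (p : ℝ) ^ (s + 1)))) ^ p ^ (s + 1) =
      ((p : ℝ) ^ (s + 1 - t))⁻¹ := by
    rw [← Real.rpow_natCast _ (p ^ (s + 1)), ← Real.rpow_mul hp0.le, ← Real.rpow_natCast _ (s + 1 - t),
      ← Real.rpow_neg hp0.le]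
    congr 1
    rw [Nat.cast_sub hts, Nat.cast_pow]
    field_simp
  have h3 : (‖γ₀ - lam‖ ^ ((1 : ℝ) / (p : ℝ) ^ (((s + 1 : ℕ) : ℝ) - (t : ℝ)))) ^ p ^ (s + 1) =
      ‖γ₀ - lam‖ ^ p ^ t := by
    rw [← Nat.cast_sub hts, Real.rpow_natCast]
    rw [← Real.rpow_natCast, ← Real.rpow_mul (norm_nonneg _), ← Real.rpow_natCast _ (p ^ t)]
    congr 1
    push_cast
    rw [one_div, inv_mul_eq_iff_eq_mul₀ (by positivity), ← pow_add, Nat.sub_add_cancel hts]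
  rw [PsiL, mul_pow, mul_pow, h2, h3]
  rw [mul_right_comm, mul_right_comm _ _ (‖1 - lam‖ ^ p ^ s), h1, one_mul, mul_comm,
    div_eq_mul_inv]

variable [IsUltrametricDist K]

theorem MultiplierData.lt_PsiL_of_eq (h : MultiplierData p lam γ₀ s s) :
    ‖1 - lam‖ < PsiL p lam γ₀ s s := by
  have hp : p.Prime := Fact.out
  have hp0 : (0 : ℝ) < p := by exact_mod_cast hp.pos
  have hG : ‖γ₀ - lam‖ = ‖1 - lam‖ := by
    refine le_antisymm h.norm_le ?_
    have h1 := norm_one_sub_le_of_Rr_le h.norm_p (norm_nonneg _) h.gamma_pow h.le_t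
    rw [← sub_add_sub_cancel 1 γ₀ lam]
    exact (IsUltrametricDist.norm_add_le_max _ _).trans (max_le h1 le_rfl)
  rw [PsiL, hG, sub_self, zero_div, neg_zero, Real.rpow_zero, div_one, Real.rpow_one, mul_one]
  refine lt_mul_of_one_lt_left h.pos (Real.one_lt_rpow_of_pos_of_lt_one_of_neg h.pos h.lt_one ?_)
  exact div_neg_of_neg_of_pos (by norm_num) hp0

theorem MultiplierData.pow_eq_of_lt (h : MultiplierData p lam γ₀ (s + 1) t) (hts : t ≤ s) :
    ‖1 - lam‖ ^ (p ^ s * (p - 1)) = (p : ℝ)⁻¹ := by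
  have hp : p.Prime := Fact.out
  refine le_antisymm ?_ (h.le_pow le_rfl)
  have hlt : ‖γ₀ - lam‖ < ‖1 - lam‖ := by
    refine lt_of_pow_lt_pow_left₀ (p ^ s * (p - 1)) (norm_nonneg _) ?_
    refine lt_of_le_of_lt ?_ (((lt_Rr_succ_iff (norm_nonneg _) t).1 h.lt_t).trans_le
      (h.le_pow le_rfl))
    exact pow_le_pow_of_le_one (norm_nonneg _) (h.norm_le.trans h.lt_one.le)
      (Nat.mul_le_mul_right _ (Nat.pow_le_pow_right hp.pos hts))
  have hγ : ‖1 - γ₀‖ = ‖1 - lam‖ := by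
    apply IsNearTranslation.norm_eq_of_norm_sub_lt
    rwa [sub_sub_sub_cancel_left, norm_sub_rev]
  rw [← hγ]
  exact norm_one_sub_pow_le_of_pow_eq_one h.norm_p h.gamma_pow

theorem MultiplierData.PsiL_le_iff (hp3 : 3 ≤ p) (h : MultiplierData p lam γ₀ s t) :
    PsiL p lam γ₀ s t ≤ ‖1 - lam‖ ↔
      (t + 2 ≤ s ∨ (s = t + 1 ∧ ‖γ₀ - lam‖ ≤ ‖1 - lam‖ ^ 2)) := by
  have hp : p.Prime := Fact.out
  rcases h.t_le_s.eq_or_lt with rfl | hlt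
  · refine iff_of_false (not_le.2 h.lt_PsiL_of_eq) ?_
    omega
  obtain ⟨s, rfl⟩ : ∃ s', s = s' + 1 := ⟨s - 1, by omega⟩
  have hts : t ≤ s := by omega
  have hL := h.pow_eq_of_lt hts
  have hpos := h.pos
  have hiff : PsiL p lam γ₀ (s + 1) t ≤ ‖1 - lam‖ ↔
      ‖γ₀ - lam‖ ^ p ^ t * ‖1 - lam‖ ^ (p ^ s * (p - 1) * (s + 1 - t)) ≤
        ‖1 - lam‖ ^ (p ^ s * (p + 1)) := by
    rw [← pow_le_pow_iff_left₀ PsiL_nonneg hpos.le (pow_ne_zero (s + 1) hp.ne_zero),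
      ← mul_le_mul_iff_left₀ (pow_pos hpos (p ^ s)), PsiL_pow_mul hpos h.t_le_s, ← pow_add, pow_mul,
      hL, inv_pow, ← div_eq_mul_inv, mul_add, mul_one, ← pow_succ]
  rw [hiff]
  rcases hts.eq_or_lt with rfl | hlt'
  · have h1 : ‖γ₀ - lam‖ ^ p ^ t * ‖1 - lam‖ ^ (p ^ t * (p - 1) * (t + 1 - t)) =
        (‖γ₀ - lam‖ * ‖1 - lam‖ ^ (p - 1)) ^ p ^ t := by
      rw [Nat.add_sub_cancel_left, mul_one, mul_pow, ← pow_mul, mul_comm (p ^ t)]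
    have h2 : ‖1 - lam‖ ^ (p ^ t * (p + 1)) = (‖1 - lam‖ ^ 2 * ‖1 - lam‖ ^ (p - 1)) ^ p ^ t := by
      rw [← pow_add, ← pow_mul, mul_comm (p ^ t)]
      congr 2
      omega
    rw [h1, h2, pow_le_pow_iff_left₀ (by positivity) (by positivity) (pow_ne_zero t hp.ne_zero),
      mul_le_mul_iff_left₀ (pow_pos hpos _)]
    constructor
    · exact fun hle => Or.inr ⟨rfl, hle⟩
    · rintro (hle | ⟨-, hle⟩)
      · omega
      · exact hle
  · refine iff_of_true ?_ (Or.inl (by omega))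
    refine (mul_le_of_le_one_left (by positivity)
      (pow_le_one₀ (norm_nonneg _) (h.norm_le.trans h.lt_one.le))).trans ?_
    refine pow_le_pow_of_le_one hpos.le h.lt_one.le ?_
    rw [mul_assoc]
    refine Nat.mul_le_mul_left _ ?_
    have h2 : 2 ≤ s + 1 - t := by omega
    calc p + 1 ≤ (p - 1) * 2 := by omega
      _ ≤ (p - 1) * (s + 1 - t) := Nat.mul_le_mul_left _ h2

end Psi

section Localization

variable {K : Type*} [NontriviallyNormedField K] {p : ℕ} [Fact p.Prime]
  {lam γ₀ : K} {s t : ℕ}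

theorem eq_rpow_of_pow_eq {a b r : ℝ} {n : ℕ} (ha : 0 ≤ a) (hb : 0 ≤ b) (hn : n ≠ 0)
    (h : a ^ n = b ^ (r * n)) : a = b ^ r := by
  rw [Real.rpow_mul hb, Real.rpow_natCast] at h
  exact (pow_left_inj₀ ha (Real.rpow_nonneg hb r) hn).1 h

theorem MultiplierData.lt_rpow_of_lt (h : MultiplierData p lam γ₀ s t) {n : ℕ}
    (hn : s < n) : ‖1 - lam‖ < (p : ℝ) ^ (-(1 : ℝ) / (p : ℝ) ^ n) := by
  have hp : p.Prime := Fact.out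
  have hp0 : (p : ℝ) ≠ 0 := by exact_mod_cast hp.ne_zero
  obtain ⟨n, rfl⟩ : ∃ m, n = m + 1 := ⟨n - 1, by omega⟩
  refine lt_of_pow_lt_pow_left₀ (p ^ (n + 1)) (by positivity) ?_
  rw [← Real.rpow_natCast _ (p ^ (n + 1)), ← Real.rpow_natCast _ (p ^ (n + 1)),
    ← Real.rpow_mul p.cast_nonneg, Nat.cast_pow, div_mul_cancel₀ _ (pow_ne_zero _ hp0),
    Real.rpow_neg_one, ← Nat.cast_pow, Real.rpow_natCast]
  refine lt_of_le_of_lt (pow_le_pow_of_le_one h.pos.le h.lt_one.le ?_)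
    (h.pow_lt (n := n) (by omega))
  rw [pow_succ]
  exact Nat.mul_le_mul_left _ (Nat.sub_le _ _)

variable [IsUltrametricDist K]

theorem MultiplierData.eq_rpow_of_succ_lt (h : MultiplierData p lam γ₀ s t) {n : ℕ}
    (hn : n + 2 ≤ s) {r : ℝ} (hr : 0 ≤ r)
    (heq : ‖1 - lam ^ p ^ (n + 1)‖ = ‖1 - lam ^ p ^ n‖ * r ^ p ^ (n + 1)) :
    r = ‖1 - lam‖ ^ (((p : ℝ) - 1) / (p : ℝ)) := by
  have hp : p.Prime := Fact.out
  have hp0 : (p : ℝ) ≠ 0 := by exact_mod_cast hp.ne_zero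
  rw [h.norm_one_sub_pow_small hn, h.norm_one_sub_pow_small (by omega)] at heq
  refine eq_rpow_of_pow_eq hr (norm_nonneg _) (pow_ne_zero (n + 1) hp.ne_zero) ?_
  refine mul_left_cancel₀ (pow_pos h.pos (p ^ n)).ne' (heq.symm.trans ?_)
  rw [← Real.rpow_natCast _ (p ^ n), ← Real.rpow_natCast _ (p ^ (n + 1)), ← Real.rpow_add h.pos]
  congr 1
  push_cast
  rw [pow_succ]
  field_simp
  ring

theorem MultiplierData.eq_PsiL [IsAlgClosed K] (h : MultiplierData p lam γ₀ (s + 1) t)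
    {r : ℝ} (hr : 0 ≤ r)
    (heq : ‖1 - lam ^ p ^ (s + 1)‖ = ‖1 - lam ^ p ^ s‖ * r ^ p ^ (s + 1)) :
    r = PsiL p lam γ₀ (s + 1) t := by
  have hp : p.Prime := Fact.out
  rw [h.norm_one_sub_pow_s, h.norm_one_sub_pow_small le_rfl, ← PsiL_pow_mul h.pos h.t_le_s,
    mul_comm] at heq
  exact ((pow_left_inj₀ PsiL_nonneg hr (pow_ne_zero (s + 1) hp.ne_zero)).1
    (mul_left_cancel₀ (pow_pos h.pos _).ne' heq)).symm

theorem MultiplierData.eq_rpow_of_le (h : MultiplierData p lam γ₀ s t) {n : ℕ} (hn : s ≤ n)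
    (hne : lam ^ p ^ n ≠ 1) {r : ℝ} (hr : 0 ≤ r)
    (heq : ‖1 - lam ^ p ^ (n + 1)‖ = ‖1 - lam ^ p ^ n‖ * r ^ p ^ (n + 1)) :
    r = (p : ℝ) ^ (-(1 : ℝ) / (p : ℝ) ^ (n + 1)) := by
  have hp : p.Prime := Fact.out
  have hp0 : (p : ℝ) ≠ 0 := by exact_mod_cast hp.ne_zero
  rw [h.norm_one_sub_pow_large hn, div_eq_mul_inv] at heq
  have hpow := mul_left_cancel₀ (norm_ne_zero_iff.2 (sub_ne_zero.2 hne.symm)) heq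
  refine eq_rpow_of_pow_eq hr p.cast_nonneg (pow_ne_zero (n + 1) hp.ne_zero) ?_
  rw [← hpow, Nat.cast_pow, div_mul_cancel₀ _ (pow_ne_zero _ hp0), Real.rpow_neg_one]

theorem exists_isMinPeriodicPt {α : Type*} {f : α → α} {x : α} {q : ℕ} (hq : 1 ≤ q)
    (h : f^[q] x = x) : ∃ n, 1 ≤ n ∧ IsMinPeriodicPt f n x := by
  classical
  have hex : ∃ n, 1 ≤ n ∧ f^[n] x = x := ⟨q, hq, h⟩
  refine ⟨Nat.find hex, (Nat.find_spec hex).1, (Nat.find_spec hex).2, fun j hj hlt hfix => ?_⟩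
  exact Nat.find_min hex hlt ⟨hj, hfix⟩

end Localization

/-- Lemma: localization of all periodic orbits of minimally ramified
quadratic-like maps. For `p ≥ 3`, `0 < |1-λ| < 1`, `|a₂| = 1`, `|a₂² - a₃| = 1`: every
periodic point of `f` in the open unit disk has minimal period a power of `p`; the fixed
points are `0` and one further point `x₀` with `|x₀| = |1-λ|`; minimal period `p^n` points
(`1 ≤ n ≤ s-1`, `s ≥ 2`) lie on the sphere of radius `|1-λ|^{(p-1)/p}`; minimal period
`p^s` points (`s ≥ 1`) on the sphere of radius `Ψ(λ)`; minimal period `p^n` points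
(`n ≥ s+1`) on the sphere of radius `p^{-1/p^n}`. In particular, apart from `0`, `f` has
no periodic point in `D_ρ(0)`, `ρ = min{|1-λ|, Ψ(λ)}`; and `ρ = Ψ(λ)` iff `s-t ≥ 2`, or
`s-t = 1` and `|γ₀-λ| ≤ |1-λ|²`. -/
theorem stmt13 (p : ℕ) [Fact p.Prime] (hp3 : 3 ≤ p)
    {K : Type*} [NontriviallyNormedField K] [IsUltrametricDist K] [CompleteSpace K]
    [IsAlgClosed K] [Algebra ℚ_[p] K]
    (hiso : ∀ x : ℚ_[p], ‖algebraMap ℚ_[p] K x‖ = ‖x‖)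
    (hdense : Dense {x : K | IsAlgebraic ℚ_[p] x})
    (lam : K) (hroot : ∀ n : ℕ, 1 ≤ n → lam ^ n ≠ 1)
    (hlam1 : 0 < ‖1 - lam‖) (hlam2 : ‖1 - lam‖ < 1)
    (s : ℕ) (hs : Rr p s ≤ ‖1 - lam‖ ∧ ‖1 - lam‖ < Rr p (s + 1))
    (γ₀ : K) (hγ₀ : γ₀ ∈ GammaR p K)
    (hγmin : ∀ γ ∈ GammaR p K, ‖γ₀ - lam‖ ≤ ‖γ - lam‖)
    (t : ℕ) (ht : Rr p t ≤ ‖γ₀ - lam‖ ∧ ‖γ₀ - lam‖ < Rr p (t + 1))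
    (c : ℕ → K) (hc0 : c 0 = 0) (hc1 : c 1 = lam) (hc : ∀ i, ‖c i‖ ≤ 1)
    (hc2 : ‖c 2‖ = 1) (hc3 : ‖c 2 ^ 2 - c 3‖ = 1) :
    (∀ x : K, ‖x‖ < 1 → ∀ q : ℕ, 1 ≤ q → IsMinPeriodicPt (pEval c) q x →
      ∃ n : ℕ, q = p ^ n) ∧
    (∃ x₀ : K, x₀ ≠ 0 ∧ ‖x₀‖ = ‖1 - lam‖ ∧ pEval c x₀ = x₀ ∧
      ∀ x : K, ‖x‖ < 1 → pEval c x = x → x = 0 ∨ x = x₀) ∧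
    (2 ≤ s → ∀ n : ℕ, 1 ≤ n → n ≤ s - 1 → ∀ x : K, ‖x‖ < 1 →
      IsMinPeriodicPt (pEval c) (p ^ n) x → ‖x‖ = ‖1 - lam‖ ^ (((p : ℝ) - 1) / (p : ℝ))) ∧
    (1 ≤ s → ∀ x : K, ‖x‖ < 1 →
      IsMinPeriodicPt (pEval c) (p ^ s) x → ‖x‖ = PsiL p lam γ₀ s t) ∧
    (∀ n : ℕ, s + 1 ≤ n → ∀ x : K, ‖x‖ < 1 →
      IsMinPeriodicPt (pEval c) (p ^ n) x → ‖x‖ = (p : ℝ) ^ (-(1 : ℝ) / (p : ℝ) ^ n)) ∧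
    (∀ x : K, ‖x‖ < min ‖1 - lam‖ (PsiL p lam γ₀ s t) → x ≠ 0 →
      ∀ q : ℕ, 1 ≤ q → (pEval c)^[q] x ≠ x) ∧
    (min ‖1 - lam‖ (PsiL p lam γ₀ s t) = PsiL p lam γ₀ s t ↔
      (t + 2 ≤ s ∨ (s = t + 1 ∧ ‖γ₀ - lam‖ ≤ ‖1 - lam‖ ^ 2))) := by
  have hp : p.Prime := Fact.out
  have hnat : ∀ m : ℕ, ‖(m : K)‖ = ‖(m : ℚ_[p])‖ := fun m => by rw [← hiso, map_natCast]
  have hnorm_p : ‖(p : K)‖ = (p : ℝ)⁻¹ := (hnat p).trans Padic.norm_p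
  have hunit : ∀ m : ℕ, ¬ p ∣ m → ‖(m : K)‖ = 1 := fun m hm =>
    (hnat m).trans (Padic.norm_natCast_eq_one_iff.2 (hp.coprime_iff_not_dvd.2 hm))
  have hp_lt : ‖(p : K)‖ < 1 := by
    rw [hnorm_p]
    exact inv_lt_one_of_one_lt₀ (by exact_mod_cast hp.one_lt)
  have hdata : MultiplierData p lam γ₀ s t :=
    ⟨hnorm_p, hlam1, hlam2, hs.1, hs.2, hγ₀, hγmin, ht.1, ht.2⟩
  subst hc1
  have hc1 : ‖c 1 - 1‖ < 1 := by rwa [norm_sub_rev]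
  have hperiod : ∀ x : K, ‖x‖ < 1 → ∀ q : ℕ, 1 ≤ q → IsMinPeriodicPt (pEval c) q x →
      ∃ n : ℕ, q = p ^ n := fun x hx q hq h =>
    (isNearTranslation_pEval hc0 hc hc1).exists_eq_prime_pow hp hunit hx hq h
  have hsmall : ∀ n : ℕ, 1 ≤ n → n + 1 ≤ s → ∀ x : K, ‖x‖ < 1 →
      IsMinPeriodicPt (pEval c) (p ^ n) x →
        ‖x‖ = ‖1 - c 1‖ ^ (((p : ℝ) - 1) / (p : ℝ)) := by
    intro n hn hns x hx h
    obtain ⟨n, rfl⟩ : ∃ m, n = m + 1 := ⟨n - 1, by omega⟩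
    exact hdata.eq_rpow_of_succ_lt hns (norm_nonneg _)
      (norm_sub_eq_mul_of_isMinPeriodicPt hp3 hp_lt hc0 hc hc1 hc2 hc3 hx h)
  have hmid : 1 ≤ s → ∀ x : K, ‖x‖ < 1 →
      IsMinPeriodicPt (pEval c) (p ^ s) x → ‖x‖ = PsiL p (c 1) γ₀ s t := by
    intro hs1 x hx h
    obtain ⟨s, rfl⟩ : ∃ m, s = m + 1 := ⟨s - 1, by omega⟩
    exact hdata.eq_PsiL (norm_nonneg _)
      (norm_sub_eq_mul_of_isMinPeriodicPt hp3 hp_lt hc0 hc hc1 hc2 hc3 hx h)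
  have hlarge : ∀ n : ℕ, s + 1 ≤ n → ∀ x : K, ‖x‖ < 1 →
      IsMinPeriodicPt (pEval c) (p ^ n) x → ‖x‖ = (p : ℝ) ^ (-(1 : ℝ) / (p : ℝ) ^ n) := by
    intro n hn x hx h
    obtain ⟨n, rfl⟩ : ∃ m, n = m + 1 := ⟨n - 1, by omega⟩
    exact hdata.eq_rpow_of_le (by omega) (hroot _ (Nat.one_le_pow _ _ hp.pos)) (norm_nonneg _)
      (norm_sub_eq_mul_of_isMinPeriodicPt hp3 hp_lt hc0 hc hc1 hc2 hc3 hx h)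
  have hfixed := exists_fixedPoint_pEval hc0 hc hlam1 hlam2 hc2
  refine ⟨hperiod, hfixed, fun hs2 n hn hns => hsmall n hn (by omega), hmid, hlarge, ?_, ?_⟩
  · intro x hx hx0 q hq hqx
    obtain ⟨hxL, hxPsi⟩ := lt_min_iff.1 hx
    have hx1 : ‖x‖ < 1 := hxL.trans hlam2
    obtain ⟨q, hq, hmin⟩ := exists_isMinPeriodicPt hq hqx
    obtain ⟨n, rfl⟩ := hperiod x hx1 q hq hmin
    rcases Nat.eq_zero_or_pos n with rfl | hn
    · obtain ⟨x₀, -, hx₀, -, huniq⟩ := hfixed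
      rcases huniq x hx1 (by simpa using hmin.1) with rfl | rfl
      · exact hx0 rfl
      · exact hxL.ne hx₀
    rcases lt_trichotomy n s with hlt | rfl | hgt
    · rw [hsmall n hn hlt x hx1 hmin] at hxL
      refine hxL.not_ge (Real.self_le_rpow_of_le_one hlam1.le hlam2.le ?_)
      have hp0 : (0 : ℝ) < p := by exact_mod_cast hp.pos
      rw [div_le_one hp0]
      linarith
    · exact hxPsi.ne (hmid hn x hx1 hmin)
    · rw [hlarge n hgt x hx1 hmin] at hxL
      exact hxL.not_gt (hdata.lt_rpow_of_lt hgt)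
  · rw [min_eq_right_iff]
    exact hdata.PsiL_le_iff hp3
end
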